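/- arXiv:2308.10853 — 2 statements merged into one kernel-verified Lean document; each statement's English description precedes it below -/
import Mathlib

section
/- Let q be an odd prime power, d ≥ 2, and let Q be a non-degenerate quadratic form on F_q^d, with associated distance φ(x,y) = Q(x−y). Fix t ∈ F_q \ {0}, let E ⊆ F_q^d, and let C_4 denote the number of 4-tuples (x_1, x_2, x_3, x_4) ∈ E^4 with φ(x_1,x_2) = φ(x_2,x_3) = φ(x_3,x_4) = φ(x_4,x_1) = t. Let γ = −1 if d = 2 and γ = −(d−2)/2 if d ≥ 3. Suppose 12 q^γ + 8 q^{d+2}/|E|² + 48 q^{(d+1)/2}/|E| ≤ 1. Then | C_4 − |E|^4/q^4 | ≤ (|E|^4/q^4) ( 12 q^γ + 8 q^{d+2}/|E|² + 28 q^{(d+1)/2}/|E| ). -/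
open Finset
open Polynomial in
theorem kl_nosq {F : Type*} [Field F] [Fintype F] (h2 : (2:F) ≠ 0) (a : F) (ha : a ≠ 0)
    (r s : F[X]) (hs : r ^ 2 = C (-4*a) * s ^ 2 * ((X ^ Fintype.card F - X) ^ 2 - C (4*a))) :
    r = 0 ∧ s = 0 := by
  have h4 : (4:F) ≠ 0 := by
    have : (4:F) = 2*2 := by norm_num
    rw [this]; exact mul_ne_zero h2 h2
  have hc : -4*a ≠ 0 := by
    rw [neg_mul]; exact neg_ne_zero.mpr (mul_ne_zero h4 ha)
  by_cases hs0 : s = 0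
  · subst hs0
    simp at hs
    exact ⟨hs, rfl⟩
  exfalso
  have hdvd : s ^ 2 ∣ r ^ 2 := by
    rw [hs]; exact ⟨C (-4*a) * ((X ^ Fintype.card F - X) ^ 2 - C (4*a)), by ring⟩
  have hdvd' : s ∣ r := (UniqueFactorizationMonoid.pow_dvd_pow_iff_dvd two_ne_zero).1 hdvd
  obtain ⟨h, rfl⟩ := hdvd'
  have hh : h ^ 2 = C (-4*a) * ((X ^ Fintype.card F - X) ^ 2 - C (4*a)) := by
    have : s ^ 2 * h ^ 2 = s ^ 2 * (C (-4*a) * ((X ^ Fintype.card F - X) ^ 2 - C (4*a))) := by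
      rw [← mul_pow, hs]; ring
    exact mul_left_cancel₀ (pow_ne_zero 2 hs0) this
  have hq : (Fintype.card F : F[X]) = 0 := by
    have := FiniteField.cast_card_eq_zero F
    rw [← C_eq_natCast, this, C_0]
  have hq1 := Fintype.one_lt_card (α := F)
  have hder := congrArg derivative hh
  simp [derivative_pow] at hder
  have h1 : h ∣ (X ^ Fintype.card F - X) := by
    have : h ∣ C (8*a) * (X ^ Fintype.card F - X) := by
      refine ⟨2 * derivative h, ?_⟩
      have e : C (8*a) = C 2 * (C 4 * C a) := by rw [← C_mul, ← C_mul]; congr 1; ring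
      have e2 : (C 2 : F[X]) = 2 := rfl
      have e4 : (C 4 : F[X]) = 4 := rfl
      simp only [e2, e4] at e hder
      rw [e]
      linear_combination hder.symm
    have h8 : (8*a) ≠ 0 := by
      have : (8:F) = 2*4 := by norm_num
      rw [this]; exact mul_ne_zero (mul_ne_zero h2 h4) ha
    exact ((isUnit_C.mpr (isUnit_iff_ne_zero.mpr h8)).dvd_mul_left).1 this
  have h3 : h ∣ C (-4*a) * C (4*a) := by
    have e : C (-4*a) * C (4*a) = C (-4*a) * (X ^ Fintype.card F - X) * (X ^ Fintype.card F - X) - h * h := by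
      linear_combination hh
    rw [e]
    exact dvd_sub (h1.mul_left _) (dvd_mul_right _ _)
  have hu : IsUnit h := by
    refine isUnit_of_dvd_unit h3 ?_
    rw [← C_mul]
    exact isUnit_C.mpr (isUnit_iff_ne_zero.mpr (mul_ne_zero hc (mul_ne_zero h4 ha)))
  have hd0 := natDegree_eq_zero_of_isUnit hu
  have hd1 : natDegree (h ^ 2) = 2 * Fintype.card F := by
    have e1 : natDegree ((X:F[X]) ^ Fintype.card F - X) = Fintype.card F :=
      FiniteField.X_pow_card_sub_X_natDegree_eq F hq1
    rw [hh, natDegree_C_mul hc, natDegree_sub_C, natDegree_pow, e1]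
  rw [natDegree_pow, hd0] at hd1
  omega
open Polynomial in
theorem kl_stepanov {F L : Type*} [Field F] [Fintype F] [Field L] [Fintype L] [Algebra F L]
    (h2 : (2:F) ≠ 0) (a : F) (ha : a ≠ 0) (m h : ℕ) (hP : Fintype.card F ^ m = 2 * h + 1)
    (hL : Fintype.card L = (2 * h + 1) ^ 2) (hh : Fintype.card F + 2 ≤ h) (S : Finset L)
    (hS : ∀ y ∈ S, ((y ^ Fintype.card F - y) ^ 2 - algebraMap F L (4*a)) ^ (2 * h * (h + 1)) = -1) :
    2 * S.card ≤ (2 * h + 1) ^ 2 + 4 * Fintype.card F * (2 * h + 1) := by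
  classical
  set q := Fintype.card F with hq
  have hq1 : 1 < q := Fintype.one_lt_card (α := F)
  set f : F[X] := (X ^ q - X) ^ 2 - C (4*a) with hf
  have e1 : natDegree ((X:F[X]) ^ q - X) = q :=
      FiniteField.X_pow_card_sub_X_natDegree_eq F hq1
  have hfd : f.natDegree = 2 * q := by
    rw [hf, natDegree_sub_C, natDegree_pow, e1]
  have hf0 : f.coeff 0 = -4*a := by
    rw [coeff_zero_eq_eval_zero, hf]
    simp [show q ≠ 0 by omega]
  set P := 2 * h + 1 with hPdef
  have hP0 : 0 < P := by omega
  set J := h + q with hJ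
  set T := P * (h - 1) + q + J with hT
  have hfp : (f ^ (h+1)).natDegree ≤ q * (P + 1) := by
    refine natDegree_pow_le.trans ?_
    rw [hfd, hPdef]; nlinarith
  let Φ₀ : (Fin J → degreeLT F h × degreeLT F (h - q)) →ₗ[F] F[X] :=
    ∑ j : Fin J, (LinearMap.mulRight F ((X:F[X])^(j:ℕ))) ∘ₗ
      (((expand F P).toLinearMap ∘ₗ (degreeLT F h).subtype ∘ₗ LinearMap.fst F _ _) -
       (LinearMap.mulRight F (f^(h+1))) ∘ₗ (expand F P).toLinearMap ∘ₗ
        (degreeLT F (h-q)).subtype ∘ₗ LinearMap.snd F _ _) ∘ₗ LinearMap.proj j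
  have hΦ₀ : ∀ v, Φ₀ v = ∑ j : Fin J, (expand F P ((v j).1 : F[X]) -
      expand F P ((v j).2 : F[X]) * f ^ (h+1)) * X ^ (j:ℕ) := by
    intro v
    simp [Φ₀]
  have hmem : ∀ v, Φ₀ v ∈ degreeLT F T := by
    intro v
    rw [hΦ₀]
    refine Submodule.sum_mem _ fun j _ => ?_
    rw [mem_degreeLT]
    have hr := (v j).1.2
    have hs := (v j).2.2
    rw [mem_degreeLT] at hr hs
    have hj := j.2
    refine lt_of_le_of_lt (b := ((T - 1 : ℕ) : WithBot ℕ)) ?_ (by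
      rw [Nat.cast_lt]; omega)
    rw [← natDegree_le_iff_degree_le]
    have hr' : ((v j).1 : F[X]).natDegree ≤ h - 1 := by
      by_cases h0 : ((v j).1 : F[X]) = 0
      · rw [h0]; simp
      · have := (natDegree_lt_iff_degree_lt h0).2 hr
        omega
    have hs' : ((v j).2 : F[X]).natDegree ≤ h - q - 1 := by
      by_cases h0 : ((v j).2 : F[X]) = 0
      · rw [h0]; simp
      · have := (natDegree_lt_iff_degree_lt h0).2 hs
        omega
    refine natDegree_mul_le.trans ?_
    rw [natDegree_X_pow]
    have : (expand F P ((v j).1 : F[X]) -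
      expand F P ((v j).2 : F[X]) * f ^ (h+1)).natDegree ≤ P * (h - 1) + q := by
      refine (natDegree_sub_le _ _).trans (max_le ?_ ?_)
      · rw [natDegree_expand]
        calc _ ≤ (h-1) * P := Nat.mul_le_mul_right _ hr'
          _ ≤ _ := by nlinarith
      · refine natDegree_mul_le.trans ?_
        rw [natDegree_expand]
        have hk : (h - q - 1) + q = h - 1 := by omega
        calc _ ≤ (h-q-1) * P + q * (P+1) := Nat.add_le_add (Nat.mul_le_mul_right _ hs') hfp
          _ = P * (h - 1) + q := by rw [← hk]; ring
    omega
  let Φ := Φ₀.codRestrict (degreeLT F T) hmem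
  have hfin : ∀ n, Module.finrank F (degreeLT F n) = n := by
    intro n
    rw [LinearEquiv.finrank_eq (degreeLTEquiv F n)]; simp
  have : ∀ n, FiniteDimensional F (degreeLT F n) := fun n =>
    LinearEquiv.finiteDimensional (degreeLTEquiv F n).symm
  have hker : LinearMap.ker Φ ≠ ⊥ := by
    apply LinearMap.ker_ne_bot_of_finrank_lt
    rw [hfin, Module.finrank_pi_fintype]
    simp only [Module.finrank_prod, hfin, sum_const, card_univ, Fintype.card_fin, smul_eq_mul]
    obtain ⟨k, rfl⟩ := Nat.exists_eq_add_of_le hh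
    rw [hT, hJ, hPdef]
    have e1 : q + 2 + k - 1 = q + 1 + k := by omega
    have e2 : q + 2 + k - q = 2 + k := by omega
    rw [e1, e2]
    nlinarith
  obtain ⟨v, hv, hv0⟩ := Submodule.exists_mem_ne_zero_of_ne_bot hker
  have hv' : Φ₀ v = 0 := by
    have := LinearMap.mem_ker.1 hv
    exact congrArg Subtype.val this
  rw [hΦ₀] at hv'
  let G : F[X] := ∑ j : Fin J, (((v j).1 : F[X]) + ((v j).2 : F[X]) * f ^ (h+1)) * X ^ ((j:ℕ) * P)
  have hroot : ∀ y ∈ S, aeval y G = 0 := by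
    intro y hy
    let φ : L →ₐ[F] L := (FiniteField.frobeniusAlgHom F L) ^ m
    have hφ : ∀ z, φ z = z ^ P := by
      intro z
      simp only [φ, AlgHom.coe_pow, FiniteField.coe_frobeniusAlgHom, pow_iterate]
      rw [← hP]
    have : φ (aeval y G) = 0 := by
      rw [← aeval_algHom_apply, hφ]
      have h0 := congrArg (aeval y) hv'
      rw [map_sum, map_zero] at h0
      rw [← h0]
      simp only [G, map_sum]
      refine sum_congr rfl fun j _ => ?_
      simp only [map_mul, map_add, map_sub, map_pow, aeval_X, expand_aeval]
      have hy1 : (y ^ P) ^ ((j:ℕ) * P) = y ^ (j:ℕ) := by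
        have := FiniteField.pow_card y
        rw [← pow_mul, show P * ((j:ℕ) * P) = P ^ 2 * j by ring, pow_mul, ← hL, this]
      have hy2 : (aeval (y ^ P) f) ^ (h+1) = - (aeval y f) ^ (h+1) := by
        rw [← hφ, aeval_algHom_apply, hφ, ← pow_mul]
        have h3 := hS y hy
        have h4 : aeval y f = (y ^ q - y) ^ 2 - algebraMap F L (4*a) := by
          simp [hf]
        rw [← h4] at h3
        rw [show P * (h+1) = 2 * h * (h+1) + (h+1) by rw [hPdef]; ring, pow_add, h3]
        ring
      rw [hy1, hy2]; ring
    rw [hφ] at this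
    exact pow_eq_zero_iff (by omega) |>.1 this
  have hG : G ≠ 0 := by
    intro hG0
    apply hv0
    have key : ∀ k : ℕ, ∀ hk : k < J, v ⟨k, hk⟩ = 0 := by
      intro k
      induction k using Nat.strong_induction_on with
      | _ k ih =>
      intro hk
      set r := ((v ⟨k,hk⟩).1 : F[X]) with hr
      set s := ((v ⟨k,hk⟩).2 : F[X]) with hs
      have hd : X ^ ((k+1) * P) ∣ (r + s * f ^ (h+1)) * X ^ (k * P) := by
        have : G = (r + s * f ^ (h+1)) * X ^ (k * P) +
          ∑ j ∈ (univ.erase (⟨k,hk⟩ : Fin J)), (((v j).1 : F[X]) + ((v j).2 : F[X]) * f ^ (h+1)) * X ^ ((j:ℕ) * P) := by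
          rw [Finset.add_sum_erase univ (fun j : Fin J => (((v j).1 : F[X]) + ((v j).2 : F[X]) * f ^ (h+1)) * X ^ ((j:ℕ) * P)) (mem_univ _)]
        rw [hG0] at this
        have h5 := eq_neg_of_add_eq_zero_left this.symm
        rw [h5, dvd_neg]
        refine dvd_sum fun j hj => ?_
        rcases lt_trichotomy (j:ℕ) k with hjk | hjk | hjk
        · have := ih j hjk j.2
          simp only [Fin.eta] at this
          rw [this]; simp
        · exfalso; rw [mem_erase] at hj; exact hj.1 (Fin.ext hjk)
        · exact (pow_dvd_pow X (Nat.mul_le_mul_right P hjk)).mul_left _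
      have hd1 : X ^ P ∣ r + s * f ^ (h+1) := by
        rw [show (k+1)*P = P + k * P by ring, pow_add] at hd
        exact (mul_dvd_mul_iff_right (pow_ne_zero _ X_ne_zero)).1 hd
      have hd2 : X ^ P ∣ r ^ 2 - s ^ 2 * f ^ P * f := by
        have : r ^ 2 - s ^ 2 * f ^ P * f = (r + s * f ^ (h+1)) * (r - s * f ^ (h+1)) := by
          rw [hPdef]; ring
        rw [this]; exact hd1.mul_right _
      have hfP : f ^ P = expand F P f := by
        rw [← hP, hq]
        clear * -
        induction m with
        | zero => simp
        | succ m ih => rw [pow_succ, pow_mul, ih, ← FiniteField.expand_card, expand_expand, mul_comm]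
      have hd3 : X ^ P ∣ f ^ P - C (-4*a) := by
        have : X ∣ f - C (-4*a) := by rw [X_dvd_iff]; simp [hf0]
        have := map_dvd (expand F P) this
        rwa [map_sub, expand_X, expand_C, ← hfP] at this
      have hd4 : X ^ P ∣ r ^ 2 - C (-4*a) * s ^ 2 * f := by
        have : r ^ 2 - C (-4*a) * s ^ 2 * f = (r ^ 2 - s ^ 2 * f ^ P * f) + (f ^ P - C (-4*a)) * (s ^ 2 * f) := by ring
        rw [this]; exact dvd_add hd2 (hd3.mul_right _)
      have hr1 := (v ⟨k,hk⟩).1.2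
      have hs1 := (v ⟨k,hk⟩).2.2
      rw [mem_degreeLT] at hr1 hs1
      have hr' : r.natDegree ≤ h - 1 := by
        by_cases h0 : r = 0
        · rw [h0]; simp
        · have := (natDegree_lt_iff_degree_lt h0).2 hr1
          omega
      have hs' : s.natDegree ≤ h - q - 1 := by
        by_cases h0 : s = 0
        · rw [h0]; simp
        · have := (natDegree_lt_iff_degree_lt h0).2 hs1
          omega
      have h6 : r ^ 2 - C (-4*a) * s ^ 2 * f = 0 := by
        apply eq_zero_of_dvd_of_natDegree_lt hd4
        rw [natDegree_X_pow]
        refine lt_of_le_of_lt (natDegree_sub_le _ _) (max_lt ?_ ?_)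
        · refine lt_of_le_of_lt natDegree_pow_le ?_
          omega
        · refine lt_of_le_of_lt natDegree_mul_le ?_
          have : (C (-4*a) * s ^ 2).natDegree ≤ 2 * s.natDegree :=
            (natDegree_C_mul_le _ _).trans natDegree_pow_le
          omega
      have h7 := kl_nosq h2 a ha r s (sub_eq_zero.1 h6)
      refine Prod.ext (Subtype.ext h7.1) (Subtype.ext h7.2)
    funext j
    exact key j j.2
  have hcard : S.card ≤ G.natDegree := by
    have : S ⊆ (G.aroots L).toFinset := by
      intro y hy
      rw [Multiset.mem_toFinset, mem_aroots]
      exact ⟨hG, hroot y hy⟩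
    calc S.card ≤ _ := card_le_card this
      _ ≤ _ := Multiset.toFinset_card_le _
      _ ≤ _ := card_roots' _
      _ ≤ _ := natDegree_map_le
  have hdeg : G.natDegree ≤ (h - 1) + q * (P+1) + (J - 1) * P := by
    refine natDegree_sum_le_of_forall_le _ _ fun j _ => ?_
    have hr1 := (v j).1.2
    have hs1 := (v j).2.2
    rw [mem_degreeLT] at hr1 hs1
    have hr' : ((v j).1 : F[X]).natDegree ≤ h - 1 := by
      by_cases h0 : ((v j).1 : F[X]) = 0
      · rw [h0]; simp
      · have := (natDegree_lt_iff_degree_lt h0).2 hr1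
        omega
    have hs' : ((v j).2 : F[X]).natDegree ≤ h - q - 1 := by
      by_cases h0 : ((v j).2 : F[X]) = 0
      · rw [h0]; simp
      · have := (natDegree_lt_iff_degree_lt h0).2 hs1
        omega
    refine natDegree_mul_le.trans ?_
    rw [natDegree_X_pow]
    have h9 : (j:ℕ) * P ≤ (J-1) * P := Nat.mul_le_mul_right _ (by have := j.2; omega)
    refine Nat.add_le_add ?_ h9
    refine (natDegree_add_le _ _).trans (max_le (by omega) ?_)
    refine natDegree_mul_le.trans ?_
    omega
  have := hcard.trans hdeg
  obtain ⟨k, rfl⟩ := Nat.exists_eq_add_of_le hh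
  have e2 : q + 2 + k - 1 = q + 1 + k := by omega
  have e3 : J - 1 = q + 1 + k + q := by omega
  rw [e2, e3] at this
  rw [hPdef] at this ⊢
  nlinarith

open Classical in
/-- Kloosterman sum. -/
noncomputable def kl {L : Type*} [Field L] [Fintype L] (Ψ : L → ℂ) (a : L) : ℂ :=
  ∑ x : L, if x = 0 then 0 else Ψ (x + a / x)

theorem kl_ringChar {L : Type*} [Field L] (h2 : (2:L) ≠ 0) : ringChar L ≠ 2 := by
  intro h
  apply h2
  have := ringChar.Nat.cast_ringChar (R := L)
  rw [h] at this
  exact_mod_cast this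

/-- number of square roots -/
theorem kl_sqrts {L : Type*} [Field L] [Fintype L] [DecidableEq L] (h2 : (2:L) ≠ 0) (b : L) :
    (((univ.filter fun x : L => x ^ 2 = b).card : ℤ)) = 1 + quadraticChar L b := by
  have := quadraticChar_card_sqrts (kl_ringChar h2) b
  rw [add_comm, ← this]
  congr 2
  ext x; simp

theorem kl_fiber {L : Type*} [Field L] [Fintype L] [DecidableEq L] (h2 : (2:L) ≠ 0) (a u : L) (ha : a ≠ 0) :
    (((univ.filter fun x : L => x ≠ 0 ∧ x + a / x = u).card : ℤ)) = 1 + quadraticChar L (u^2-4*a) := by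
  rw [← kl_sqrts h2]
  congr 1
  refine card_bij' (fun x _ => 2 * x - u) (fun z _ => (z + u) / 2) ?_ ?_ ?_ ?_
  · intro x hx
    simp only [mem_filter, mem_univ, true_and] at hx ⊢
    obtain ⟨h0, h1⟩ := hx
    have : x * x + a = u * x := by rw [← h1]; field_simp
    linear_combination 4 * this
  · intro z hz
    simp only [mem_filter, mem_univ, true_and] at hz ⊢
    have h3 : (z + u) * (u - z) = 4 * a := by linear_combination -hz
    have h4 : (4:L) ≠ 0 := by
      rw [show (4:L) = 2*2 by norm_num]; exact mul_ne_zero h2 h2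
    have h0 : z + u ≠ 0 := by
      intro h0
      rw [h0, zero_mul] at h3
      exact mul_ne_zero h4 ha h3.symm
    refine ⟨div_ne_zero h0 h2, ?_⟩
    field_simp
    linear_combination hz
  · intro x hx; field_simp; ring
  · intro z hz; field_simp; ring

theorem kl_eq_sum {L : Type*} [Field L] [Fintype L] [DecidableEq L] (h2 : (2:L) ≠ 0) (a : L) (ha : a ≠ 0)
    (Ψ : L → ℂ) : kl Ψ a = ∑ u, (1 + (quadraticChar L (u^2-4*a) : ℂ)) * Ψ u := by
  have h1 : ∀ u : L, (1 + (quadraticChar L (u^2-4*a) : ℂ)) * Ψ u =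
      ∑ x : L, if x ≠ 0 ∧ x + a / x = u then Ψ u else 0 := by
    intro u
    have := kl_fiber h2 a u ha
    rw [← sum_filter, sum_const, nsmul_eq_mul]
    congr 1
    exact_mod_cast this.symm
  simp_rw [h1]
  rw [sum_comm]
  unfold kl
  refine sum_congr rfl fun x _ => ?_
  by_cases hx : x = 0
  · simp [hx]
  · simp [hx]

theorem kl_artin {F L : Type*} [Field F] [Fintype F] [Field L] [Fintype L] [Algebra F L]
    (ψ : AddChar F ℂ) (hψ : ψ.IsPrimitive) (g : L → ℂ) :
    ∑ y : L, g (y ^ Fintype.card F - y) = ∑ u : L, g u * ∑ c : F, ψ (c * Algebra.trace F L u) := by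
  classical
  set q := Fintype.card F with hq
  let A : L →ₗ[F] L := (FiniteField.frobeniusAlgHom F L).toLinearMap - LinearMap.id
  have hA : ∀ y, A y = y ^ q - y := fun y => by simp [A, hq]
  let Tr := Algebra.trace F L
  have hle : LinearMap.range A ≤ LinearMap.ker Tr := by
    rintro _ ⟨y, rfl⟩
    rw [LinearMap.mem_ker, hA, map_sub, sub_eq_zero]
    have := Algebra.trace_eq_of_algEquiv (FiniteField.frobeniusAlgEquivOfAlgebraic F L) y
    rw [← this]
    simp [hq, Tr]
  have hsurj : LinearMap.range Tr = ⊤ := LinearMap.range_eq_top.2 (Algebra.trace_surjective F L)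
  have hq1 : 1 < q := Fintype.one_lt_card (α := F)
  have hset : (univ.filter fun y : L => y ^ q = y) = univ.image (algebraMap F L) := by
    symm
    apply eq_of_subset_of_card_le
    · intro y hy
      obtain ⟨x, -, rfl⟩ := mem_image.1 hy
      simp only [mem_filter, mem_univ, true_and]
      rw [← map_pow, hq, FiniteField.pow_card]
    · rw [card_image_of_injective _ (algebraMap F L).injective, card_univ, ← hq]
      have hne := FiniteField.X_pow_card_sub_X_ne_zero L hq1
      have hdeg := FiniteField.X_pow_card_sub_X_natDegree_eq L hq1
      calc _ ≤ ((Polynomial.X ^ q - Polynomial.X : Polynomial L).roots).toFinset.card := by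
            apply card_le_card
            intro y hy
            simp only [mem_filter, mem_univ, true_and] at hy
            rw [Multiset.mem_toFinset, Polynomial.mem_roots hne]
            simp [hy]
        _ ≤ _ := Multiset.toFinset_card_le _
        _ ≤ _ := Polynomial.card_roots' _
        _ = q := hdeg
  have hkc : (univ.filter fun y : L => A y = 0).card = q := by
    have : (univ.filter fun y : L => A y = 0) = (univ.filter fun y : L => y ^ q = y) := by
      ext y; simp [hA, sub_eq_zero]
    rw [this, hset, card_image_of_injective _ (algebraMap F L).injective, card_univ, ← hq]
  have hk1 : Module.finrank F (LinearMap.ker A) = 1 := by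
    have h1 := Module.card_eq_pow_finrank (K := F) (V := LinearMap.ker A)
    have h2 : Fintype.card (LinearMap.ker A) = q := by
      rw [← hkc, Fintype.card_subtype]
      congr 1
    rw [h2, ← hq] at h1
    exact (Nat.pow_right_injective hq1 (by simpa using h1)).symm
  have hrange : LinearMap.range A = LinearMap.ker Tr := by
    apply Submodule.eq_of_le_of_finrank_eq hle
    have h1 := LinearMap.finrank_range_add_finrank_ker A
    have h2 := LinearMap.finrank_range_add_finrank_ker Tr
    rw [hsurj, finrank_top, Module.finrank_self] at h2
    omega
  have hfib : ∀ u : L, (((univ.filter fun y : L => A y = u).card : ℕ) : ℂ) = ∑ c : F, ψ (c * Tr u) := by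
    intro u
    rw [AddChar.sum_mulShift _ hψ]
    by_cases hu : Tr u = 0
    · rw [if_pos hu]
      have : u ∈ LinearMap.range A := by rw [hrange]; exact hu
      obtain ⟨y0, rfl⟩ := this
      rw [← hq, ← hkc]
      congr 1
      refine card_bij' (fun y _ => y - y0) (fun y _ => y + y0) ?_ ?_ ?_ ?_
      · intro y hy; simp at hy ⊢; simp [hy]
      · intro y hy; simp at hy ⊢; simp [hy]
      · intro y hy; simp
      · intro y hy; simp
    · rw [if_neg hu, Nat.cast_inj, card_eq_zero, filter_eq_empty_iff]
      intro y _ hy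
      apply hu
      have : u ∈ LinearMap.range A := ⟨y, hy⟩
      rw [hrange] at this; exact this
  rw [← sum_fiberwise univ (fun y : L => A y)]
  refine sum_congr rfl fun u _ => ?_
  rw [← hfib u, mul_comm, ← nsmul_eq_mul, ← sum_const]
  refine sum_congr rfl fun y hy => ?_
  rw [← hA, (mem_filter.1 hy).2]

theorem kl_sum_c {F L : Type*} [Field F] [Fintype F] [Field L] [Fintype L] [Algebra F L] [DecidableEq L]
    (h2 : (2:L) ≠ 0) (ψ : AddChar F ℂ) (hψ : ψ.IsPrimitive) (a : L) (ha : a ≠ 0) :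
    ∑ c : F, kl (fun x : L => ψ (c * Algebra.trace F L x)) a =
      ∑ y : L, (1 + (quadraticChar L ((y ^ Fintype.card F - y) ^ 2 - 4 * a) : ℂ)) := by
  rw [kl_artin ψ hψ (fun u => (1 + (quadraticChar L (u ^ 2 - 4 * a) : ℂ)))]
  simp_rw [kl_eq_sum h2 a ha, mul_sum]
  exact sum_comm

theorem kl_upper {F L : Type*} [Field F] [Fintype F] [Field L] [Fintype L] [Algebra F L]
    (h2 : (2:F) ≠ 0) (ψ : AddChar F ℂ) (hψ : ψ.IsPrimitive) (a : F) (ha : a ≠ 0)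
    (m h : ℕ) (hP : Fintype.card F ^ m = 2 * h + 1)
    (hL : Fintype.card L = (2 * h + 1) ^ 2) (hh : Fintype.card F + 2 ≤ h) :
    - (∑ c : F, kl (fun x : L => ψ (c * Algebra.trace F L x)) (algebraMap F L a)).re ≤
      - ((2 * h + 1 : ℝ)) ^ 2 + 2 * (Fintype.card F) + 4 * (Fintype.card F) * (2 * h + 1) := by
  classical
  have h2L : (2:L) ≠ 0 := by
    have := (map_ne_zero (algebraMap F L)).2 h2
    rwa [map_ofNat] at this
  have haL : algebraMap F L a ≠ 0 := (map_ne_zero (algebraMap F L)).2 ha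
  rw [kl_sum_c h2L ψ hψ _ haL]
  set q := Fintype.card F with hq
  have hq1 : 1 < q := Fintype.one_lt_card (α := F)
  let f : L → L := fun y => (y ^ q - y) ^ 2 - 4 * algebraMap F L a
  let S0 := univ.filter fun y : L => f y = 0
  let Sm := univ.filter fun y : L => quadraticChar L (f y) = -1
  have hm : 2 * Sm.card ≤ (2 * h + 1) ^ 2 + 4 * q * (2 * h + 1) := by
    apply kl_stepanov h2 a ha m h hP hL hh
    intro y hy
    have hy' := (mem_filter.1 hy).2
    have h3 := quadraticChar_eq_pow_of_char_ne_two' (kl_ringChar h2L) (f y)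
    rw [hy', hL, show (2 * h + 1) ^ 2 / 2 = 2 * h * (h+1) by
      rw [show (2 * h + 1) ^ 2 = 1 + 2 * (2 * h * (h+1)) by ring]; omega] at h3
    simp only [f] at h3
    rw [map_mul, map_ofNat, ← h3]
    simp
  have h0 : S0.card ≤ 2 * q := by
    let p : Polynomial L := (Polynomial.X ^ q - Polynomial.X) ^ 2 - Polynomial.C (4 * algebraMap F L a)
    have hdeg : p.natDegree = 2 * q := by
      simp only [p]
      rw [Polynomial.natDegree_sub_C, Polynomial.natDegree_pow, FiniteField.X_pow_card_sub_X_natDegree_eq L hq1]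
    have hne : p ≠ 0 := by
      intro h; rw [h] at hdeg; simp at hdeg; omega
    calc S0.card ≤ p.roots.toFinset.card := by
          apply card_le_card
          intro y hy
          have hy' := (mem_filter.1 hy).2
          rw [Multiset.mem_toFinset, Polynomial.mem_roots hne]
          simpa [p, f] using hy'
        _ ≤ _ := Multiset.toFinset_card_le _
        _ ≤ _ := Polynomial.card_roots' _
        _ = 2 * q := hdeg
  have hterm : ∀ y : L, (0:ℝ) ≤ (quadraticChar L (f y) : ℝ) + (-1 + (if f y = 0 then 1 else 0) +
      2 * (if quadraticChar L (f y) = -1 then 1 else 0)) := by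
    intro y
    by_cases hy : f y = 0
    · simp [hy]
    · rcases quadraticChar_dichotomy hy with h | h <;> rw [h] <;> simp [hy] 
      norm_num
  have hsum := sum_nonneg fun y (_ : y ∈ (univ : Finset L)) => hterm y
  rw [sum_add_distrib, sum_add_distrib, sum_add_distrib, ← mul_sum, sum_boole, sum_boole] at hsum
  simp only [sum_const, card_univ, hL] at hsum
  have hre : (∑ y : L, (1 + (quadraticChar L ((y ^ q - y) ^ 2 - 4 * algebraMap F L a) : ℂ))).re =
     (2 * h + 1 : ℝ) ^ 2 + ∑ y : L, (quadraticChar L (f y) : ℝ) := by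
    rw [Complex.re_sum]
    simp [sum_add_distrib, hL, f]
  rw [hre]
  have h0' : (S0.card : ℝ) ≤ 2 * q := by exact_mod_cast h0
  have hm' : 2 * (Sm.card : ℝ) ≤ (2 * h + 1) ^ 2 + 4 * q * (2 * h + 1) := by exact_mod_cast hm
  simp only [S0, Sm] at h0' hm'
  simp only [nsmul_eq_mul] at hsum
  push_cast at hsum
  linarith

theorem kl_pairs_split {L : Type*} [Field L] [Fintype L] [DecidableEq L] (h2 : (2:L) ≠ 0) (s p : L) :
    (((univ.filter fun z : L × L => z.1 + z.2 = s ∧ z.1 * z.2 = p).card : ℤ)) =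
      1 + quadraticChar L (s^2-4*p) := by
  rw [← kl_sqrts h2]
  congr 1
  refine card_bij' (fun z _ => z.1 - z.2) (fun w _ => ((s + w) / 2, (s - w) / 2)) ?_ ?_ ?_ ?_
  · intro z hz
    simp only [mem_filter, mem_univ, true_and] at hz ⊢
    rw [← hz.1, ← hz.2]; ring
  · intro w hw
    simp only [mem_filter, mem_univ, true_and] at hw ⊢
    constructor
    · field_simp; ring
    · have : (4:L) ≠ 0 := by
        rw [show (4:L) = 2*2 by norm_num]; exact mul_ne_zero h2 h2
      apply mul_left_cancel₀ this
      field_simp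
      linear_combination (-1 : L) * hw
  · intro z hz
    simp only [mem_filter, mem_univ, true_and] at hz
    ext <;> simp <;> rw [← hz.1] <;> field_simp <;> ring
  · intro w hw
    field_simp; ring

theorem kl_pairs_nonsplit {L : Type*} [Field L] [Fintype L] [DecidableEq L] (h2 : (2:L) ≠ 0) (n : L)
    (hn : ¬ IsSquare n) (s p : L) :
    (((univ.filter fun z : L × L => 2 * z.1 = s ∧ z.1 * z.1 - n * z.2 * z.2 = p).card : ℤ)) =
      1 - quadraticChar L (s^2-4*p) := by
  have hn0 : n ≠ 0 := by rintro rfl; exact hn ⟨0, by simp⟩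
  have : quadraticChar L (n * (s^2-4*p)) = - quadraticChar L (s^2-4*p) := by
    rw [map_mul, quadraticChar_neg_one_iff_not_isSquare.2 hn]; ring
  rw [sub_eq_add_neg, ← this, ← kl_sqrts h2]
  congr 1
  refine card_bij' (fun z _ => 2 * n * z.2) (fun w _ => (s / 2, w / (2 * n))) ?_ ?_ ?_ ?_
  · intro z hz
    simp only [mem_filter, mem_univ, true_and] at hz ⊢
    rw [← hz.1, ← hz.2]; ring
  · intro w hw
    simp only [mem_filter, mem_univ, true_and] at hw ⊢
    constructor
    · field_simp
    · field_simp
      linear_combination (-1 : L) * hw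
  · intro z hz
    simp only [mem_filter, mem_univ, true_and] at hz
    ext
    · simp; rw [← hz.1]; field_simp
    · simp; field_simp
  · intro w hw
    field_simp

/-- algebraic identity behind the quadratic Davenport-Hasse relation. -/
theorem kl_quad_aux {L : Type*} [Field L] [Fintype L] [DecidableEq L] (h2 : (2:L) ≠ 0) (n : L)
    (hn : ¬ IsSquare n) (Ψ : AddChar L ℂ) (hΨ : Ψ.IsPrimitive) (a : L) (ha : a ≠ 0) :
    (∑ z : L × L, if z.1 * z.1 - n * z.2 * z.2 = 0 then 0 else
      Ψ (2 * z.1 + a * (2 * z.1) / (z.1 * z.1 - n * z.2 * z.2))) + kl Ψ a ^ 2 =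
      2 * Fintype.card L := by
  let g : L × L → ℂ := fun w => if w.2 = 0 then 0 else Ψ (w.1 + a * w.1 / w.2)
  have e1 : kl Ψ a ^ 2 = ∑ z : L × L, g (z.1 + z.2, z.1 * z.2) := by
    rw [sq, kl, sum_mul_sum, Fintype.sum_prod_type]
    refine sum_congr rfl fun x _ => sum_congr rfl fun y _ => ?_
    by_cases hx : x = 0
    · simp [hx, g]
    by_cases hy : y = 0
    · simp [hy, g]
    simp only [hx, hy, g, mul_eq_zero, or_self, if_false]
    rw [← AddChar.map_add_eq_mul]
    congr 1
    field_simp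
    ring
  have e2 : ∀ z : L × L, (if z.1 * z.1 - n * z.2 * z.2 = 0 then 0 else
      Ψ (2 * z.1 + a * (2 * z.1) / (z.1 * z.1 - n * z.2 * z.2))) =
      g (2 * z.1, z.1 * z.1 - n * z.2 * z.2) := fun z => rfl
  have e3 : ∀ φ : L × L → L × L, ∑ z, g (φ z) =
      ∑ w, (((univ.filter fun z => φ z = w).card : ℕ) : ℂ) * g w := by
    intro φ
    rw [← sum_fiberwise univ φ]
    refine sum_congr rfl fun w _ => ?_
    rw [← nsmul_eq_mul, ← sum_const]
    refine sum_congr rfl fun z hz => ?_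
    rw [(mem_filter.1 hz).2]
  simp_rw [e2]
  rw [e1, e3 (fun z => (2 * z.1, z.1 * z.1 - n * z.2 * z.2)), e3 (fun z => (z.1 + z.2, z.1 * z.2)),
    ← sum_add_distrib]
  have e4 : ∀ w : L × L,
     (((univ.filter fun z : L × L => (2 * z.1, z.1 * z.1 - n * z.2 * z.2) = w).card : ℕ) : ℂ) * g w +
     (((univ.filter fun z : L × L => (z.1 + z.2, z.1 * z.2) = w).card : ℕ) : ℂ) * g w = 2 * g w := by
    rintro ⟨s, p⟩
    have h3 := kl_pairs_split h2 s p
    have h4 := kl_pairs_nonsplit h2 n hn s p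
    simp only [Prod.mk.injEq]
    rw [← add_mul]
    congr 1
    have h5 : (((univ.filter fun z : L × L => 2 * z.1 = s ∧ z.1 * z.1 - n * z.2 * z.2 = p).card : ℤ)) +
       (((univ.filter fun z : L × L => z.1 + z.2 = s ∧ z.1 * z.2 = p).card : ℤ)) = 2 := by
      rw [h3, h4]; ring
    exact_mod_cast h5
  rw [sum_congr rfl fun w _ => e4 w, ← mul_sum, Fintype.sum_prod_type_right]
  congr 1
  have e5 : ∀ p : L, ∑ s : L, g (s, p) = if p = -a then (Fintype.card L : ℂ) else 0 := by
    intro p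
    by_cases hp : p = 0
    · simp [g, hp, ha]
    · simp only [g, hp, if_false]
      have := AddChar.sum_mulShift (1 + a / p) hΨ
      have h6 : 1 + a / p = 0 ↔ p = -a := by
        constructor
        · intro h; field_simp at h; linear_combination h
        · rintro rfl; field_simp; ring
      simp only [h6] at this
      rw [← Nat.cast_zero, ← apply_ite, ← this]
      refine sum_congr rfl fun s _ => ?_
      congr 1; ring
  simp_rw [e5]
  simp

theorem kl_quad {F L : Type} [Field F] [Fintype F] [Field L] [Fintype L] [Algebra F L]
    (h2 : (2:F) ≠ 0) (ψ : AddChar F ℂ) (hψ : ψ.IsPrimitive) (a : F) (ha : a ≠ 0) :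
    ∃ (M : Type) (_ : Field M) (_ : Fintype M) (_ : Algebra F M),
      Fintype.card M = Fintype.card L ^ 2 ∧
      ∀ c : F, c ≠ 0 → kl (fun x : M => ψ (c * Algebra.trace F M x)) (algebraMap F M a) =
        2 * Fintype.card L - kl (fun x : L => ψ (c * Algebra.trace F L x)) (algebraMap F L a) ^ 2 := by
  classical
  have h2L : (2:L) ≠ 0 := by
    have := (map_ne_zero (algebraMap F L)).2 h2
    rwa [map_ofNat] at this
  have haL : algebraMap F L a ≠ 0 := (map_ne_zero (algebraMap F L)).2 ha
  obtain ⟨n, hn⟩ := FiniteField.exists_nonsquare (kl_ringChar h2L)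
  have : Fact (∀ r : L, r ^ 2 ≠ n + 0 * r) := ⟨fun r h => hn ⟨r, by rw [← sq, h]; ring⟩⟩
  let _ : Fintype (QuadraticAlgebra L n 0) := Fintype.ofEquiv _ (QuadraticAlgebra.equivProd n 0).symm
  refine ⟨QuadraticAlgebra L n 0, inferInstance, inferInstance, inferInstance, ?_, ?_⟩
  · rw [Fintype.card_congr (QuadraticAlgebra.equivProd n 0), Fintype.card_prod, sq]
  intro c hc
  have htr : ∀ z : QuadraticAlgebra L n 0, Algebra.trace L (QuadraticAlgebra L n 0) z = 2 * z.re := by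
    intro z
    rw [Algebra.trace_eq_matrix_trace (QuadraticAlgebra.basis n 0), Matrix.trace_fin_two]
    simp [Algebra.leftMulMatrix_eq_repr_mul, QuadraticAlgebra.basis]
    ring
  have htr2 : ∀ z : QuadraticAlgebra L n 0, Algebra.trace F (QuadraticAlgebra L n 0) z =
      Algebra.trace F L (2 * z.re) := by
    intro z
    rw [← htr, Algebra.trace_trace]
  let Ψ : AddChar L ℂ := (AddChar.mulShift ψ c).compAddMonoidHom (Algebra.trace F L).toAddMonoidHom
  have hΨa : ∀ x, Ψ x = ψ (c * Algebra.trace F L x) := fun x => rfl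
  have hΨ : Ψ.IsPrimitive := by
    apply AddChar.IsPrimitive.of_ne_one
    intro h
    apply hψ hc
    ext x
    obtain ⟨y, rfl⟩ := Algebra.trace_surjective F L x
    have := DFunLike.congr_fun h y
    rw [hΨa] at this
    simpa using this
  have := kl_quad_aux h2L n hn Ψ hΨ (algebraMap F L a) haL
  rw [eq_sub_iff_add_eq]
  rw [← this]
  congr 1
  rw [kl, ← (QuadraticAlgebra.equivProd n 0).symm.sum_comp]
  refine sum_congr rfl fun z _ => ?_
  have hnorm : ((QuadraticAlgebra.equivProd n 0).symm z) = 0 ↔ z.1 * z.1 - n * z.2 * z.2 = 0 := by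
    rw [← QuadraticAlgebra.norm_eq_zero_iff_eq_zero, QuadraticAlgebra.norm_def]
    simp
  simp only [hnorm]
  by_cases h0 : z.1 * z.1 - n * z.2 * z.2 = 0
  · simp [h0]
  · simp only [h0, if_false]
    rw [hΨa, htr2]
    congr 3
    rw [div_eq_mul_inv, IsScalarTower.algebraMap_apply F L (QuadraticAlgebra L n 0)]
    simp [QuadraticAlgebra.norm_def]
    field_simp

noncomputable def klSeq (q : ℕ) (K : ℝ) : ℕ → ℝ
  | 0 => K
  | k + 1 => 2 * (q : ℝ) ^ (2 ^ k) - (klSeq q K k) ^ 2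

theorem klSeq_lower (q : ℕ) (hq : 0 < q) (K : ℝ) (k : ℕ) :
    4 ^ k * (K ^ 2 / q - 4) ≤ (klSeq q K k) ^ 2 / (q : ℝ) ^ (2 ^ k) - 4 ∨ K ^ 2 / q - 4 < 0 := by
  by_cases h : K ^ 2 / q - 4 < 0
  · right; exact h
  left
  push Not at h
  have hq' : (0:ℝ) < q := by exact_mod_cast hq
  induction k with
  | zero => simp [klSeq]
  | succ k ih =>
    have hP : (0:ℝ) < (q:ℝ) ^ (2 ^ k) := by positivity
    set P := (q:ℝ) ^ (2 ^ k) with hPd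
    have e : (q:ℝ) ^ (2 ^ (k+1)) = P ^ 2 := by rw [hPd, ← pow_mul, pow_succ]
    rw [klSeq, e, ← hPd]
    set x := klSeq q K k
    set ρ := x ^ 2 / P - 4 with hρ
    have hx : x ^ 2 = (ρ + 4) * P := by rw [hρ]; field_simp; ring
    have e2 : (2 * P - x ^ 2) ^ 2 / P ^ 2 - 4 = 4 * ρ + ρ ^ 2 := by
      rw [hx]; field_simp; ring
    rw [e2, pow_succ]
    nlinarith [sq_nonneg ρ]

theorem kl_tower {F : Type} [Field F] [Fintype F]
    (h2 : (2:F) ≠ 0) (ψ : AddChar F ℂ) (hψ : ψ.IsPrimitive) (a : F) (ha : a ≠ 0)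
    (K : F → ℝ) (hK : ∀ c, kl (fun x : F => ψ (c * x)) a = K c) (k : ℕ) :
    ∃ (L : Type) (_ : Field L) (_ : Fintype L) (_ : Algebra F L),
      Fintype.card L = Fintype.card F ^ (2 ^ k) ∧
      ∀ c : F, c ≠ 0 → kl (fun x : L => ψ (c * Algebra.trace F L x)) (algebraMap F L a) =
        (klSeq (Fintype.card F) (K c) k : ℂ) := by
  induction k with
  | zero =>
    refine ⟨F, inferInstance, inferInstance, inferInstance, by simp, fun c _ => ?_⟩
    simpa [klSeq, Algebra.trace_self_apply] using hK c
  | succ k ih =>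
    obtain ⟨L, _, _, _, hc, hL⟩ := ih
    obtain ⟨M, i1, i2, i3, hc', hM⟩ := kl_quad (L := L) h2 ψ hψ a ha
    refine ⟨M, i1, i2, i3, by rw [hc', hc, ← pow_mul, pow_succ], fun c h0 => ?_⟩
    rw [hM c h0, hL c h0, hc, klSeq]
    push_cast; ring

theorem kl_real {L : Type*} [Field L] [Fintype L] (ψ : AddChar L ℂ) (a : L) :
    kl ψ a = ((kl ψ a).re : ℂ) := by
  rw [eq_comm, ← Complex.conj_eq_iff_re]
  rw [kl, map_sum, ← Equiv.sum_comp (Equiv.neg L)]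
  refine sum_congr rfl fun x _ => ?_
  by_cases hx : x = 0
  · simp [hx]
  · simp only [Equiv.neg_apply, neg_eq_zero, hx, if_false]
    rw [← AddChar.map_neg_eq_conj]
    congr 1
    rw [div_neg]; ring

theorem kl_bound {F : Type} [Field F] [Fintype F]
    (h2 : (2:F) ≠ 0) (ψ : AddChar F ℂ) (hψ : ψ.IsPrimitive) (a : F) (ha : a ≠ 0) :
    ‖kl ψ a‖ ≤ 2 * √(Fintype.card F) := by
  classical
  set q := Fintype.card F with hq
  let K : F → ℝ := fun c => (kl (fun x : F => ψ (c * x)) a).re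
  have hK : ∀ c, kl (fun x : F => ψ (c * x)) a = K c := fun c =>
    kl_real (AddChar.mulShift ψ c) a
  have hq1 : 1 < q := Fintype.one_lt_card (α := F)
  have hqodd : q % 2 = 1 := FiniteField.odd_card_of_char_ne_two (kl_ringChar h2)
  have hq3 : 3 ≤ q := by omega
  have hq' : (0:ℝ) < q := by exact_mod_cast (by omega : 0 < q)
  have main : ∀ k, 2 ≤ k → (4:ℝ) ^ k * (K 1 ^ 2 / q - 4) ≤ 8 * q := by
    intro k hk
    rcases klSeq_lower q (by omega) (K 1) k with hlow | hneg
    swap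
    · have : (0:ℝ) < 4 ^ k := by positivity
      nlinarith
    obtain ⟨L, _, _, _, hc, hL⟩ := kl_tower h2 ψ hψ a ha K hK (k+1)
    have hPodd : Odd (q ^ (2 ^ k)) := (Nat.odd_iff.2 hqodd).pow
    obtain ⟨h, hh⟩ := hPodd
    have hbig : 2 * q + 5 ≤ 2 * h + 1 := by
      rw [← hh]
      have h4 : 4 ≤ 2 ^ k := by
        calc 4 = 2 ^ 2 := by norm_num
          _ ≤ 2 ^ k := Nat.pow_le_pow_right (by norm_num) hk
      calc 2 * q + 5 ≤ q ^ 4 := by nlinarith [Nat.pow_le_pow_left hq3 3, pow_succ q 3]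
        _ ≤ _ := Nat.pow_le_pow_right (by omega) h4
    have hup := kl_upper (L := L) h2 ψ hψ a ha (2^k) h hh
      (by rw [hc, ← hh, ← pow_mul, pow_succ]) (by omega)
    have hPr : (q:ℝ) ^ (2 ^ k) = 2 * h + 1 := by exact_mod_cast hh
    set P : ℝ := 2 * h + 1 with hP
    have hPpos : 1 ≤ P := by rw [hP]; have : (0:ℝ) ≤ h := by positivity
                             linarith
    have h0 : kl (fun x : L => ψ (0 * Algebra.trace F L x)) (algebraMap F L a) = ((P ^ 2 - 1 : ℝ) : ℂ) := by
      rw [kl]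
      simp only [zero_mul, AddChar.map_zero_eq_one]
      rw [show (∑ x : L, if x = 0 then (0:ℂ) else 1) = ∑ x : L, (1 - if x = 0 then (1:ℂ) else 0) by
        refine sum_congr rfl fun x _ => ?_
        split_ifs <;> simp]
      rw [sum_sub_distrib]
      simp only [sum_const, card_univ, sum_ite_eq', mem_univ, if_true, nsmul_eq_mul, mul_one, hc]
      rw [← hPr, ← hq, pow_succ, pow_mul]
      push_cast; rfl
    rw [← Finset.add_sum_erase univ _ (mem_univ (0:F)), h0, Complex.add_re, Complex.ofReal_re] at hup
    have hs : ∑ c ∈ univ.erase (0:F), kl (fun x : L => ψ (c * Algebra.trace F L x)) (algebraMap F L a) =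
       ((∑ c ∈ univ.erase (0:F), klSeq q (K c) (k+1) : ℝ) : ℂ) := by
      push_cast
      exact sum_congr rfl fun c hc => hL c (ne_of_mem_erase hc)
    rw [hs, Complex.ofReal_re] at hup
    have hle : ∀ c, klSeq q (K c) (k+1) ≤ 2 * P := by
      intro c
      rw [klSeq, hPr]
      nlinarith [sq_nonneg (klSeq q (K c) k)]
    rw [← Finset.add_sum_erase (univ.erase (0:F)) _ (mem_erase.2 ⟨one_ne_zero, mem_univ (1:F)⟩)] at hup
    have hrest : ∑ c ∈ (univ.erase (0:F)).erase 1, klSeq q (K c) (k+1) ≤ q * (2 * P) := by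
      calc _ ≤ ∑ c ∈ (univ.erase (0:F)).erase 1, 2 * P := sum_le_sum fun c _ => hle c
        _ ≤ ∑ c : F, 2 * P := sum_le_sum_of_subset_of_nonneg (subset_univ _) (fun _ _ _ => by linarith)
        _ = _ := by simp [hq]
    have h1 : klSeq q (K 1) (k+1) = 2 * P - klSeq q (K 1) k ^ 2 := by rw [klSeq, hPr]
    rw [hPr] at hlow
    rw [← hq, h1] at hup
    have h5 : klSeq q (K 1) k ^ 2 - 2 * P ≤ 8 * q * P := by
      nlinarith
    have h6 : klSeq q (K 1) k ^ 2 ≤ (8 * q + 2) * P := by linarith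
    have h7 : klSeq q (K 1) k ^ 2 / P ≤ 8 * q + 2 := by
      rw [div_le_iff₀ (by linarith)]; exact h6
    linarith
  have hρ : K 1 ^ 2 / q - 4 ≤ 0 := by
    by_contra hcon
    push Not at hcon
    obtain ⟨k, hk⟩ := pow_unbounded_of_one_lt (8 * q / (K 1 ^ 2 / q - 4)) (by norm_num : (1:ℝ) < 4)
    have h3 := main (k+2) (by omega)
    rw [div_lt_iff₀ hcon] at hk
    have : (4:ℝ)^k ≤ 4^(k+2) := pow_le_pow_right₀ (by norm_num) (by omega)
    nlinarith
  have hK1 : kl ψ a = K 1 := by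
    rw [← hK 1]; simp
  rw [hK1, Complex.norm_real]
  have : K 1 ^ 2 ≤ 4 * q := by
    rw [sub_nonpos, div_le_iff₀ hq'] at hρ; exact hρ
  rw [Real.norm_eq_abs]
  refine abs_le_of_sq_le_sq ?_ (by positivity)
  rw [mul_pow, Real.sq_sqrt hq'.le]
  linarith

open Classical in
noncomputable def etaC (F : Type) [Field F] [Fintype F] : MulChar F ℂ :=
  (quadraticChar F).ringHomComp (Int.castRingHom ℂ)

open Classical in
theorem etaC_apply {F : Type} [Field F] [Fintype F] (a : F) :
    etaC F a = ((quadraticChar F a : ℤ) : ℂ) := rfl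

theorem etaC_quad {F : Type} [Field F] [Fintype F] : (etaC F).IsQuadratic := by
  classical
  exact (quadraticChar_isQuadratic F).comp _

theorem etaC_sq {F : Type} [Field F] [Fintype F] {a : F} (ha : a ≠ 0) : etaC F a ^ 2 = 1 := by
  classical
  rw [etaC_apply]
  exact_mod_cast quadraticChar_sq_one (F := F) ha

theorem etaC_norm {F : Type} [Field F] [Fintype F] {a : F} (ha : a ≠ 0) : ‖etaC F a‖ = 1 := by
  have h := etaC_sq ha
  have h' : ‖etaC F a‖ ^ 2 = 1 := by rw [← norm_pow, h, norm_one]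
  nlinarith [norm_nonneg (etaC F a)]

theorem etaC_ne_one {F : Type} [Field F] [Fintype F] (h2 : (2:F) ≠ 0) : etaC F ≠ 1 := by
  classical
  rw [etaC]
  refine (MulChar.ringHomComp_ne_one_iff (RingHom.injective_int _)).mpr ?_
  exact quadraticChar_ne_one (kl_ringChar h2)

theorem gs_norm {F : Type} [Field F] [Fintype F] (h2 : (2:F) ≠ 0) (ψ : AddChar F ℂ)
    (hψ : ψ.IsPrimitive) : ‖gaussSum (etaC F) ψ‖ = √(Fintype.card F) := by
  have h := gaussSum_sq (etaC_ne_one h2) etaC_quad hψ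
  have h' : ‖gaussSum (etaC F) ψ‖ ^ 2 = Fintype.card F := by
    rw [← norm_pow, h, norm_mul, etaC_norm (neg_ne_zero.mpr one_ne_zero)]; simp
  rw [← h', Real.sqrt_sq (norm_nonneg _)]

theorem gs_sum {F : Type} [Field F] [Fintype F] (ψ : AddChar F ℂ) {b : F} (hb : b ≠ 0) :
    ∑ y : F, etaC F y * ψ (b * y) = etaC F b * gaussSum (etaC F) ψ := by
  have := gaussSum_mulShift (etaC F) ψ (Units.mk0 b hb)
  rw [← this, ← mul_assoc, Units.val_mk0, ← sq, etaC_sq hb, one_mul]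
  simp [gaussSum, AddChar.mulShift_apply]

theorem gs_quad {F : Type} [Field F] [Fintype F] (h2 : (2:F) ≠ 0) (ψ : AddChar F ℂ)
    (hψ : ψ.IsPrimitive) {b : F} (hb : b ≠ 0) :
    ∑ z : F, ψ (b * z ^ 2) = etaC F b * gaussSum (etaC F) ψ := by
  classical
  rw [← gs_sum ψ hb, ← Finset.sum_fiberwise (s := univ) (g := fun z : F => z ^ 2)]
  have h0 : ∑ y : F, ψ (b * y) = 0 := by
    have := AddChar.sum_mulShift b hψ
    simp only [hb, if_false] at this
    rw [Nat.cast_zero] at this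
    rw [← this]
    exact sum_congr rfl fun y _ => by rw [mul_comm]
  have : ∀ y : F, ∑ z with z ^ 2 = y, ψ (b * z ^ 2) = ψ (b * y) + etaC F y * ψ (b * y) := by
    intro y
    rw [Finset.sum_congr rfl (g := fun _ => ψ (b * y))
      (fun z hz => by rw [(mem_filter.mp hz).2]), sum_const, nsmul_eq_mul, etaC_apply]
    have := kl_sqrts h2 y
    have h' : ((univ.filter fun x : F => x ^ 2 = y).card : ℂ)
      = 1 + ((quadraticChar F y : ℤ) : ℂ) := by exact_mod_cast this
    rw [h']; ring
  rw [Finset.sum_congr rfl fun y _ => this y, sum_add_distrib, h0, zero_add]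

theorem ac_sum {F : Type} [Field F] (ψ : AddChar F ℂ) {ι : Type} (s : Finset ι)
    (f : ι → F) : ψ (∑ i ∈ s, f i) = ∏ i ∈ s, ψ (f i) := by
  classical
  induction s using Finset.induction_on with
  | empty => simp
  | insert a s ha ih => rw [sum_insert ha, prod_insert ha, AddChar.map_add_eq_mul, ih]

theorem gs_lin {F : Type} [Field F] [Fintype F] (h2 : (2:F) ≠ 0) (ψ : AddChar F ℂ)
    (hψ : ψ.IsPrimitive) {b : F} (hb : b ≠ 0) (m : F) :
    ∑ z : F, ψ (b * z ^ 2 + m * z) =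
      ψ (-(m ^ 2 / (4 * b))) * (etaC F b * gaussSum (etaC F) ψ) := by
  have h4 : (4:F) ≠ 0 := by
    have : (4:F) = 2 * 2 := by norm_num
    rw [this]; exact mul_ne_zero h2 h2
  rw [← gs_quad h2 ψ hψ hb, mul_sum, ← Equiv.sum_comp (Equiv.addRight (m / (2 * b)))
    (fun z => ψ (-(m ^ 2 / (4 * b))) * ψ (b * z ^ 2))]
  refine sum_congr rfl fun z _ => ?_
  rw [← AddChar.map_add_eq_mul]
  congr 1
  simp only [Equiv.coe_addRight]
  field_simp
  ring

theorem gs_multi {F : Type} [Field F] [Fintype F] (h2 : (2:F) ≠ 0) (ψ : AddChar F ℂ)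
    (hψ : ψ.IsPrimitive) {d : ℕ} (w : Fin d → F) (hw : ∀ i, w i ≠ 0) {c : F} (hc : c ≠ 0)
    (m : Fin d → F) :
    ∑ x : Fin d → F, ψ (c * ∑ i, w i * x i ^ 2 + ∑ i, m i * x i) =
      ψ (-((∑ i, m i ^ 2 / (4 * w i)) / c)) *
        (etaC F c ^ d * (etaC F (∏ i, w i)) * gaussSum (etaC F) ψ ^ d) := by
  classical
  have h1 : ∀ x : Fin d → F, ψ (c * ∑ i, w i * x i ^ 2 + ∑ i, m i * x i) =
      ∏ i, ψ ((c * w i) * x i ^ 2 + m i * x i) := by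
    intro x
    rw [mul_sum, ← sum_add_distrib, ac_sum]
    exact prod_congr rfl fun i _ => by rw [mul_assoc]
  rw [sum_congr rfl fun x _ => h1 x,
    ← Fintype.prod_sum (fun i z => ψ ((c * w i) * z ^ 2 + m i * z)),
    prod_congr rfl fun i _ => gs_lin h2 ψ hψ (mul_ne_zero hc (hw i)) (m i),
    prod_mul_distrib, prod_mul_distrib, ← ac_sum]
  congr 1
  · rw [sum_neg_distrib, sum_div]
    congr 2
    refine sum_congr rfl fun i _ => ?_
    rw [div_div]; congr 1; ring
  · simp only [map_mul, prod_mul_distrib, prod_const, card_univ, Fintype.card_fin, map_prod]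

theorem ac_sum_zero {F : Type} [Field F] [Fintype F] (ψ : AddChar F ℂ) (hψ : ψ.IsPrimitive)
    {b : F} (hb : b ≠ 0) : ∑ y : F, ψ (b * y) = 0 := by
  classical
  have := AddChar.sum_mulShift b hψ
  simp only [hb, if_false] at this
  rw [Nat.cast_zero] at this
  rw [← this]
  exact sum_congr rfl fun y _ => by rw [mul_comm]

open Classical in
noncomputable def innerS {F : Type} [Field F] [Fintype F] (ψ : AddChar F ℂ) (d : ℕ) (t R : F) : ℂ :=
  ∑ c : F, if c = 0 then 0 else etaC F c ^ d * ψ (-(c * t) - R / c)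

theorem sum_ite_zero_sub {F : Type} [Field F] [Fintype F] [DecidableEq F] (f : F → ℂ) :
    (∑ c : F, if c = 0 then 0 else f c) = ∑ c, f c - f 0 := by
  have : ∀ c : F, (if c = 0 then 0 else f c) = f c - if c = 0 then f 0 else 0 := by
    intro c; split_ifs with h <;> simp [h]
  rw [sum_congr rfl fun c _ => this c, sum_sub_distrib]
  simp

theorem innerS_even_zero {F : Type} [Field F] [Fintype F] (ψ : AddChar F ℂ)
    (hψ : ψ.IsPrimitive) {d : ℕ} (hd : Even d) {t : F} (ht : t ≠ 0) : innerS ψ d t 0 = -1 := by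
  classical
  have h1 : innerS ψ d t 0 = ∑ c : F, if c = 0 then 0 else ψ (-t * c) := by
    refine sum_congr rfl fun c _ => ?_
    split_ifs with h
    · rfl
    · obtain ⟨k, rfl⟩ := hd
      rw [← two_mul, pow_mul, etaC_sq h, one_pow, one_mul]
      congr 1; simp; ring
  rw [h1, sum_ite_zero_sub, ac_sum_zero ψ hψ (neg_ne_zero.mpr ht)]
  simp

theorem innerS_odd_zero {F : Type} [Field F] [Fintype F] (h2 : (2:F) ≠ 0) (ψ : AddChar F ℂ)
    (hψ : ψ.IsPrimitive) {d : ℕ} (hd : Odd d) {t : F} (ht : t ≠ 0) :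
    ‖innerS ψ d t 0‖ = √(Fintype.card F) := by
  classical
  have h1 : innerS ψ d t 0 = ∑ c : F, etaC F c * ψ (-t * c) := by
    refine sum_congr rfl fun c _ => ?_
    split_ifs with h
    · rw [h, MulChar.map_zero, zero_mul]
    · obtain ⟨k, rfl⟩ := hd
      rw [pow_add, pow_mul, etaC_sq h, one_pow, one_mul, pow_one]
      congr 2; simp; ring
  rw [h1, gs_sum ψ (neg_ne_zero.mpr ht), norm_mul, etaC_norm (neg_ne_zero.mpr ht), one_mul,
    gs_norm h2 ψ hψ]

theorem innerS_even {F : Type} [Field F] [Fintype F] (h2 : (2:F) ≠ 0) (ψ : AddChar F ℂ)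
    (hψ : ψ.IsPrimitive) {d : ℕ} (hd : Even d) {t R : F} (ht : t ≠ 0) (hR : R ≠ 0) :
    ‖innerS ψ d t R‖ ≤ 2 * √(Fintype.card F) := by
  classical
  have h1 : innerS ψ d t R = kl ψ (t * R) := by
    unfold kl
    rw [← Equiv.sum_comp (Equiv.mulRight₀ (-t) (neg_ne_zero.mpr ht))]
    refine sum_congr rfl fun c _ => ?_
    by_cases h : c = 0
    · simp [h]
    · have h' : c * -t ≠ 0 := mul_ne_zero h (neg_ne_zero.mpr ht)
      have e : (Equiv.mulRight₀ (-t) (neg_ne_zero.mpr ht)) c = c * -t := rfl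
      rw [e, if_neg h, if_neg h']
      obtain ⟨k, rfl⟩ := hd
      rw [← two_mul, pow_mul, etaC_sq h, one_pow, one_mul]
      congr 1; field_simp; ring
  rw [h1]
  exact kl_bound h2 ψ hψ _ (mul_ne_zero ht hR)

theorem innerS_odd {F : Type} [Field F] [Fintype F] (h2 : (2:F) ≠ 0) (ψ : AddChar F ℂ)
    (hψ : ψ.IsPrimitive) {d : ℕ} (hd : Odd d) {t R : F} (hR : R ≠ 0) :
    ‖innerS ψ d t R‖ ≤ 2 * √(Fintype.card F) := by
  classical
  have h1 : etaC F R * gaussSum (etaC F) ψ * innerS ψ d t R =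
      ∑ c : F, if c = 0 then 0 else ∑ z : F, ψ (c * (R * z ^ 2 - t) + 2 * R * z) := by
    unfold innerS
    rw [mul_sum]
    refine sum_congr rfl fun c _ => ?_
    split_ifs with h
    · simp
    · obtain ⟨k, rfl⟩ := hd
      rw [pow_add, pow_mul, etaC_sq h, one_pow, one_mul, pow_one]
      have e := gs_quad h2 ψ hψ (mul_ne_zero hR h)
      rw [map_mul] at e
      calc _ = etaC F R * etaC F c * gaussSum (etaC F) ψ * ψ (-(c * t) - R / c) := by ring
        _ = ∑ z : F, ψ (R * c * (z + 1 / c) ^ 2) * ψ (-(c * t) - R / c) := by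
          rw [← e, ← Equiv.sum_comp (Equiv.addRight (1 / c)), sum_mul]; rfl
        _ = _ := by
          refine sum_congr rfl fun z _ => ?_
          rw [← AddChar.map_add_eq_mul]
          congr 1; field_simp; ring
  have h3 : etaC F R * gaussSum (etaC F) ψ * innerS ψ d t R =
      ∑ z : F, if z ^ 2 = t / R then (Fintype.card F : ℂ) * ψ (2 * R * z) else 0 := by
    rw [h1, sum_ite_zero_sub, sum_comm]
    have : ∑ z : F, ψ (0 * (R * z ^ 2 - t) + 2 * R * z) = 0 := by
      simp only [zero_mul, zero_add]
      exact ac_sum_zero ψ hψ (mul_ne_zero h2 hR)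
    rw [this, sub_zero]
    refine sum_congr rfl fun z _ => ?_
    simp only [AddChar.map_add_eq_mul]
    rw [← sum_mul, AddChar.sum_mulShift _ hψ]
    have : R * z ^ 2 - t = 0 ↔ z ^ 2 = t / R := by
      rw [sub_eq_zero, eq_div_iff hR, mul_comm]
    simp only [this]
    split_ifs <;> simp
  have h4 : √(Fintype.card F) * ‖innerS ψ d t R‖ ≤ 2 * Fintype.card F := by
    have : √(Fintype.card F) * ‖innerS ψ d t R‖ =
        ‖etaC F R * gaussSum (etaC F) ψ * innerS ψ d t R‖ := by
      rw [norm_mul, norm_mul, etaC_norm hR, gs_norm h2 ψ hψ, one_mul]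
    rw [this, h3, ← sum_filter]
    refine (norm_sum_le _ _).trans ?_
    have hn : ∀ z : F, ‖(Fintype.card F : ℂ) * ψ (2 * R * z)‖ = Fintype.card F := by
      intro z; rw [norm_mul, AddChar.norm_apply]; simp
    simp only [hn, sum_const, nsmul_eq_mul]
    gcongr
    have e := kl_sqrts h2 (t / R)
    have : quadraticChar F (t / R) ≤ 1 := by
      by_cases h : t / R = 0
      · rw [h]; simp
      · rcases quadraticChar_dichotomy h with h | h <;> rw [h] <;> norm_num
    have : ((univ.filter fun x : F => x ^ 2 = t / R).card : ℤ) ≤ 2 := by linarith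
    exact_mod_cast this
  have hq : (0:ℝ) < Fintype.card F := by exact_mod_cast Fintype.card_pos
  have hs : 0 < √(Fintype.card F : ℝ) := Real.sqrt_pos.mpr hq
  have : √(Fintype.card F) * ‖innerS ψ d t R‖ ≤ √(Fintype.card F) * (2 * √(Fintype.card F)) := by
    nlinarith [Real.mul_self_sqrt hq.le]
  exact le_of_mul_le_mul_left this hs

theorem innerS_bound {F : Type} [Field F] [Fintype F] (h2 : (2:F) ≠ 0) (ψ : AddChar F ℂ)
    (hψ : ψ.IsPrimitive) (d : ℕ) {t : F} (ht : t ≠ 0) (R : F) :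
    ‖innerS ψ d t R‖ ≤ 2 * √(Fintype.card F) := by
  have hq : (1:ℝ) ≤ √(Fintype.card F) := by
    rw [Real.one_le_sqrt]; exact_mod_cast Fintype.card_pos
  rcases Nat.even_or_odd d with hd | hd
  · by_cases hR : R = 0
    · rw [hR, innerS_even_zero ψ hψ hd ht]; simp; linarith
    · exact innerS_even h2 ψ hψ hd ht hR
  · by_cases hR : R = 0
    · rw [hR, innerS_odd_zero h2 ψ hψ hd ht]; linarith
    · exact innerS_odd h2 ψ hψ hd hR

/-- Fourier transform of the sphere. -/
theorem sphere_fourier {F : Type} [Field F] [Fintype F] [DecidableEq F] (h2 : (2:F) ≠ 0)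
    (ψ : AddChar F ℂ)
    (hψ : ψ.IsPrimitive) {d : ℕ} (w : Fin d → F) (hw : ∀ i, w i ≠ 0) (t : F) (m : Fin d → F) :
    (Fintype.card F : ℂ) * ∑ x : Fin d → F,
        (if ∑ i, w i * x i ^ 2 = t then ψ (∑ i, m i * x i) else 0) =
      (if m = 0 then (Fintype.card F : ℂ) ^ d else 0) +
        etaC F (∏ i, w i) * gaussSum (etaC F) ψ ^ d *
          innerS ψ d t (∑ i, m i ^ 2 / (4 * w i)) := by
  have h1 : (Fintype.card F : ℂ) * ∑ x : Fin d → F,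
        (if ∑ i, w i * x i ^ 2 = t then ψ (∑ i, m i * x i) else 0) =
      ∑ c : F, ∑ x : Fin d → F, ψ (-(c * t)) * ψ (c * ∑ i, w i * x i ^ 2 + ∑ i, m i * x i) := by
    rw [mul_sum, sum_comm]
    refine sum_congr rfl fun x _ => ?_
    have : ∀ c : F, ψ (-(c * t)) * ψ (c * ∑ i, w i * x i ^ 2 + ∑ i, m i * x i) =
        ψ (c * (∑ i, w i * x i ^ 2 - t)) * ψ (∑ i, m i * x i) := by
      intro c
      rw [← AddChar.map_add_eq_mul, ← AddChar.map_add_eq_mul]; congr 1; ring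
    rw [sum_congr rfl fun c _ => this c, ← sum_mul, AddChar.sum_mulShift _ hψ]
    simp only [sub_eq_zero]
    split_ifs <;> simp
  have h0 : ∑ x : Fin d → F, ψ (∑ i, m i * x i) =
      (if m = 0 then (Fintype.card F : ℂ) ^ d else 0) := by
    simp only [ac_sum]
    rw [← Fintype.prod_sum (fun i z => ψ (m i * z))]
    split_ifs with hm
    · simp [hm]
    · obtain ⟨i, hi⟩ := Function.ne_iff.mp hm
      exact prod_eq_zero (mem_univ i) (ac_sum_zero ψ hψ hi)
  rw [h1]
  unfold innerS
  rw [mul_sum, ← h0, ← sub_eq_iff_eq_add']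
  have h5 := sum_ite_zero_sub (F := F) (fun c => ∑ x : Fin d → F,
    ψ (-(c * t)) * ψ (c * ∑ i, w i * x i ^ 2 + ∑ i, m i * x i))
  simp only [zero_mul, neg_zero, AddChar.map_zero_eq_one, one_mul, zero_add] at h5
  rw [← h5]
  refine sum_congr rfl fun c _ => ?_
  by_cases hc : c = 0
  · simp [hc]
  · rw [if_neg hc, if_neg hc, ← mul_sum, gs_multi h2 ψ hψ w hw hc m, sub_eq_add_neg,
      AddChar.map_add_eq_mul]
    ring

theorem char_orth {F : Type} [Field F] [Fintype F] [DecidableEq F] (ψ : AddChar F ℂ)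
    (hψ : ψ.IsPrimitive) {d : ℕ} (m : Fin d → F) :
    ∑ x : Fin d → F, ψ (m ⬝ᵥ x) = (if m = 0 then (Fintype.card F : ℂ) ^ d else 0) := by
  simp only [dotProduct, ac_sum]
  rw [← Fintype.prod_sum (fun i z => ψ (m i * z))]
  split_ifs with hm
  · simp [hm]
  · obtain ⟨i, hi⟩ := Function.ne_iff.mp hm
    exact prod_eq_zero (mem_univ i) (ac_sum_zero ψ hψ hi)

noncomputable def fhat {F : Type} [Field F] [Fintype F] (ψ : AddChar F ℂ) {d : ℕ}
    (f : (Fin d → F) → ℂ) (m : Fin d → F) : ℂ := by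
  classical exact ∑ x, f x * ψ (m ⬝ᵥ x)

theorem fhat_parseval {F : Type} [Field F] [Fintype F] [DecidableEq F] (ψ : AddChar F ℂ)
    (hψ : ψ.IsPrimitive) {d : ℕ} (f : (Fin d → F) → ℂ) :
    ∑ m, ‖fhat ψ f m‖ ^ 2 = (Fintype.card F : ℝ) ^ d * ∑ x, ‖f x‖ ^ 2 := by
  have key : ∀ z : ℂ, ((‖z‖ ^ 2 : ℝ) : ℂ) = z * (starRingEnd ℂ) z := by
    intro z; rw [Complex.mul_conj, Complex.normSq_eq_norm_sq]
  have : ((∑ m, ‖fhat ψ f m‖ ^ 2 : ℝ) : ℂ) =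
      (((Fintype.card F : ℝ) ^ d * ∑ x, ‖f x‖ ^ 2 : ℝ) : ℂ) := by
    rw [Complex.ofReal_sum, Complex.ofReal_mul, Complex.ofReal_sum]
    simp only [key]
    calc _ = ∑ m : Fin d → F, ∑ x : Fin d → F, ∑ y : Fin d → F,
          (f x * (starRingEnd ℂ) (f y)) * ψ ((x - y) ⬝ᵥ m) := by
          refine sum_congr rfl fun m _ => ?_
          simp only [fhat]
          rw [map_sum, sum_mul_sum]
          refine sum_congr rfl fun x _ => sum_congr rfl fun y _ => ?_
          rw [map_mul, ← AddChar.map_neg_eq_conj, sub_dotProduct, sub_eq_add_neg,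
            AddChar.map_add_eq_mul, dotProduct_comm m x, dotProduct_comm m y]
          ring
      _ = ∑ x : Fin d → F, ∑ y : Fin d → F,
          (f x * (starRingEnd ℂ) (f y)) *
            (if x - y = 0 then (Fintype.card F : ℂ) ^ d else 0) := by
          rw [sum_comm]
          refine sum_congr rfl fun x _ => ?_
          rw [sum_comm]
          refine sum_congr rfl fun y _ => ?_
          rw [← mul_sum, char_orth ψ hψ]
      _ = _ := by
          rw [mul_sum]
          refine sum_congr rfl fun x _ => ?_
          simp only [sub_eq_zero, mul_ite, mul_zero]
          simp
          ring
  exact_mod_cast this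

theorem fhat_conv {F : Type} [Field F] [Fintype F] [DecidableEq F] (ψ : AddChar F ℂ)
    {d : ℕ} (K f : (Fin d → F) → ℂ) (m : Fin d → F) :
    fhat ψ (fun x => ∑ y, K (x - y) * f y) m = fhat ψ K m * fhat ψ f m := by
  simp only [fhat]
  rw [mul_comm, sum_mul_sum]
  simp only [sum_mul]
  rw [sum_comm]
  refine sum_congr rfl fun y _ => ?_
  rw [← Equiv.sum_comp (Equiv.addRight y)]
  refine sum_congr rfl fun x _ => ?_
  simp only [Equiv.coe_addRight, add_sub_cancel_right, dotProduct_add, AddChar.map_add_eq_mul]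
  ring

theorem conv_bound {F : Type} [Field F] [Fintype F] [DecidableEq F] (ψ : AddChar F ℂ)
    (hψ : ψ.IsPrimitive) {d : ℕ} (K f : (Fin d → F) → ℂ) (L : ℝ)
    (hK : ∀ m, ‖fhat ψ K m‖ ^ 2 ≤ L) :
    ∑ x, ‖∑ y, K (x - y) * f y‖ ^ 2 ≤ L * ∑ x, ‖f x‖ ^ 2 := by
  have hq : (0:ℝ) < (Fintype.card F : ℝ) ^ d := by
    have : (0:ℝ) < Fintype.card F := by exact_mod_cast Fintype.card_pos
    positivity
  refine le_of_mul_le_mul_left ?_ hq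
  rw [← fhat_parseval ψ hψ (fun x => ∑ y, K (x - y) * f y)]
  calc _ ≤ ∑ m, L * ‖fhat ψ f m‖ ^ 2 := by
        refine sum_le_sum fun m _ => ?_
        rw [fhat_conv, norm_mul, mul_pow]
        exact mul_le_mul_of_nonneg_right (hK m) (by positivity)
    _ = _ := by rw [← mul_sum, fhat_parseval ψ hψ]; ring

theorem diag_main {F : Type} [Field F] [Fintype F] [DecidableEq F] (h2 : (2:F) ≠ 0)
    {d : ℕ} (hd : 1 ≤ d) (w : Fin d → F) (hw : ∀ i, w i ≠ 0) (t : F) (ht : t ≠ 0) :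
    ∃ θ : ℝ, |Fintype.card F * θ - 1| * √(Fintype.card F) ^ d ≤
        (if Even d then 1 else √(Fintype.card F)) ∧
      ∀ f : (Fin d → F) → ℝ,
        ∑ x : Fin d → F, (∑ y : Fin d → F, ((if ∑ i, w i * (x i - y i) ^ 2 = t then 1 else 0) - θ) * f y) ^ 2 ≤
          4 * (Fintype.card F : ℝ) ^ (d - 1) * ∑ x, f x ^ 2 := by
  classical
  obtain ⟨ψ, hψ⟩ : ∃ ψ : AddChar F ℂ, ψ.IsPrimitive :=
    ⟨_, AddChar.FiniteField.primitiveChar_to_Complex_isPrimitive F⟩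
  set q : ℝ := (Fintype.card F : ℝ) with hqd
  have hqC : (Fintype.card F : ℂ) = (q : ℂ) := by simp [hqd]
  have hq : 0 < q := by rw [hqd]; exact_mod_cast Fintype.card_pos
  have hs : 0 < √q := Real.sqrt_pos.mpr hq
  have hss : √q ^ 2 = q := Real.sq_sqrt hq.le
  have hite : ∀ (P : Prop) [Decidable P], (((if P then 1 else 0 : ℝ)) : ℂ) = if P then 1 else 0 := by
    intro P _; split_ifs <;> simp
  have hwp : (∏ i, w i) ≠ 0 := prod_ne_zero_iff.mpr fun i _ => hw i
  set k : ℝ := ∑ x : Fin d → F, if ∑ i, w i * x i ^ 2 = t then (1:ℝ) else 0 with hk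
  have hkC : (k : ℂ) = ∑ x : Fin d → F, if ∑ i, w i * x i ^ 2 = t then (1:ℂ) else 0 := by
    rw [hk]; push_cast; simp only [hite]
  refine ⟨k / q ^ d, ?_, ?_⟩
  · have h := sphere_fourier h2 ψ hψ w hw t 0
    simp only [Pi.zero_apply, zero_mul, sum_const_zero, AddChar.map_zero_eq_one, if_true] at h
    rw [← hkC, hqC] at h
    have e0 : (∑ i, (0:F) ^ 2 / (4 * w i)) = 0 := by simp
    rw [e0, ← sub_eq_iff_eq_add'] at h
    have h' := congrArg norm h
    rw [norm_mul, norm_mul, norm_pow, etaC_norm hwp, one_mul, gs_norm h2 ψ hψ, ← hqd] at h'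
    have h3 : ‖(q:ℂ) * k - q ^ d‖ = |q * k - q ^ d| := by
      rw [← Real.norm_eq_abs, ← Complex.norm_real]; push_cast; rfl
    rw [h3] at h'
    have h4 : |q * (k / q ^ d) - 1| * √q ^ d * √q ^ d = |q * k - q ^ d| := by
      have : q * k - q ^ d = (q * (k / q ^ d) - 1) * q ^ d := by field_simp
      rw [this, abs_mul, abs_of_pos (pow_pos hq d), mul_assoc, ← mul_pow, ← sq, hss]
    have h5 : |q * (k / q ^ d) - 1| * √q ^ d = ‖innerS ψ d t 0‖ := by
      refine mul_right_cancel₀ (pow_pos hs d).ne' ?_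
      rw [h4, h', mul_comm]
    rw [h5]
    split_ifs with hev
    · rw [innerS_even_zero ψ hψ hev ht]; simp
    · exact (innerS_odd_zero h2 ψ hψ (Nat.not_even_iff_odd.mp hev) ht).le
  · intro f
    have hb := conv_bound ψ hψ
      (fun v : Fin d → F => (if ∑ i, w i * v i ^ 2 = t then (1:ℂ) else 0) - ((k / q ^ d : ℝ) : ℂ))
      (fun y => (f y : ℂ)) (4 * q ^ (d - 1)) ?_
    · have e1 : ∀ x : Fin d → F, ‖∑ y, ((if ∑ i, w i * (x - y) i ^ 2 = t then (1:ℂ) else 0)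
          - ((k / q ^ d : ℝ) : ℂ)) * (f y : ℂ)‖ ^ 2 =
          (∑ y, ((if ∑ i, w i * (x i - y i) ^ 2 = t then 1 else 0) - k / q ^ d) * f y) ^ 2 := by
        intro x
        rw [← sq_abs (∑ y, _), ← Real.norm_eq_abs, ← Complex.norm_real]
        push_cast
        simp only [hite]
        rfl
      simp only [e1, Complex.norm_real, Real.norm_eq_abs, sq_abs] at hb
      exact hb
    · intro m
      have hl := sphere_fourier h2 ψ hψ w hw t m
      have hfh : fhat ψ (fun v : Fin d → F => (if ∑ i, w i * v i ^ 2 = t then (1:ℂ) else 0)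
          - ((k / q ^ d : ℝ) : ℂ)) m = (∑ x : Fin d → F,
        (if ∑ i, w i * x i ^ 2 = t then ψ (∑ i, m i * x i) else 0))
          - ((k / q ^ d : ℝ) : ℂ) * (if m = 0 then (q : ℂ) ^ d else 0) := by
        simp only [fhat, sub_mul]
        rw [sum_sub_distrib, ← mul_sum, char_orth ψ hψ, hqC]
        congr 1
        refine sum_congr rfl fun x _ => ?_
        split_ifs <;> simp [dotProduct]
      rw [hfh]
      by_cases hm : m = 0
      · have : (∑ x : Fin d → F, (if ∑ i, w i * x i ^ 2 = t then ψ (∑ i, m i * x i) else 0)) = k := by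
          rw [hkC]; simp [hm]
        rw [this, if_pos hm]
        have : (k:ℂ) - ((k / q ^ d : ℝ) : ℂ) * (q:ℂ) ^ d = 0 := by
          have hqc : (q:ℂ) ≠ 0 := by exact_mod_cast hq.ne'
          push_cast; field_simp; simp
        rw [this]; simp; positivity
      · rw [if_neg hm, mul_zero, sub_zero]
        rw [if_neg hm, zero_add] at hl
        have h' := congrArg norm hl
        rw [norm_mul, norm_mul, norm_mul, norm_pow, etaC_norm hwp, one_mul, gs_norm h2 ψ hψ,
          ← hqd, hqC, Complex.norm_real, Real.norm_eq_abs, abs_of_pos hq] at h'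
        have hi := innerS_bound h2 ψ hψ d ht (∑ i, m i ^ 2 / (4 * w i))
        rw [← hqd] at hi
        have h6 := congrArg (fun z => z ^ 2) h'
        simp only [mul_pow] at h6
        rw [← pow_mul, mul_comm d 2, pow_mul, hss] at h6
        have hi2 : ‖innerS ψ d t (∑ i, m i ^ 2 / (4 * w i))‖ ^ 2 ≤ 4 * q := by
          have := pow_le_pow_left₀ (norm_nonneg _) hi 2
          rw [mul_pow, hss] at this; linarith
        refine le_of_mul_le_mul_left ?_ (pow_pos hq 2)
        rw [h6]
        obtain ⟨e, rfl⟩ : ∃ e, d = e + 1 := ⟨d - 1, by omega⟩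
        calc _ ≤ q ^ (e + 1) * (4 * q) := by gcongr
          _ = _ := by rw [Nat.add_sub_cancel]; ring

theorem gen_main {F : Type} [Field F] [Fintype F] [DecidableEq F] (h2 : (2:F) ≠ 0)
    {d : ℕ} (hd : 1 ≤ d) (Q : QuadraticForm F (Fin d → F))
    (hQ : ∀ x, (∀ y, QuadraticMap.polar (⇑Q) x y = 0) → x = 0) (t : F) (ht : t ≠ 0) :
    ∃ θ : ℝ, |Fintype.card F * θ - 1| * √(Fintype.card F) ^ d ≤
        (if Even d then 1 else √(Fintype.card F)) ∧
      ∀ f : (Fin d → F) → ℝ,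
        ∑ x : Fin d → F, (∑ y : Fin d → F, ((if Q (x - y) = t then 1 else 0) - θ) * f y) ^ 2 ≤
          4 * (Fintype.card F : ℝ) ^ (d - 1) * ∑ x, f x ^ 2 := by
  have : Invertible (2:F) := invertibleOfNonzero h2
  obtain ⟨w, ⟨e⟩⟩ := QuadraticForm.equivalent_weightedSumSquares_units_of_nondegenerate' Q (by
    intro x hx
    refine hQ x fun y => ?_
    have h := hx y
    have h5 := LinearMap.congr_fun (LinearMap.congr_fun
      (QuadraticMap.two_nsmul_associated F Q) x) y
    rw [← QuadraticMap.polarBilin_apply_apply, ← h5]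
    simp only [LinearMap.smul_apply, h, smul_zero])
  have hfr : Module.finrank F (Fin d → F) = d := by simp
  generalize Module.finrank F (Fin d → F) = d' at *
  subst hfr
  obtain ⟨θ, h1, h3⟩ := diag_main h2 hd (fun i => (w i : F)) (fun i => (w i).ne_zero) t ht
  refine ⟨θ, h1, fun f => ?_⟩
  have h4 := h3 (fun x => f (e.toLinearEquiv.symm x))
  have hQe : ∀ x y : Fin d' → F, Q (x - y) =
      ∑ i, (w i : F) * (e.toLinearEquiv x i - e.toLinearEquiv y i) ^ 2 := by
    intro x y
    have := e.map_app (x - y)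
    rw [← this, QuadraticMap.weightedSumSquares_apply]
    refine sum_congr rfl fun i _ => ?_
    have : e (x - y) = e.toLinearEquiv x - e.toLinearEquiv y := map_sub e.toLinearEquiv x y
    rw [this, Pi.sub_apply, sq]; rfl
  rw [← Equiv.sum_comp e.toLinearEquiv.toEquiv,
    ← Equiv.sum_comp e.toLinearEquiv.toEquiv (fun x => f (e.toLinearEquiv.symm x) ^ 2)] at h4
  have e1 : ∀ x : Fin d' → F, e.toLinearEquiv.symm (e.toLinearEquiv.toEquiv x) = x :=
    fun x => e.toLinearEquiv.symm_apply_apply x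
  simp only [e1] at h4
  refine le_trans (le_of_eq ?_) h4
  refine sum_congr rfl fun x _ => ?_
  rw [← Equiv.sum_comp e.toLinearEquiv.toEquiv (fun y =>
    ((if ∑ i, (w i : F) * (e.toLinearEquiv.toEquiv x i - y i) ^ 2 = t then 1 else 0) - θ)
      * f (e.toLinearEquiv.symm y))]
  simp only [e1, hQe]
  rfl

theorem comb_main {V : Type} [Fintype V] [DecidableEq V] (A : V → V → ℝ)
    (hA : ∀ x y, A x y ^ 2 = A x y) (hsym : ∀ x y, A x y = A y x) (θ l : ℝ) (hl : 0 ≤ l)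
    (hθ0 : 0 ≤ θ) (hθ1 : θ ≤ 1)
    (H : ∀ f : V → ℝ, ∑ x, (∑ y, (A x y - θ) * f y) ^ 2 ≤ l ^ 2 * ∑ x, f x ^ 2)
    (E : Finset V) (n : ℝ) (hn : n = E.card) :
    ∃ b S s T : ℝ, (∑ x ∈ E, ∑ y ∈ E, ∑ z ∈ E, ∑ v ∈ E, A x y * A y z * A z v * A v x) =
        θ ^ 4 * n ^ 4 + 4 * θ ^ 3 * n ^ 2 * b + 4 * θ ^ 2 * n * S + 2 * θ ^ 2 * b ^ 2
          + 4 * θ * s + T ∧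
      |b| ≤ l * n ∧ 0 ≤ S ∧ S ≤ l ^ 2 * n ∧ |s| ≤ l ^ 3 * n ∧ 0 ≤ T ∧
      T ≤ l ^ 2 * (θ * n ^ 2 + l * n) := by
  have hn0 : 0 ≤ n := by rw [hn]; positivity
  set B : V → V → ℝ := fun x y => A x y - θ with hB
  have hBs : ∀ x y, B x y = B y x := fun x y => by simp only [hB, hsym x y]
  have HE : ∀ f : V → ℝ, ∑ x ∈ E, (∑ y ∈ E, B x y * f y) ^ 2 ≤ l ^ 2 * ∑ x ∈ E, f x ^ 2 := by
    intro f
    have h := H (fun y => if y ∈ E then f y else 0)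
    have e1 : ∀ x, (∑ y, (A x y - θ) * if y ∈ E then f y else 0) = ∑ y ∈ E, B x y * f y := by
      intro x
      simp [hB, Finset.sum_ite_mem]
    have e2 : (∑ x, (if x ∈ E then f x else 0) ^ 2) = ∑ x ∈ E, f x ^ 2 := by
      simp [ite_pow, Finset.sum_ite_mem]
    simp only [e1, e2] at h
    refine le_trans ?_ h
    exact sum_le_sum_of_subset_of_nonneg (subset_univ _) fun _ _ _ => sq_nonneg _
  set u : V → ℝ := fun x => ∑ y ∈ E, B x y with hu
  set b := ∑ x ∈ E, u x with hb
  set S := ∑ x ∈ E, u x ^ 2 with hS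
  set s := ∑ x ∈ E, u x * ∑ y ∈ E, B x y * u y with hs
  set D : V → V → ℝ := fun x z => ∑ y ∈ E, B x y * B y z with hD
  set T := ∑ x ∈ E, ∑ z ∈ E, D x z ^ 2 with hT
  have hS0 : 0 ≤ S := sum_nonneg fun _ _ => sq_nonneg _
  have hS1 : S ≤ l ^ 2 * n := by
    have := HE (fun _ => 1)
    simp only [mul_one, one_pow, sum_const, nsmul_eq_mul] at this
    rw [hn]; exact this
  have hb1 : |b| ≤ l * n := by
    refine abs_le_of_sq_le_sq ?_ (by positivity)
    have h1 : b ^ 2 ≤ E.card * S := sq_sum_le_card_mul_sum_sq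
    rw [← hn] at h1
    nlinarith
  have hs1 : |s| ≤ l ^ 3 * n := by
    have h1 : s ^ 2 ≤ S * ∑ x ∈ E, (∑ y ∈ E, B x y * u y) ^ 2 := sum_mul_sq_le_sq_mul_sq _ _ _
    have h3 : s ^ 2 ≤ (l * S) ^ 2 := by
      have := HE u
      nlinarith
    have := abs_le_of_sq_le_sq h3 (by positivity)
    calc |s| ≤ l * S := this
      _ ≤ l * (l ^ 2 * n) := by gcongr
      _ = _ := by ring
  have hT0 : 0 ≤ T := sum_nonneg fun _ _ => sum_nonneg fun _ _ => sq_nonneg _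
  have hT1 : T ≤ l ^ 2 * (θ * n ^ 2 + l * n) := by
    have h1 : T ≤ l ^ 2 * ∑ z ∈ E, ∑ y ∈ E, B y z ^ 2 := by
      rw [hT, sum_comm, mul_sum]
      exact sum_le_sum fun z _ => HE (fun y => B y z)
    have h3 : ∑ z ∈ E, ∑ y ∈ E, B y z ^ 2 = (1 - 2 * θ) * (θ * n ^ 2 + b) + θ ^ 2 * n ^ 2 := by
      have : ∀ z y, B y z ^ 2 = (1 - 2 * θ) * B z y + (θ - θ ^ 2) := by
        intro z y
        rw [hBs z y]
        have := hA y z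
        simp only [hB]
        linear_combination this
      simp only [this, sum_add_distrib, ← mul_sum, sum_const, nsmul_eq_mul, ← hn]
      simp only [hb, hu]
      ring
    refine h1.trans ?_
    have h5 : (1 - 2 * θ) * b ≤ l * n := by
      refine (le_abs_self _).trans ?_
      rw [abs_mul]
      have : |1 - 2 * θ| ≤ 1 := by rw [abs_le]; constructor <;> linarith
      nlinarith [abs_nonneg b, abs_nonneg (1 - 2 * θ)]
    refine mul_le_mul_of_nonneg_left ?_ (by positivity)
    rw [h3]
    nlinarith [mul_nonneg (sq_nonneg θ) (sq_nonneg n)]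
  refine ⟨b, S, s, T, ?_, hb1, hS0, hS1, hs1, hT0, hT1⟩
  have hc : ∀ x z, ∑ y ∈ E, A x y * A y z = θ ^ 2 * n + θ * (u x + u z) + D x z := by
    intro x z
    have : ∀ y, A x y * A y z = θ ^ 2 + (θ * B x y + θ * B z y) + B x y * B y z := by
      intro y
      rw [hBs z y]; simp only [hB]; ring
    simp only [this, sum_add_distrib, ← mul_sum, sum_const, nsmul_eq_mul, ← hn]
    simp only [hu, hD]; ring
  have h1 : (∑ x ∈ E, ∑ y ∈ E, ∑ z ∈ E, ∑ v ∈ E, A x y * A y z * A z v * A v x) =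
      ∑ x ∈ E, ∑ z ∈ E, (θ ^ 2 * n + θ * (u x + u z) + D x z) ^ 2 := by
    refine sum_congr rfl fun x _ => ?_
    rw [sum_comm]
    refine sum_congr rfl fun z _ => ?_
    rw [← hc, sq, sum_mul_sum]
    refine sum_congr rfl fun y _ => sum_congr rfl fun v _ => ?_
    rw [hsym z v, hsym v x]; ring
  have hD1 : ∑ x ∈ E, ∑ z ∈ E, D x z = S := by
    have : ∀ x, ∑ z ∈ E, D x z = ∑ y ∈ E, B x y * u y := by
      intro x
      simp only [hD, hu, mul_sum]; rw [sum_comm]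
    simp only [this]
    rw [sum_comm, hS]
    refine sum_congr rfl fun y _ => ?_
    rw [← sum_mul, sq]; simp only [hu]; congr 1
    exact sum_congr rfl fun x _ => hBs x y
  have hD2 : ∑ x ∈ E, ∑ z ∈ E, u x * D x z = s := by
    rw [hs]
    refine sum_congr rfl fun x _ => ?_
    rw [← mul_sum]; congr 1
    simp only [hD, hu, mul_sum]; rw [sum_comm]
  have hDs : ∀ x z, D x z = D z x := by
    intro x z; simp only [hD]
    refine sum_congr rfl fun y _ => ?_
    rw [hBs x y, hBs y z]; ring
  have hD3 : ∑ x ∈ E, ∑ z ∈ E, u z * D x z = s := by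
    rw [← hD2, sum_comm]
    exact sum_congr rfl fun x _ => sum_congr rfl fun z _ => by rw [hDs]
  have hu2 : ∑ x ∈ E, ∑ z ∈ E, u x * u z = b ^ 2 := by
    rw [sq, hb, sum_mul_sum]
  have hD2b : ∑ x ∈ E, u x * ∑ i ∈ E, D x i = s := by
    rw [← hD2]; simp only [mul_sum]
  have hu2b : ∑ x ∈ E, u x * b = b ^ 2 := by
    rw [← sum_mul, ← hb, sq]
  have hu2c : ∑ x ∈ E, b * u x = b ^ 2 := by
    rw [← mul_sum, ← hb, sq]
  have hex : ∀ x z, (θ ^ 2 * n + θ * (u x + u z) + D x z) ^ 2 = θ ^ 4 * n ^ 2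
      + 2 * θ ^ 3 * n * u x + 2 * θ ^ 3 * n * u z + 2 * θ ^ 2 * n * D x z
      + θ ^ 2 * u x ^ 2 + θ ^ 2 * u z ^ 2 + 2 * θ ^ 2 * (u x * u z)
      + 2 * θ * (u x * D x z) + 2 * θ * (u z * D x z) + D x z ^ 2 := by
    intro x z; ring
  rw [h1]
  simp only [hex, sum_add_distrib, ← mul_sum, sum_const, nsmul_eq_mul, ← hn, ← hT, ← hb, ← hS,
    hD1, hD2b, hD3, hu2b, hu2c]
  ring

theorem arith_norm (δ ε X q b S s T : ℝ) (hq : 0 ≤ q) (hX : 0 ≤ X) (hδ : |δ| ≤ ε)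
    (hsize : 12 * ε + 8 * (q * X ^ 2) + 48 * X ≤ 1)
    (hb : |b| ≤ 2 * X) (hS0 : 0 ≤ S) (hS : S ≤ (2 * X) ^ 2) (hs : |s| ≤ (2 * X) ^ 3)
    (hT0 : 0 ≤ T) (hT : T ≤ 4 * (q * X ^ 2) * (1 + δ + 2 * X)) :
    |(1 + δ) ^ 4 + 4 * (1 + δ) ^ 3 * b + 4 * (1 + δ) ^ 2 * S + 2 * (1 + δ) ^ 2 * b ^ 2
      + 4 * (1 + δ) * s + T - 1| ≤ 12 * ε + 8 * (q * X ^ 2) + 28 * X := by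
  have hY : 0 ≤ q * X ^ 2 := by positivity
  have hε0 : 0 ≤ ε := (abs_nonneg δ).trans hδ
  have hX1 : X ≤ 1 / 48 := by linarith
  have hδ1 : |δ| ≤ 1 / 12 := by linarith
  obtain ⟨hd1, hd2⟩ := abs_le.mp hδ1
  have p0 : 0 ≤ 1 + δ := by linarith
  have p1 : 1 + δ ≤ 13 / 12 := by linarith
  have p2 : (1 + δ) ^ 2 ≤ 6 / 5 := by nlinarith
  have p3 : (1 + δ) ^ 3 ≤ 13 / 10 := by
    have := mul_le_mul p2 p1 p0 (by norm_num)
    nlinarith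
  have t0 : |(1 + δ) ^ 4 - 1| ≤ 5 * ε := by
    have e : (1 + δ) ^ 4 - 1 = δ * (4 + 6 * δ + 4 * δ ^ 2 + δ ^ 3) := by ring
    have h4 : |4 + 6 * δ + 4 * δ ^ 2 + δ ^ 3| ≤ 5 := by
      have a1 : δ ^ 2 ≤ 1 / 144 := by nlinarith
      have a2 : 0 ≤ δ ^ 2 := sq_nonneg _
      have a3 : δ ^ 3 = δ * δ ^ 2 := by ring
      rw [abs_le]; constructor <;> nlinarith
    rw [e, abs_mul]
    nlinarith [abs_nonneg δ, abs_nonneg (4 + 6 * δ + 4 * δ ^ 2 + δ ^ 3)]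
  have X2 : X ^ 2 ≤ X / 48 := by nlinarith
  have X3 : X ^ 3 ≤ X / 48 := by nlinarith [mul_nonneg hX hX, mul_nonneg hX (sq_nonneg X)]
  have t1 : |4 * (1 + δ) ^ 3 * b| ≤ 11 * X := by
    rw [abs_mul, abs_of_nonneg (by positivity : 0 ≤ 4 * (1 + δ) ^ 3)]
    calc _ ≤ 4 * (13 / 10) * (2 * X) := by gcongr
      _ ≤ _ := by linarith
  have t2 : 4 * (1 + δ) ^ 2 * S ≤ 1 * X := by
    calc _ ≤ 4 * (6 / 5) * (2 * X) ^ 2 := by gcongr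
      _ ≤ _ := by nlinarith
  have t2' : 0 ≤ 4 * (1 + δ) ^ 2 * S := by positivity
  have t3 : 2 * (1 + δ) ^ 2 * b ^ 2 ≤ 1 * X := by
    rw [← sq_abs b]
    calc _ ≤ 2 * (6 / 5) * (2 * X) ^ 2 := by gcongr
      _ ≤ _ := by nlinarith
  have t3' : 0 ≤ 2 * (1 + δ) ^ 2 * b ^ 2 := by positivity
  have t4 : |4 * (1 + δ) * s| ≤ 1 * X := by
    rw [abs_mul, abs_of_nonneg (by positivity : 0 ≤ 4 * (1 + δ))]
    calc _ ≤ 4 * (13 / 12) * (2 * X) ^ 3 := by gcongr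
      _ ≤ _ := by nlinarith
  have t5 : T ≤ 8 * (q * X ^ 2) := by
    nlinarith [mul_nonneg hY (by linarith : 0 ≤ 2 - (1 + δ + 2 * X))]
  rw [abs_le] at *
  constructor <;> linarith [t0.1, t0.2, t1.1, t1.2, t4.1, t4.2]

theorem card_four {V : Type} [Fintype V] [DecidableEq V] (E : Finset V) (R : V → V → Prop)
    [DecidableRel R] :
    (Nat.card {x : Fin 4 → V // (∀ i, x i ∈ E) ∧ R (x 0) (x 1) ∧ R (x 1) (x 2) ∧ R (x 2) (x 3) ∧
      R (x 3) (x 0)} : ℝ) = ∑ x ∈ E, ∑ y ∈ E, ∑ z ∈ E, ∑ v ∈ E,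
        (if R x y then (1:ℝ) else 0) * (if R y z then (1:ℝ) else 0) *
          (if R z v then (1:ℝ) else 0) * (if R v x then (1:ℝ) else 0) := by
  classical
  let e : V × V × V × V ≃ (Fin 4 → V) :=
    { toFun := fun p => ![p.1, p.2.1, p.2.2.1, p.2.2.2]
      invFun := fun x => (x 0, x 1, x 2, x 3)
      left_inv := fun p => rfl
      right_inv := fun x => by ext i; fin_cases i <;> rfl }
  rw [Nat.card_eq_fintype_card, Fintype.card_subtype, card_filter]
  push_cast
  rw [← Equiv.sum_comp e]
  simp only [Fintype.sum_prod_type]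
  have hE : ∀ g : V → ℝ, ∑ x ∈ E, g x = ∑ x, (if x ∈ E then (1:ℝ) else 0) * g x := by
    intro g; simp [ite_mul, Finset.sum_ite_mem]
  simp only [hE, mul_sum]
  refine sum_congr rfl fun x _ => sum_congr rfl fun y _ => sum_congr rfl fun z _ =>
    sum_congr rfl fun v _ => ?_
  have h0 : e (x, y, z, v) 0 = x := rfl
  have h1 : e (x, y, z, v) 1 = y := rfl
  have h2 : e (x, y, z, v) 2 = z := rfl
  have h3 : e (x, y, z, v) 3 = v := rfl
  have hI : ∀ (P P' : Prop) [Decidable P] [Decidable P'] [Decidable (P ∧ P')], (if P ∧ P' then (1:ℝ) else 0) =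
      (if P then (1:ℝ) else 0) * (if P' then (1:ℝ) else 0) := by
    intro P P' _ _ _; by_cases hP : P <;> simp [hP]
  have hA : (∀ i, e (x, y, z, v) i ∈ E) ↔ x ∈ E ∧ y ∈ E ∧ z ∈ E ∧ v ∈ E := by
    rw [← h0, ← h1, ← h2, ← h3]
    refine ⟨fun h => ⟨h 0, h 1, h 2, h 3⟩, fun h i => ?_⟩
    fin_cases i
    · exact h.1
    · exact h.2.1
    · exact h.2.2.1
    · exact h.2.2.2
  simp only [hA, h0, h1, h2, h3, hI]
  ring

theorem norm_ident (q θ n b S s T : ℝ) (hq : 0 < q) (hn : 0 < n) :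
    θ ^ 4 * n ^ 4 + 4 * θ ^ 3 * n ^ 2 * b + 4 * θ ^ 2 * n * S + 2 * θ ^ 2 * b ^ 2
          + 4 * θ * s + T - n ^ 4 / q ^ 4 = n ^ 4 / q ^ 4 *
        ((1 + (q * θ - 1)) ^ 4 + 4 * (1 + (q * θ - 1)) ^ 3 * (q * b / n ^ 2)
          + 4 * (1 + (q * θ - 1)) ^ 2 * (q ^ 2 * S / n ^ 3)
          + 2 * (1 + (q * θ - 1)) ^ 2 * (q * b / n ^ 2) ^ 2
          + 4 * (1 + (q * θ - 1)) * (q ^ 3 * s / n ^ 4) + q ^ 4 * T / n ^ 4 - 1) := by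
  have : 1 + (q * θ - 1) = q * θ := by ring
  rw [this]
  field_simp

theorem delta_bound (q : ℝ) (hq : 1 ≤ q) (d : ℕ) (hd : 2 ≤ d) (x γ : ℝ)
    (hγ : γ = if d = 2 then -1 else -(((d : ℝ) - 2) / 2))
    (h : x * √q ^ d ≤ (if Even d then 1 else √q)) : x ≤ q ^ γ := by
  have hq0 : 0 < q := by linarith
  have e1 : √q ^ d = q ^ ((d : ℝ) / 2) := by
    rw [Real.sqrt_eq_rpow, ← Real.rpow_natCast, ← Real.rpow_mul hq0.le]; congr 1; ring
  have h0 : 0 < q ^ ((d : ℝ) / 2) := Real.rpow_pos_of_pos hq0 _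
  refine le_of_mul_le_mul_right ?_ h0
  rw [← Real.rpow_add hq0, ← e1]
  refine h.trans ?_
  split_ifs with hev
  · refine Real.one_le_rpow hq ?_
    rw [hγ]
    split_ifs with h2
    · rw [h2]; norm_num
    · linarith
  · rw [Real.sqrt_eq_rpow]
    refine Real.rpow_le_rpow_of_exponent_le hq ?_
    rw [hγ]
    split_ifs with h2
    · exact absurd (by rw [h2]; exact even_two) hev
    · linarith



/-- Counting 4-cycles with all edge lengths equal to `t`,
for the distance `φ(x,y) = Q(x-y)` coming from a non-degenerate quadratic form. -/
theorem stmt12 (q d : ℕ) (hd : 2 ≤ d)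
    (F : Type) [Field F] [Fintype F]
    (hq : Fintype.card F = q) (hodd : Odd q)
    (Q : QuadraticForm F (Fin d → F))
    (hQ : ∀ x, (∀ y, QuadraticMap.polar (⇑Q) x y = 0) → x = 0)
    (t : F) (ht : t ≠ 0)
    (E : Finset (Fin d → F))
    (γ : ℝ) (hγ : γ = if d = 2 then -1 else -(((d : ℝ) - 2) / 2))
    (hsize : 12 * (q : ℝ) ^ γ + 8 * (q : ℝ) ^ (d + 2) / (E.card : ℝ) ^ 2 +
        48 * (q : ℝ) ^ (((d : ℝ) + 1) / 2) / (E.card : ℝ) ≤ 1) :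
    |(Nat.card {x : Fin 4 → (Fin d → F) // (∀ i, x i ∈ E) ∧
        Q (x 0 - x 1) = t ∧ Q (x 1 - x 2) = t ∧ Q (x 2 - x 3) = t ∧
        Q (x 3 - x 0) = t} : ℝ) -
        (E.card : ℝ) ^ 4 / (q : ℝ) ^ 4| ≤
      ((E.card : ℝ) ^ 4 / (q : ℝ) ^ 4) *
        (12 * (q : ℝ) ^ γ + 8 * (q : ℝ) ^ (d + 2) / (E.card : ℝ) ^ 2 +
          28 * (q : ℝ) ^ (((d : ℝ) + 1) / 2) / (E.card : ℝ)) := by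
  classical
  have h2 : (2:F) ≠ 0 := by
    apply Ring.two_ne_zero
    intro h
    have := FiniteField.even_card_of_char_two h
    rw [hq] at this
    rcases hodd with ⟨k, hk⟩
    omega
  have hq1 : (1:ℝ) < q := by
    rw [← hq]; exact_mod_cast Fintype.one_lt_card
  have hq0 : (0:ℝ) < q := by linarith
  rcases Nat.eq_zero_or_pos E.card with hE | hE
  · have hE' : E = ∅ := card_eq_zero.mp hE
    have : IsEmpty {x : Fin 4 → (Fin d → F) // (∀ i, x i ∈ E) ∧
        Q (x 0 - x 1) = t ∧ Q (x 1 - x 2) = t ∧ Q (x 2 - x 3) = t ∧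
        Q (x 3 - x 0) = t} := by
      refine ⟨fun ⟨x, hx⟩ => ?_⟩
      have := hx.1 0
      rw [hE'] at this
      exact absurd this (notMem_empty _)
    rw [Nat.card_of_isEmpty, hE]
    simp
  have hn : (0:ℝ) < E.card := by exact_mod_cast hE
  obtain ⟨θ, hθ, H⟩ := gen_main h2 (by omega : 1 ≤ d) Q hQ t ht
  rw [hq] at hθ H
  have hδ : |(q:ℝ) * θ - 1| ≤ (q:ℝ) ^ γ := delta_bound q hq1.le d hd _ γ hγ hθ
  set ε := (q:ℝ) ^ γ with hε
  set p := (q:ℝ) ^ (((d:ℝ) + 1) / 2) with hp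
  set n : ℝ := (E.card : ℝ) with hnd
  have hp0 : 0 < p := Real.rpow_pos_of_pos hq0 _
  have hp2 : p ^ 2 = (q:ℝ) ^ (d + 1) := by
    rw [hp, ← Real.rpow_natCast, ← Real.rpow_mul hq0.le, ← Real.rpow_natCast]
    congr 1; push_cast; ring
  have hX0 : 0 < p / n := div_pos hp0 hn
  have eY : (q:ℝ) * (p / n) ^ 2 = (q:ℝ) ^ (d + 2) / n ^ 2 := by
    rw [div_pow, hp2]; ring
  have hsize' : 12 * ε + 8 * ((q:ℝ) * (p / n) ^ 2) + 48 * (p / n) ≤ 1 := by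
    rw [eY]; refine le_trans (le_of_eq ?_) hsize; ring
  have hY0 : 0 ≤ (q:ℝ) * (p / n) ^ 2 := by positivity
  have hδ1 : |(q:ℝ) * θ - 1| ≤ 1 / 12 := by linarith
  obtain ⟨hd1, hd2⟩ := abs_le.mp hδ1
  have hθ0 : 0 ≤ θ := by
    by_contra hc
    push Not at hc
    nlinarith
  have hq3 : (3:ℝ) ≤ q := by
    have : 1 < q := by exact_mod_cast hq1
    rcases hodd with ⟨k, hk⟩
    have : 3 ≤ q := by omega
    exact_mod_cast this
  have hθ1 : θ ≤ 1 := by nlinarith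
  have hl2 : (2 * p / q) ^ 2 = 4 * (q:ℝ) ^ (d - 1) := by
    rw [div_pow, mul_pow, hp2]
    obtain ⟨e, rfl⟩ : ∃ e, d = e + 1 := ⟨d - 1, by omega⟩
    rw [Nat.add_sub_cancel, div_eq_iff (by positivity)]; ring
  rw [card_four E (fun x y => Q (x - y) = t)]
  obtain ⟨b, S, s, T, hC, hb, hS0, hS, hs, hT0, hT⟩ := comb_main
    (fun x y => if Q (x - y) = t then (1:ℝ) else 0)
    (fun x y => by split_ifs <;> simp)
    (fun x y => by rw [← neg_sub, QuadraticMap.map_neg])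
    θ (2 * p / q) (by positivity) hθ0 hθ1 (by rw [hl2]; exact H) E n hnd
  rw [hC]
  clear_value p n ε
  clear hC H
  have ha := arith_norm ((q:ℝ) * θ - 1) ε (p / n) q (q * b / n ^ 2) (q ^ 2 * S / n ^ 3)
    (q ^ 3 * s / n ^ 4) (q ^ 4 * T / n ^ 4) hq0.le hX0.le hδ hsize' ?_ (by positivity) ?_ ?_
    (by positivity) ?_
  · rw [eY] at ha
    have e1 : θ ^ 4 * n ^ 4 + 4 * θ ^ 3 * n ^ 2 * b + 4 * θ ^ 2 * n * S + 2 * θ ^ 2 * b ^ 2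
          + 4 * θ * s + T - n ^ 4 / (q:ℝ) ^ 4 = n ^ 4 / (q:ℝ) ^ 4 *
        ((1 + (q * θ - 1)) ^ 4 + 4 * (1 + (q * θ - 1)) ^ 3 * (q * b / n ^ 2)
          + 4 * (1 + (q * θ - 1)) ^ 2 * (q ^ 2 * S / n ^ 3)
          + 2 * (1 + (q * θ - 1)) ^ 2 * (q * b / n ^ 2) ^ 2
          + 4 * (1 + (q * θ - 1)) * (q ^ 3 * s / n ^ 4) + q ^ 4 * T / n ^ 4 - 1) := by
      exact norm_ident q θ n b S s T hq0 hn
    rw [e1, abs_mul, abs_of_nonneg (by positivity : 0 ≤ n ^ 4 / (q:ℝ) ^ 4)]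
    refine mul_le_mul_of_nonneg_left (ha.trans (le_of_eq ?_)) (by positivity)
    ring
  · rw [abs_div, abs_mul, abs_of_pos hq0, abs_of_pos (by positivity : 0 < n ^ 2)]
    calc _ ≤ q * (2 * p / q * n) / n ^ 2 := by gcongr
      _ = _ := by field_simp
  · calc _ ≤ q ^ 2 * ((2 * p / q) ^ 2 * n) / n ^ 3 := by gcongr
      _ = _ := by field_simp
  · rw [abs_div, abs_mul, abs_of_pos (by positivity : 0 < (q:ℝ) ^ 3),
      abs_of_pos (by positivity : 0 < n ^ 4)]
    calc _ ≤ q ^ 3 * ((2 * p / q) ^ 3 * n) / n ^ 4 := by gcongr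
      _ = _ := by field_simp
  · calc _ ≤ q ^ 4 * ((2 * p / q) ^ 2 * (θ * n ^ 2 + 2 * p / q * n)) / n ^ 4 := by gcongr
      _ = _ := by field_simp; ring
end

section
/- Let q be an odd prime power, d ≥ 2, and let Q be a non-degenerate quadratic form on F_q^d, with associated distance φ(x,y) = Q(x−y). Fix t ∈ F_q \ {0}, let E ⊆ F_q^d, and let C_5 denote the number of 5-tuples (x_1, …, x_5) ∈ E^5 with φ(x_i, x_{i+1}) = t for 1 ≤ i ≤ 4 and φ(x_5, x_1) = t. Let γ = −1 if d = 2 and γ = −(d−2)/2 if d ≥ 3. Suppose 12 q^γ + 8 q^{d+2}/|E|² + 48 q^{(d+1)/2}/|E| ≤ 1. Then | C_5 − |E|^5/q^5 | ≤ (|E|^5/q^5) ( 12 q^γ + 8 q^{(2d+3)/2}/|E|² + 32 q^{(d+1)/2}/|E| ). -/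
open Finset


namespace W13
open Polynomial

/-- dimension count -/
lemma exists_relation {k : Type*} [Field k] (n D : ℕ) (h : D < n) (w : ℕ → k[X])
    (hw : ∀ i < n, (w i).degree < D) :
    ∃ e : ℕ → k, (∃ i < n, e i ≠ 0) ∧ ∑ i ∈ range n, C (e i) * w i = 0 := by
  classical
  let f : Fin n → degreeLT k D := fun i => ⟨w i, mem_degreeLT.2 (hw i i.2)⟩
  have hnot : ¬ LinearIndependent k f := by
    intro hl
    have h1 := hl.fintype_card_le_finrank
    have h2 : Module.finrank k (degreeLT k D) = D := by
      rw [LinearEquiv.finrank_eq (degreeLTEquiv k D)]; simp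
    rw [h2, Fintype.card_fin] at h1
    omega
  rw [Fintype.not_linearIndependent_iff] at hnot
  obtain ⟨g, hg, i, hi⟩ := hnot
  refine ⟨fun j => if hj : j < n then g ⟨j, hj⟩ else 0, ⟨i, i.2, by simpa using hi⟩, ?_⟩
  rw [Finset.sum_range]
  have := congrArg (Subtype.val) hg
  simp only [f, AddSubmonoidClass.coe_finsetSum, Submodule.coe_smul, ZeroMemClass.coe_zero] at this
  rw [← this]
  refine Finset.sum_congr rfl fun j _ => ?_
  simp [smul_eq_C_mul]

/-- distinct degrees -/
lemma ne_zero_of_degrees {k : Type*} [Field k] (n s : ℕ) (w : ℕ → k[X]) (c : ℕ → k)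
    (hw : ∀ i < n, (w i).natDegree ≤ i + s) (hc : ∀ i < n, (w i).coeff (i + s) ≠ 0)
    (hne : ∃ i < n, c i ≠ 0) : ∑ i ∈ range n, C (c i) * w i ≠ 0 := by
  classical
  obtain ⟨i, hi, hci⟩ := hne
  let S := (range n).filter (fun i => c i ≠ 0)
  have hS : S.Nonempty := ⟨i, by simp [S, hi, hci]⟩
  obtain ⟨m, hmS, hmax⟩ := S.exists_max_image id hS
  simp only [S, mem_filter, mem_range] at hmS
  intro h0
  have h1 := congrArg (fun f => f.coeff (m + s)) h0
  simp only [finsetSum_coeff, coeff_C_mul, coeff_zero] at h1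
  rw [Finset.sum_eq_single m] at h1
  · exact mul_ne_zero hmS.2 (hc m hmS.1) h1
  · intro b hb hbm
    simp only [mem_range] at hb
    by_cases hcb : c b = 0
    · simp [hcb]
    · have : b ≤ m := hmax b (by simp [S, hb, hcb])
      rw [coeff_eq_zero_of_natDegree_lt, mul_zero]
      have := hw b hb
      omega
  · intro h; simp [hmS.1] at h

theorem stepanov {k : Type*} [Field k] [Fintype k] [DecidableEq k] (p : ℕ) [Fact p.Prime]
    [CharP k p] (hp3 : 3 ≤ p) (ν : ℕ) (hcard : Fintype.card k = p ^ (2 * (ν + 1)))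
    (a b u : k) (ha : a ≠ 0) :
    ((Finset.univ : Finset k).filter (fun x => x ≠ 0 ∧
      ∑ i ∈ range (2 * (ν + 1)), (a * x + b / x) ^ p ^ i = u)).card
      ≤ p ^ (2 * ν + 1) + 4 * p ^ (ν + 1) := by
  classical
  set P' := p ^ ν with hP'
  set P := p ^ (ν + 1) with hP
  have hPP : P = p * P' := by rw [hP, hP', pow_succ, mul_comm]
  have hP'pos : 0 < P' := by positivity
  have hQ : Fintype.card k = P * P := by rw [hcard, hP, two_mul, pow_add]
  set U : k[X] := ∑ i ∈ range (ν + 1), (C a * X ^ 2 + C b) ^ p ^ i * X ^ (P' - p ^ i) with hU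
  have hpi : ∀ i < ν + 1, p ^ i ≤ P' := fun i hi =>
    Nat.pow_le_pow_right (by omega) (by omega)
  have hquad : (C a * X ^ 2 + C b : k[X]).natDegree ≤ 2 := by compute_degree
  have hterm : ∀ i < ν + 1, ((C a * X ^ 2 + C b) ^ p ^ i * X ^ (P' - p ^ i) : k[X]).natDegree
      ≤ P' + p ^ i := by
    intro i hi
    refine natDegree_mul_le.trans ?_
    rw [natDegree_X_pow]
    have := natDegree_pow_le_of_le (p ^ i) hquad
    have := hpi i hi
    omega
  have hUdeg : U.natDegree ≤ 2 * P' := by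
    refine natDegree_sum_le_of_forall_le _ _ fun i hi => ?_
    have := hterm i (mem_range.1 hi)
    have := hpi i (mem_range.1 hi)
    omega
  have hUcoeff : U.coeff (2 * P') = a ^ P' := by
    rw [hU, finsetSum_coeff, Finset.sum_range_succ, Finset.sum_eq_zero, zero_add]
    · rw [← hP', Nat.sub_self, pow_zero, mul_one, mul_comm 2 P']
      rw [coeff_pow_of_natDegree_le hquad]
      simp
    · intro i hi
      rw [mem_range] at hi
      apply coeff_eq_zero_of_natDegree_lt
      have h1 := hterm i (by omega)
      have h2 : p ^ i < P' := Nat.pow_lt_pow_right (by omega) (by omega)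
      omega
  -- the value of U
  set T : k → k := fun x => ∑ i ∈ range (ν + 1), (a * x + b / x) ^ p ^ i with hT
  have hUeval : ∀ x : k, x ≠ 0 → U.eval x = x ^ P' * T x := by
    intro x hx
    rw [hU, eval_finsetSum, hT, Finset.mul_sum]
    refine Finset.sum_congr rfl fun i hi => ?_
    have := hpi i (mem_range.1 hi)
    simp only [eval_mul, eval_pow, eval_add, eval_C, eval_X]
    have h1 : a * x ^ 2 + b = x * (a * x + b / x) := by field_simp
    have h2 : x ^ P' = x ^ p ^ i * x ^ (P' - p ^ i) := by rw [← pow_add]; congr 1; omega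
    rw [h1, mul_pow, h2]; ring
  let B := P' + 3
  let n := P * B
  -- families
  let wG : ℕ → k[X] := fun m => X ^ (m % P' + (m / P) * P) * U ^ ((m / P') % p) *
    X ^ ((p - 1 - (m / P') % p) * P')
  let wH : ℕ → k[X] := fun m => X ^ ((m % P') * P + (m / P)) *
    (C u * X ^ P' - U) ^ ((m / P') % p) * X ^ ((p - 1 - (m / P') % p) * P')
  have hdecomp : ∀ m, m = m % P' + ((m / P') % p) * P' + (m / P) * P := by
    intro m
    have h1 : m / P = m / P' / p := by rw [hPP, mul_comm, Nat.div_div_eq_div_mul]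
    have h2 := Nat.mod_add_div m P'
    have h3 := Nat.mod_add_div (m / P') p
    rw [h1, hPP]
    calc m = m % P' + P' * (m / P') := h2.symm
      _ = m % P' + P' * ((m / P') % p + p * (m / P' / p)) := by rw [h3]
      _ = _ := by ring
  have hmodp : ∀ m, (m / P') % p ≤ p - 1 := fun m => by
    have := Nat.mod_lt (m / P') (show p > 0 by omega); omega
  have hP'P : P' ≤ P := by rw [hPP]; exact Nat.le_mul_of_pos_left _ (by omega)
  have hp1 : (p - 1) * P' = P - P' := by rw [hPP, Nat.sub_mul, one_mul]
  have hPpos : 0 < P := by omega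
  have hsplit : ∀ l, l ≤ p - 1 → l * P' + (p - 1 - l) * P' = (p - 1) * P' := by
    intro l hl; rw [← add_mul]; congr 1; omega
  have hGdeg : ∀ m < n, (wG m).natDegree ≤ m + (p - 1) * P' := by
    intro m _
    have h1 := hdecomp m
    have h2 := hmodp m
    refine natDegree_mul_le.trans ?_
    rw [natDegree_X_pow]
    have h3 := natDegree_mul_le (p := (X ^ (m % P' + (m / P) * P) : k[X]))
      (q := U ^ ((m / P') % p))
    rw [natDegree_X_pow] at h3
    have h4 := natDegree_pow_le_of_le ((m / P') % p) hUdeg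
    have h5 := hsplit _ h2
    have h6 : (m / P') % p * (2 * P') = 2 * ((m / P') % p * P') := by ring
    omega
  have hGcoeff : ∀ m < n, (wG m).coeff (m + (p - 1) * P') ≠ 0 := by
    intro m _
    have h1 := hdecomp m
    have h2 := hmodp m
    have h5 := hsplit _ h2
    have h6 : (m / P') % p * (2 * P') = 2 * ((m / P') % p * P') := by ring
    have : m + (p - 1) * P' = ((m / P') % p * (2 * P') + (m % P' + (m / P) * P)) +
      ((p - 1 - (m / P') % p) * P') := by omega
    rw [this]
    simp only [wG]
    rw [coeff_mul_X_pow, coeff_X_pow_mul, coeff_pow_of_natDegree_le hUdeg, hUcoeff]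
    exact pow_ne_zero _ (pow_ne_zero _ ha)
  have hHdeg : ∀ m < n, (wH m).degree < (P' * P + B + P : ℕ) := by
    intro m hm
    have h2 := hmodp m
    have hV : (C u * X ^ P' - U).natDegree ≤ 2 * P' := by
      refine (natDegree_sub_le _ _).trans ?_
      have : (C u * X ^ P').natDegree ≤ P' := natDegree_C_mul_X_pow_le _ _
      omega
    have h3 := natDegree_mul_le (p := (X ^ ((m % P') * P + (m / P)) : k[X]))
      (q := (C u * X ^ P' - U) ^ ((m / P') % p))
    rw [natDegree_X_pow] at h3
    have h4 := natDegree_pow_le_of_le ((m / P') % p) hV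
    have h5 := hsplit _ h2
    have h6 : (m / P') % p * (2 * P') = 2 * ((m / P') % p * P') := by ring
    have h7 : (wH m).natDegree ≤ (m % P') * P + (m / P) + (m / P') % p * P' + (p - 1) * P' := by
      refine natDegree_mul_le.trans ?_
      rw [natDegree_X_pow]
      omega
    have h8 : m / P < B := by
      rw [Nat.div_lt_iff_lt_mul hPpos, mul_comm]; exact hm
    have h9 : (m % P') * P + P ≤ P' * P := by
      have := Nat.mod_lt m hP'pos
      calc (m % P') * P + P = (m % P' + 1) * P := by ring
        _ ≤ P' * P := Nat.mul_le_mul_right _ (by omega)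
    have h10 : (m / P') % p * P' ≤ (p - 1) * P' := Nat.mul_le_mul_right _ h2
    refine degree_le_natDegree.trans_lt ?_
    norm_cast
    omega
  have hnD : P' * P + B + P < n := by
    show P' * P + (P' + 3) + P < P * (P' + 3)
    have h3 : 3 ≤ P := by
      rw [hPP]; nlinarith
    have h4 : 3 * P' ≤ P := by rw [hPP]; exact Nat.mul_le_mul_right _ hp3
    nlinarith
  obtain ⟨e, hne, hrel⟩ := exists_relation n _ hnD wH hHdeg
  have hfrob : ∀ z : k, (z ^ P) ^ P = z := by
    intro z; rw [← pow_mul, ← hQ, FiniteField.pow_card]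
  let G : k[X] := ∑ i ∈ range n, C ((e i) ^ P) * wG i
  have hG0 : G ≠ 0 := by
    refine ne_zero_of_degrees n ((p - 1) * P') wG _ hGdeg hGcoeff ?_
    obtain ⟨i, hi, hei⟩ := hne
    exact ⟨i, hi, pow_ne_zero _ hei⟩
  have hGnat : G.natDegree ≤ n + P := by
    refine natDegree_sum_le_of_forall_le _ _ fun i hi => ?_
    have := hGdeg i (mem_range.1 hi)
    have := natDegree_C_mul_le ((e i) ^ P) (wG i)
    have := mem_range.1 hi
    omega
  have hzero : ∀ x : k, x ≠ 0 → ∑ i ∈ range (2 * (ν + 1)), (a * x + b / x) ^ p ^ i = u →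
      G.eval x = 0 := by
    intro x hx hxu
    have hTP : T x ^ P = u - T x := by
      have h1 : T x ^ P = ∑ i ∈ range (ν + 1), (a * x + b / x) ^ p ^ (ν + 1 + i) := by
        rw [hT, hP]
        simp only
        rw [sum_pow_char_pow]
        refine Finset.sum_congr rfl fun i _ => ?_
        rw [← pow_mul, ← pow_add, add_comm i]
      rw [h1, ← hxu, two_mul,
        Finset.sum_range_add (fun i => (a * x + b / x) ^ p ^ i) (ν + 1) (ν + 1), hT]
      exact (add_sub_cancel_left _ _).symm
    have hHeval : ∑ i ∈ range n, e i * (x ^ ((i % P') * P + (i / P)) *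
        (u - T x) ^ ((i / P') % p)) = 0 := by
      have h1 := congrArg (eval x) hrel
      rw [eval_finsetSum, eval_zero] at h1
      have h2 : x ^ ((p - 1) * P') * ∑ i ∈ range n, e i * (x ^ ((i % P') * P + (i / P)) *
        (u - T x) ^ ((i / P') % p)) = 0 := by
        rw [← h1, Finset.mul_sum]
        refine Finset.sum_congr rfl fun i _ => ?_
        simp only [wH, eval_mul, eval_pow, eval_C, eval_X, eval_sub, hUeval x hx]
        rw [← hsplit _ (hmodp i), pow_add]
        have : u * x ^ P' - x ^ P' * T x = x ^ P' * (u - T x) := by ring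
        rw [this, mul_pow, ← pow_mul, mul_comm P' (i / P' % p)]
        ring
      exact (mul_eq_zero.1 h2).resolve_left (pow_ne_zero _ hx)
    have hGeval : G.eval x = x ^ ((p - 1) * P') * ∑ i ∈ range n, (e i) ^ P *
        (x ^ ((i % P') + (i / P) * P) * (T x) ^ ((i / P') % p)) := by
      simp only [G]
      rw [eval_finsetSum, Finset.mul_sum]
      refine Finset.sum_congr rfl fun i _ => ?_
      simp only [wG, eval_mul, eval_pow, eval_C, eval_X, hUeval x hx]
      rw [← hsplit _ (hmodp i), pow_add, mul_pow, ← pow_mul, mul_comm P' (i / P' % p)]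
      ring
    have hpow : (∑ i ∈ range n, (e i) ^ P *
        (x ^ ((i % P') + (i / P) * P) * (T x) ^ ((i / P') % p))) ^ P = 0 := by
      rw [hP, sum_pow_char_pow, ← hHeval]
      refine Finset.sum_congr rfl fun i _ => ?_
      rw [← hP, mul_pow, hfrob, mul_pow, ← pow_mul, ← pow_mul, mul_comm ((i / P') % p) P,
        pow_mul (T x), hTP, add_mul, pow_add, pow_mul x (i / P * P), pow_mul x (i / P), hfrob,
        ← pow_add]
    rw [hGeval, pow_eq_zero_iff (by omega) |>.1 hpow, mul_zero]
  calc _ ≤ G.roots.toFinset.card := by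
        refine Finset.card_le_card fun x hx => ?_
        simp only [mem_filter, mem_univ, true_and] at hx
        rw [Multiset.mem_toFinset, mem_roots hG0]
        exact hzero x hx.1 hx.2
    _ ≤ G.natDegree := (Multiset.toFinset_card_le _).trans (card_roots' _)
    _ ≤ n + P := hGnat
    _ = _ := by
      show P * (P' + 3) + P = _
      have : p ^ (2 * ν + 1) = P * P' := by
        rw [hP, hP', ← pow_add]; congr 1; ring
      rw [this]; ring
end W13


namespace W13
open Polynomial

section Lfun
variable {F : Type*} [Field F]

/-- the completely multiplicative function on monic polynomials -/
noncomputable def Lam (ψ : AddChar F ℂ) (a b : F) (f : F[X]) : ℂ :=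
  open Classical in
  if f.coeff 0 = 0 then 0 else ψ (-(a * f.nextCoeff + b * (f.coeff 1 / f.coeff 0)))

lemma Lam_one (ψ : AddChar F ℂ) (a b : F) : Lam ψ a b 1 = 1 := by
  have h : (1 : F[X]).nextCoeff = 0 := by rw [← C_1, nextCoeff_C_eq_zero]
  simp [Lam, coeff_one, h]

lemma Lam_mul (ψ : AddChar F ℂ) (a b : F) {f g : F[X]} (hf : f.Monic) (hg : g.Monic) :
    Lam ψ a b (f * g) = Lam ψ a b f * Lam ψ a b g := by
  unfold Lam
  by_cases h1 : f.coeff 0 = 0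
  · simp [h1]
  by_cases h2 : g.coeff 0 = 0
  · simp [h2]
  rw [if_neg h1, if_neg h2, if_neg (by rw [mul_coeff_zero]; exact mul_ne_zero h1 h2),
    ← AddChar.map_add_eq_mul, hf.nextCoeff_mul hg, mul_coeff_zero, mul_coeff_one]
  congr 1
  field_simp
  ring

lemma Lam_pow (ψ : AddChar F ℂ) (a b : F) {f : F[X]} (hf : f.Monic) (n : ℕ) :
    Lam ψ a b (f ^ n) = Lam ψ a b f ^ n := by
  induction n with
  | zero => simp [Lam_one]
  | succ n ih => rw [pow_succ, Lam_mul _ _ _ (hf.pow n) hf, ih, pow_succ]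

lemma minpoly_inv_nextCoeff {L : Type*} [Field L] [Algebra F L] [FiniteDimensional F L]
    (x : L) (hx : x ≠ 0) :
    (minpoly F x⁻¹).nextCoeff = (minpoly F x).coeff 1 / (minpoly F x).coeff 0 ∧
    IntermediateField.adjoin F {x⁻¹} = IntermediateField.adjoin F {x} := by
  have hadj : IntermediateField.adjoin F {x⁻¹} = IntermediateField.adjoin F {x} := by
    apply le_antisymm
    · rw [IntermediateField.adjoin_simple_le_iff]
      exact inv_mem (IntermediateField.mem_adjoin_simple_self F x)
    · rw [IntermediateField.adjoin_simple_le_iff]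
      have := inv_mem (IntermediateField.mem_adjoin_simple_self F x⁻¹)
      rwa [inv_inv] at this
  refine ⟨?_, hadj⟩
  have hxInt : IsIntegral F x := .of_finite F x
  have hxInt' : IsIntegral F x⁻¹ := .of_finite F _
  set P := minpoly F x with hP
  have hdeg : (minpoly F x⁻¹).natDegree = P.natDegree := by
    rw [hP, ← IntermediateField.adjoin.finrank hxInt, ← IntermediateField.adjoin.finrank hxInt', hadj]
  have hP0 : P.coeff 0 ≠ 0 := by
    rw [hP]; exact minpoly.coeff_zero_ne_zero hxInt hx
  have hpos : 0 < P.natDegree := minpoly.natDegree_pos hxInt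
  have htr : P.natTrailingDegree = 0 := natTrailingDegree_eq_zero.2 (Or.inr hP0)
  have hrd : P.reverse.natDegree = P.natDegree := by rw [reverse_natDegree, htr, Nat.sub_zero]
  have hrl : P.reverse.leadingCoeff = P.coeff 0 := by
    rw [reverse_leadingCoeff, trailingCoeff, htr]
  let R := C (P.coeff 0)⁻¹ * P.reverse
  have hRm : R.Monic := by
    simp only [R, Monic, leadingCoeff_mul, leadingCoeff_C, hrl]
    exact inv_mul_cancel₀ hP0
  have hRd : R.natDegree = P.natDegree := by
    simp only [R]; rw [natDegree_C_mul (inv_ne_zero hP0), hrd]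
  have hR0 : aeval x⁻¹ R = 0 := by
    simp only [R, map_mul]
    have : aeval x⁻¹ P.reverse = 0 := by
      let := invertibleOfNonzero hx
      have := (eval₂_reverse_eq_zero_iff (algebraMap F L) x P).2 (by
        rw [← aeval_def]; exact minpoly.aeval F x)
      rwa [invOf_eq_inv, ← aeval_def] at this
    rw [this, mul_zero]
  have hRmin : R = minpoly F x⁻¹ := by
    exact (eq_of_monic_of_dvd_of_natDegree_le (minpoly.monic hxInt') hRm (minpoly.dvd F _ hR0)
      (by rw [hRd, hdeg])).symm ▸ rfl
  rw [← hRmin, nextCoeff_of_natDegree_pos (by omega), hRd]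
  simp only [R]
  rw [coeff_C_mul, coeff_reverse, revAt_le (by omega), show P.natDegree - (P.natDegree - 1) = 1 by omega]
  field_simp

lemma trace_char {L : Type*} [Field L] [Algebra F L] [FiniteDimensional F L]
    (ψ : AddChar F ℂ) (a b : F) (x : L) (hx : x ≠ 0) :
    ψ (Algebra.trace F L (algebraMap F L a * x + algebraMap F L b / x)) =
      Lam ψ a b (minpoly F x) ^ (Module.finrank F L / (minpoly F x).natDegree) := by
  have hxInt : IsIntegral F x := .of_finite F x
  obtain ⟨h1, h2⟩ := minpoly_inv_nextCoeff (F := F) x hx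
  have hfin : Module.finrank F L / (minpoly F x).natDegree =
      Module.finrank (IntermediateField.adjoin F {x}) L := by
    rw [← IntermediateField.adjoin.finrank hxInt,
      ← Module.finrank_mul_finrank F (IntermediateField.adjoin F {x}) L]
    exact Nat.mul_div_cancel_left _ Module.finrank_pos
  have hP0 : (minpoly F x).coeff 0 ≠ 0 := minpoly.coeff_zero_ne_zero hxInt hx
  rw [hfin, Lam, if_neg hP0, ← AddChar.map_nsmul_eq_pow]
  congr 1
  rw [map_add, div_eq_mul_inv, ← Algebra.smul_def, ← Algebra.smul_def, map_smul, map_smul,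
    trace_eq_finrank_mul_minpoly_nextCoeff F x, trace_eq_finrank_mul_minpoly_nextCoeff F x⁻¹,
    h1, h2, nsmul_eq_mul, smul_eq_mul, smul_eq_mul]
  ring

variable [Fintype F]
open Classical in
/-- monic polynomials of degree n -/
noncomputable def Mon (F : Type*) [Field F] [Fintype F] (n : ℕ) : Finset F[X] :=
  (Finset.univ : Finset (Fin n → F)).image (fun v => X ^ n + ∑ i : Fin n, C (v i) * X ^ (i : ℕ))

lemma degree_aux (n : ℕ) (v : Fin n → F) :
    (∑ i : Fin n, C (v i) * X ^ (i : ℕ) : F[X]).degree < n := by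
  rw [← mem_degreeLT]
  refine Submodule.sum_mem _ fun i _ => ?_
  rw [mem_degreeLT]
  refine (degree_C_mul_X_pow_le _ _).trans_lt ?_
  exact_mod_cast i.2

lemma mem_Mon {n : ℕ} {f : F[X]} : f ∈ Mon F n ↔ f.Monic ∧ f.natDegree = n := by
  classical
  simp only [Mon, mem_image, mem_univ, true_and]
  constructor
  · rintro ⟨v, rfl⟩
    have h1 := monic_X_pow_add (degree_aux n v)
    exact ⟨h1, natDegree_eq_of_degree_eq_some (by
      rw [degree_add_eq_left_of_degree_lt, degree_X_pow]
      rw [degree_X_pow]; exact degree_aux n v)⟩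
  · rintro ⟨hm, hn⟩
    refine ⟨fun i => f.coeff i, ?_⟩
    conv_rhs => rw [hm.as_sum, hn, Finset.sum_range]

/-- sums over monic polynomials -/
noncomputable def Acoef (ψ : AddChar F ℂ) (a b : F) (n : ℕ) : ℂ := ∑ f ∈ Mon F n, Lam ψ a b f

lemma Acoef_zero (ψ : AddChar F ℂ) (a b : F) : Acoef ψ a b 0 = 1 := by
  have : Mon F 0 = {1} := by
    ext f
    rw [mem_Mon, mem_singleton]
    constructor
    · rintro ⟨h1, h2⟩; exact h1.natDegree_eq_zero.1 h2
    · rintro rfl; simp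
  rw [Acoef, this, sum_singleton, Lam_one]

lemma Acoef_one (ψ : AddChar F ℂ) (a b : F) [DecidableEq F] :
    Acoef ψ a b 1 = ∑ x ∈ univ.filter (fun x : F => x ≠ 0), ψ (a * x + b / x) := by
  rw [Finset.sum_filter]
  symm
  refine Finset.sum_bij (fun x _ => X + C (-x)) ?_ ?_ ?_ ?_
  · intro x _; rw [mem_Mon]; exact ⟨monic_X_add_C _, natDegree_X_add_C _⟩
  · intro x _ y _ h; simpa using h
  · intro f hf
    rw [mem_Mon] at hf
    exact ⟨-f.coeff 0, mem_univ _, by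
      rw [neg_neg]; exact (hf.1.eq_X_add_C hf.2).symm⟩
  · intro x _
    simp only [Lam, nextCoeff_X_add_C]
    by_cases hx : x = 0
    · simp [hx]
    · simp [hx, coeff_one]
      rw [add_comm]
      congr 1; ring

lemma Acoef_big (ψ : AddChar F ℂ) (hψ : ψ ≠ 1) (a b : F) (ha : a ≠ 0) (n : ℕ) (hn : 3 ≤ n) :
    Acoef ψ a b n = 0 := by
  obtain ⟨s, hs⟩ : ∃ s, ψ (-(a * s)) ≠ 1 := by
    obtain ⟨y, hy⟩ := AddChar.ne_one_iff.1 hψ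
    exact ⟨-(y / a), by rwa [mul_neg, neg_neg, mul_div_cancel₀ _ ha]⟩
  have hmem : ∀ (c : F) (f), f ∈ Mon F n → f + C c * X ^ (n - 1) ∈ Mon F n := by
    intro c f hf
    rw [mem_Mon] at hf ⊢
    have hd : (C c * X ^ (n - 1)).degree < f.degree := by
      rw [degree_eq_natDegree hf.1.ne_zero, hf.2]
      refine (degree_C_mul_X_pow_le _ _).trans_lt ?_
      exact_mod_cast (by omega : n - 1 < n)
    exact ⟨hf.1.add_of_left hd, by rw [natDegree_add_eq_left_of_degree_lt hd, hf.2]⟩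
  have key : Acoef ψ a b n = ψ (-(a * s)) * Acoef ψ a b n := by
    conv_rhs => rw [Acoef, Finset.mul_sum]
    symm
    refine Finset.sum_bij (fun f _ => f + C s * X ^ (n - 1)) (fun f hf => hmem s f hf) ?_ ?_ ?_
    · intro f _ g _ h; simpa using h
    · intro f hf
      refine ⟨f + C (-s) * X ^ (n - 1), hmem _ f hf, by simp [add_assoc]⟩
    · intro f hf
      have hf' := mem_Mon.1 hf
      have h2 := mem_Mon.1 (hmem s f hf)
      unfold Lam
      rw [nextCoeff_of_natDegree_pos (by omega), nextCoeff_of_natDegree_pos (by omega), h2.2, hf'.2]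
      have c0 : (f + C s * X ^ (n - 1)).coeff 0 = f.coeff 0 := by
        rw [coeff_add, coeff_C_mul_X_pow, if_neg (show ¬ (0 = n - 1) by omega), add_zero]
      have c1 : (f + C s * X ^ (n - 1)).coeff 1 = f.coeff 1 := by
        rw [coeff_add, coeff_C_mul_X_pow, if_neg (show ¬ (1 = n - 1) by omega), add_zero]
      have c2 : (f + C s * X ^ (n - 1)).coeff (n - 1) = f.coeff (n - 1) + s := by
        rw [coeff_add, coeff_C_mul_X_pow, if_pos rfl]
      rw [c0, c1, c2]
      split_ifs
      · simp
      · rw [← AddChar.map_add_eq_mul]; congr 1; ring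
  have : (1 - ψ (-(a * s))) * Acoef ψ a b n = 0 := by rw [sub_mul, one_mul, ← key, sub_self]
  exact (mul_eq_zero.1 this).resolve_left (sub_ne_zero.2 hs.symm)

lemma Acoef_two (ψ : AddChar F ℂ) (hψ : ψ ≠ 1) (a b : F) (ha : a ≠ 0) (hb : b ≠ 0) :
    Acoef ψ a b 2 = Fintype.card F := by
  classical
  have h1 : Acoef ψ a b 2 = ∑ z : F × F, Lam ψ a b (X ^ 2 + C z.2 * X + C z.1) := by
    symm
    have hdeg : ∀ z : F × F, (C z.2 * X + C z.1).degree < 2 := fun z =>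
      degree_linear_lt
    refine Finset.sum_bij (fun z _ => X ^ 2 + C z.2 * X + C z.1) ?_ ?_ ?_ ?_
    · intro z _
      rw [mem_Mon, add_assoc]
      exact ⟨monic_X_pow_add (hdeg z), natDegree_eq_of_degree_eq_some (by
        rw [degree_add_eq_left_of_degree_lt, degree_X_pow]
        rw [degree_X_pow]; exact hdeg z)⟩
    · intro z _ w _ h
      have e0 := congrArg (fun f => f.coeff 0) h
      have e1 := congrArg (fun f => f.coeff 1) h
      simp [coeff_X, coeff_C, coeff_X_pow] at e0 e1
      exact Prod.ext e0 e1
    · intro f hf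
      rw [mem_Mon] at hf
      refine ⟨(f.coeff 0, f.coeff 1), mem_univ _, ?_⟩
      conv_rhs => rw [hf.1.as_sum, hf.2]
      simp [Finset.sum_range_succ]; ring
    · intro z _; rfl
  rw [h1, Fintype.sum_prod_type]
  have h2 : ∀ c : F, ∑ y : F, Lam ψ a b (X ^ 2 + C y * X + C c) =
      if c = -(b / a) then (Fintype.card F : ℂ) else 0 := by
    intro c
    by_cases hc : c = 0
    · subst hc
      rw [if_neg (by simp [ha, hb])]
      refine Finset.sum_eq_zero fun y _ => ?_
      simp [Lam]
    have : ∀ y : F, Lam ψ a b (X ^ 2 + C y * X + C c) = ψ (y * (-(a + b / c))) := by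
      intro y
      have hn : (X ^ 2 + C y * X + C c : F[X]).nextCoeff = y := by
        have : (X ^ 2 + C y * X + C c : F[X]).natDegree = 2 := by compute_degree!
        rw [nextCoeff_of_natDegree_pos (by omega), this]
        simp [coeff_X, coeff_C, coeff_X_pow]
      rw [Lam, hn, if_neg (by simpa using hc)]
      simp [coeff_C, coeff_X_pow]
      congr 1; ring
    simp_rw [this]
    rw [AddChar.sum_mulShift _ (AddChar.IsPrimitive.of_ne_one hψ)]
    have : -(a + b / c) = 0 ↔ c = -(b / a) := by
      rw [neg_eq_zero]
      constructor
      · intro h; field_simp at h ⊢; linear_combination h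
      · intro h; subst h; field_simp; ring
    simp only [this]
    split_ifs <;> simp
  simp_rw [h2]
  simp

open Classical in
/-- monic irreducibles of degree at most n -/
noncomputable def Irr (F : Type*) [Field F] [Fintype F] (n : ℕ) : Finset F[X] :=
  ((range (n + 1)).biUnion (Mon F)).filter Irreducible

lemma mem_Irr {n : ℕ} {f : F[X]} : f ∈ Irr F n ↔ f.Monic ∧ f.natDegree ≤ n ∧ Irreducible f := by
  classical
  simp only [Irr, mem_filter, mem_biUnion, mem_range, mem_Mon]
  constructor
  · rintro ⟨⟨m, hm, h1, h2⟩, h3⟩; exact ⟨h1, by omega, h3⟩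
  · rintro ⟨h1, h2, h3⟩; exact ⟨⟨f.natDegree, by omega, h1, rfl⟩, h3⟩

open Classical in
lemma natDegree_eq_sum {n : ℕ} {f : F[X]} (hf : f ∈ Mon F n) :
    (n : ℂ) = ∑ P ∈ Irr F n, ∑ k ∈ Icc 1 n, if P ^ k ∣ f then (P.natDegree : ℂ) else 0 := by
  obtain ⟨hm, hn⟩ := mem_Mon.1 hf
  have hf0 := hm.ne_zero
  set s := UniqueFactorizationMonoid.normalizedFactors f with hs
  have hprod : s.prod = f := by
    rw [hs, UniqueFactorizationMonoid.prod_normalizedFactors_eq hf0, hm.normalize_eq_self]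
  have hmonic : ∀ P ∈ s, P.Monic := by
    intro P hP
    have h1 := UniqueFactorizationMonoid.normalize_normalized_factor P hP
    have h2 := (UniqueFactorizationMonoid.irreducible_of_normalized_factor P hP).ne_zero
    rw [← h1]; exact monic_normalize h2
  have hdeg : n = (s.map natDegree).sum := by
    rw [← hn, ← hprod, natDegree_multiset_prod_of_monic _ hmonic]
  have hcount : ∀ P ∈ Irr F n, ∑ k ∈ Icc 1 n, (if P ^ k ∣ f then (P.natDegree : ℂ) else 0)
      = (s.count P : ℂ) * P.natDegree := by
    intro P hP
    obtain ⟨hPm, hPn, hPi⟩ := mem_Irr.1 hP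
    have hiff : ∀ k, P ^ k ∣ f ↔ k ≤ s.count P := by
      intro k
      rw [pow_dvd_iff_le_emultiplicity,
        UniqueFactorizationMonoid.emultiplicity_eq_count_normalizedFactors hPi hf0,
        hPm.normalize_eq_self]
      norm_cast
    have hle : s.count P ≤ n := by
      have h1 : P ^ s.count P ∣ f := (hiff _).2 le_rfl
      have h2 := natDegree_le_of_dvd h1 hf0
      rw [natDegree_pow, hn] at h2
      have := hPi.natDegree_pos
      nlinarith
    rw [← Finset.sum_filter]
    have : (Icc 1 n).filter (fun k => P ^ k ∣ f) = Icc 1 (s.count P) := by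
      ext k; simp only [mem_filter, mem_Icc, hiff]; omega
    rw [this, sum_const, Nat.card_Icc, nsmul_eq_mul]; simp
  rw [Finset.sum_congr rfl hcount]
  have hsub : s.toFinset ⊆ Irr F n := by
    intro P hP
    rw [Multiset.mem_toFinset] at hP
    refine mem_Irr.2 ⟨hmonic P hP, ?_, UniqueFactorizationMonoid.irreducible_of_normalized_factor P hP⟩
    have := natDegree_le_of_dvd (UniqueFactorizationMonoid.dvd_of_mem_normalizedFactors hP) hf0
    omega
  rw [← Finset.sum_subset hsub]
  · conv_lhs => rw [hdeg, Finset.sum_multiset_map_count]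
    push_cast [nsmul_eq_mul]; rfl
  · intro P _ hP
    rw [Multiset.mem_toFinset] at hP
    simp [Multiset.count_eq_zero_of_notMem hP]

/-- the von Mangoldt type sum -/
noncomputable def Smang (ψ : AddChar F ℂ) (a b : F) (m : ℕ) : ℂ :=
  ∑ P ∈ Irr F m, if P.natDegree ∣ m then (P.natDegree : ℂ) * Lam ψ a b P ^ (m / P.natDegree) else 0

open Classical in
lemma sum_dvd (ψ : AddChar F ℂ) (a b : F) (n : ℕ) {g : F[X]} (hg : g.Monic) :
    ∑ f ∈ Mon F n, (if g ∣ f then Lam ψ a b f else 0) =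
      if g.natDegree ≤ n then Lam ψ a b g * Acoef ψ a b (n - g.natDegree) else 0 := by
  split_ifs with h
  · rw [Acoef, Finset.mul_sum, ← Finset.sum_filter]
    symm
    refine Finset.sum_bij (fun r _ => g * r) ?_ ?_ ?_ ?_
    · intro r hr
      obtain ⟨h1, h2⟩ := mem_Mon.1 hr
      rw [mem_filter, mem_Mon]
      exact ⟨⟨hg.mul h1, by rw [hg.natDegree_mul h1, h2]; omega⟩, dvd_mul_right _ _⟩
    · intro r _ r' _ h; exact mul_left_cancel₀ hg.ne_zero h
    · intro f hf
      rw [mem_filter, mem_Mon] at hf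
      obtain ⟨⟨h1, h2⟩, r, rfl⟩ := hf
      have hr : r.Monic := hg.of_mul_monic_left h1
      refine ⟨r, mem_Mon.2 ⟨hr, ?_⟩, rfl⟩
      rw [hg.natDegree_mul hr] at h2; omega
    · intro r hr
      rw [Lam_mul _ _ _ hg (mem_Mon.1 hr).1]
  · refine Finset.sum_eq_zero fun f hf => ?_
    rw [if_neg]
    intro hd
    obtain ⟨h1, h2⟩ := mem_Mon.1 hf
    have := natDegree_le_of_dvd hd h1.ne_zero
    omega

lemma newton (ψ : AddChar F ℂ) (a b : F) (n : ℕ) :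
    (n : ℂ) * Acoef ψ a b n = ∑ m ∈ Icc 1 n, Smang ψ a b m * Acoef ψ a b (n - m) := by
  classical
  have h1 : (n : ℂ) * Acoef ψ a b n = ∑ P ∈ Irr F n, ∑ k ∈ Icc 1 n,
      (P.natDegree : ℂ) * (if P.natDegree * k ≤ n then
        Lam ψ a b P ^ k * Acoef ψ a b (n - P.natDegree * k) else 0) := by
    rw [Acoef, Finset.mul_sum]
    have : ∀ f ∈ Mon F n, (n : ℂ) * Lam ψ a b f = ∑ P ∈ Irr F n, ∑ k ∈ Icc 1 n,
        (P.natDegree : ℂ) * (if P ^ k ∣ f then Lam ψ a b f else 0) := by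
      intro f hf
      conv_lhs => rw [natDegree_eq_sum hf]
      simp_rw [Finset.sum_mul]
      refine Finset.sum_congr rfl fun P _ => Finset.sum_congr rfl fun k _ => ?_
      split_ifs <;> simp
    rw [Finset.sum_congr rfl this, Finset.sum_comm]
    refine Finset.sum_congr rfl fun P hP => ?_
    rw [Finset.sum_comm]
    refine Finset.sum_congr rfl fun k _ => ?_
    obtain ⟨hPm, -, -⟩ := mem_Irr.1 hP
    rw [← Finset.mul_sum, sum_dvd ψ a b n (hPm.pow k), hPm.natDegree_pow, Lam_pow _ _ _ hPm,
      mul_comm k]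
  have h2 : ∀ m ∈ Icc 1 n, Smang ψ a b m * Acoef ψ a b (n - m) = ∑ P ∈ Irr F n,
      if P.natDegree ∣ m then (P.natDegree : ℂ) * (Lam ψ a b P ^ (m / P.natDegree) *
        Acoef ψ a b (n - m)) else 0 := by
    intro m hm
    rw [mem_Icc] at hm
    rw [Smang, Finset.sum_mul]
    have hsub : Irr F m ⊆ Irr F n := by
      intro P hP; rw [mem_Irr] at hP ⊢; exact ⟨hP.1, by omega, hP.2.2⟩
    rw [← Finset.sum_subset hsub]
    · refine Finset.sum_congr rfl fun P _ => ?_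
      split_ifs
      · ring
      · simp
    · intro P hP hP'
      rw [if_neg]
      intro hd
      apply hP'
      rw [mem_Irr] at hP ⊢
      exact ⟨hP.1, Nat.le_of_dvd (by omega) hd, hP.2.2⟩
  rw [h1, Finset.sum_congr rfl h2, Finset.sum_comm (s := Icc 1 n)]
  refine Finset.sum_congr rfl fun P hP => ?_
  have hpos : 0 < P.natDegree := (mem_Irr.1 hP).2.2.natDegree_pos
  simp_rw [mul_ite, mul_zero]
  rw [← Finset.sum_filter, ← Finset.sum_filter]
  refine Finset.sum_bij (fun k _ => P.natDegree * k) ?_ ?_ ?_ ?_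
  · intro k hk
    simp only [mem_filter, mem_Icc] at hk ⊢
    exact ⟨⟨by nlinarith, hk.2⟩, dvd_mul_right _ _⟩
  · intro k _ k' _ h; exact Nat.eq_of_mul_eq_mul_left hpos h
  · intro m hm
    simp only [mem_filter, mem_Icc] at hm
    obtain ⟨⟨h1, h2⟩, k, rfl⟩ := hm
    refine ⟨k, ?_, rfl⟩
    simp only [mem_filter, mem_Icc]
    refine ⟨⟨?_, by nlinarith⟩, h2⟩
    rcases Nat.eq_zero_or_pos k with h | h
    · simp [h] at h1
    · exact h
  · intro k _
    rw [Nat.mul_div_cancel_left _ hpos]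

lemma Smang_eq {L : Type*} [Field L] [Fintype L] [DecidableEq L] [Algebra F L]
    (ψ : AddChar F ℂ) (a b : F) (m : ℕ) (hm : Module.finrank F L = m) :
    ∑ x ∈ univ.filter (fun x : L => x ≠ 0),
      ψ (Algebra.trace F L (algebraMap F L a * x + algebraMap F L b / x)) = Smang ψ a b m := by
  classical
  have : FiniteDimensional F L := .of_finite
  have hmpos : 0 < m := by rw [← hm]; exact Module.finrank_pos
  have h1 : ∑ x ∈ univ.filter (fun x : L => x ≠ 0),
      ψ (Algebra.trace F L (algebraMap F L a * x + algebraMap F L b / x)) =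
      ∑ x : L, Lam ψ a b (minpoly F x) ^ (m / (minpoly F x).natDegree) := by
    rw [Finset.sum_filter]
    refine Finset.sum_congr rfl fun x _ => ?_
    split_ifs with hx
    · rw [trace_char ψ a b x hx, hm]
    · push Not at hx
      subst hx
      simp [Lam, hmpos.ne']
  rw [h1, Smang]
  have hdvd : ∀ x : L, (minpoly F x).natDegree ∣ m := fun x => by
    rw [← hm]; exact minpoly.degree_dvd (.of_finite F x)
  rw [← Finset.sum_fiberwise_of_maps_to (s := univ) (t := Irr F m) (g := fun x : L => minpoly F x)]
  · refine Finset.sum_congr rfl fun P hP => ?_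
    obtain ⟨hPm, hPn, hPi⟩ := mem_Irr.1 hP
    have h2 : ∀ x ∈ univ.filter (fun x : L => minpoly F x = P),
        Lam ψ a b (minpoly F x) ^ (m / (minpoly F x).natDegree) =
          Lam ψ a b P ^ (m / P.natDegree) := by
      intro x hx
      rw [mem_filter] at hx
      rw [hx.2]
    rw [Finset.sum_congr rfl h2, sum_const, nsmul_eq_mul]
    split_ifs with hd
    · congr 1
      norm_cast
      have hsplit : (P.map (algebraMap F L)).Splits := by
        have h3 := (hPi.natDegree_dvd_iff_dvd_X_pow_card_pow_sub_X).1 hd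
        have h4 : Nat.card F ^ m = Nat.card L := by
          rw [Module.natCard_eq_pow_finrank (K := F) (V := L), hm]
        rw [h4] at h3
        have h5 := FiniteField.isSplittingField_sub L F
        rw [← Nat.card_eq_fintype_card] at h5
        refine Splits.of_dvd h5.splits ?_ (map_dvd (algebraMap F L) h3)
        exact map_ne_zero (FiniteField.X_pow_card_sub_X_ne_zero _ Finite.one_lt_card)
      rw [← card_rootSet_eq_natDegree (K := L) (PerfectField.separable_of_irreducible hPi) hsplit,
        ← Fintype.card_coe]
      refine Fintype.card_congr (Equiv.subtypeEquivRight fun x => ?_)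
      rw [mem_filter, mem_rootSet]
      constructor
      · rintro ⟨-, rfl⟩; exact ⟨hPm.ne_zero, minpoly.aeval F x⟩
      · rintro ⟨-, h⟩; exact ⟨mem_univ _, (minpoly.eq_of_irreducible_of_monic hPi h hPm).symm⟩
    · rw [Finset.card_eq_zero.2, Nat.cast_zero, zero_mul]
      rw [Finset.filter_eq_empty_iff]
      intro x _ h
      exact hd (h ▸ hdvd x)
  · intro x _
    exact mem_Irr.2 ⟨minpoly.monic (.of_finite F x), Nat.le_of_dvd hmpos (hdvd x),
      minpoly.irreducible (.of_finite F x)⟩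

lemma Smang_rec (ψ : AddChar F ℂ) (hψ : ψ ≠ 1) (a b : F) (ha : a ≠ 0) (hb : b ≠ 0) :
    Smang ψ a b 1 = Acoef ψ a b 1 ∧
    Smang ψ a b 2 = 2 * Fintype.card F - Acoef ψ a b 1 ^ 2 ∧
    ∀ n, Smang ψ a b (n + 3) = -(Acoef ψ a b 1 * Smang ψ a b (n + 2)) -
      Fintype.card F * Smang ψ a b (n + 1) := by
  have e1 := newton ψ a b 1
  have e2 := newton ψ a b 2
  have s1 : Smang ψ a b 1 = Acoef ψ a b 1 := by
    simp [Acoef_zero] at e1; exact e1.symm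
  refine ⟨s1, ?_, ?_⟩
  · rw [Finset.sum_Icc_succ_top (by norm_num)] at e2
    simp [Acoef_zero, Acoef_two ψ hψ a b ha hb, s1] at e2
    linear_combination -e2
  · intro n
    have e3 := newton ψ a b (n + 3)
    rw [Acoef_big ψ hψ a b ha _ (by omega), Finset.sum_Icc_succ_top (by omega),
      Finset.sum_Icc_succ_top (by omega), Finset.sum_Icc_succ_top (by omega),
      Finset.sum_eq_zero] at e3
    · rw [show n + 3 - (n + 1) = 2 by omega, show n + 3 - (n + 1 + 1) = 1 by omega,
        show n + 3 - (n + 2 + 1) = 0 by omega, Acoef_zero, Acoef_two ψ hψ a b ha hb] at e3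
      linear_combination -e3
    · intro m hm
      rw [mem_Icc] at hm
      rw [Acoef_big ψ hψ a b ha _ (by omega), mul_zero]

end Lfun
end W13


namespace W13

lemma kl_stepanov {k : Type*} [Field k] [Fintype k] [DecidableEq k] (p : ℕ) [Fact p.Prime]
    [Algebra (ZMod p) k] (hp3 : 3 ≤ p) (ν : ℕ) (hcard : Fintype.card k = p ^ (2 * (ν + 1)))
    (a b : k) (ha : a ≠ 0) :
    ‖∑ x ∈ univ.filter (fun x : k => x ≠ 0),
      (ZMod.stdAddChar (N := p)) (Algebra.trace (ZMod p) k (a * x + b / x))‖ ≤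
      (4 * p + 1) * (p : ℝ) ^ (ν + 1) := by
  classical
  have : CharP k p := charP_of_injective_algebraMap (algebraMap (ZMod p) k).injective p
  let N : ZMod p → ℕ := fun u => ((Finset.univ : Finset k).filter (fun x => x ≠ 0 ∧
      Algebra.trace (ZMod p) k (a * x + b / x) = u)).card
  have hfin : Module.finrank (ZMod p) k = 2 * (ν + 1) := by
    have h1 := Module.card_eq_pow_finrank (K := ZMod p) (V := k)
    rw [hcard, ZMod.card] at h1
    exact (Nat.pow_right_injective (Fact.out : p.Prime).two_le h1).symm
  have hN : ∀ u, N u ≤ p ^ (2 * ν + 1) + 4 * p ^ (ν + 1) := by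
    intro u
    refine le_trans (Finset.card_le_card ?_)
      (stepanov p hp3 ν hcard a b (algebraMap (ZMod p) k u) ha)
    intro x hx
    simp only [mem_filter, mem_univ, true_and] at hx ⊢
    refine ⟨hx.1, ?_⟩
    rw [← hx.2, FiniteField.algebraMap_trace_eq_sum_pow, hfin, Nat.card_zmod]
  have hsum : ∑ u, N u + 1 = p ^ (2 * (ν + 1)) := by
    rw [← hcard]
    have h1 : ∑ u, N u = ((Finset.univ : Finset k).filter (fun x => x ≠ 0)).card := by
      rw [Finset.card_eq_sum_card_fiberwise (t := univ)
        (f := fun x => Algebra.trace (ZMod p) k (a * x + b / x)) (fun _ _ => mem_coe.2 (mem_univ _))]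
      refine Finset.sum_congr rfl fun u _ => ?_
      rw [Finset.filter_filter]
    rw [h1, Finset.filter_ne', Finset.card_erase_of_mem (mem_univ _), Finset.card_univ]
    have : 0 < Fintype.card k := Fintype.card_pos
    omega
  set M : ℝ := (p : ℝ) ^ (2 * ν + 1) + 4 * (p : ℝ) ^ (ν + 1) with hM
  have hN' : ∀ u, (N u : ℝ) ≤ M := fun u => by rw [hM]; exact_mod_cast hN u
  have hprim : ∑ u : ZMod p, (ZMod.stdAddChar (N := p)) u = 0 := by
    apply AddChar.sum_eq_zero_of_ne_one
    intro h
    have h1 := ZMod.isPrimitive_stdAddChar p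
    have h2 := h1 (a := 1) one_ne_zero
    apply h2
    rw [h]; ext; simp
  have hS : ∑ x ∈ univ.filter (fun x : k => x ≠ 0),
      (ZMod.stdAddChar (N := p)) (Algebra.trace (ZMod p) k (a * x + b / x)) =
      ∑ u : ZMod p, ((N u : ℂ) - (M : ℂ)) * (ZMod.stdAddChar (N := p)) u := by
    simp_rw [sub_mul]
    rw [Finset.sum_sub_distrib, ← Finset.mul_sum, hprim, mul_zero, sub_zero]
    rw [← Finset.sum_fiberwise_of_maps_to (t := univ)
      (g := fun x => Algebra.trace (ZMod p) k (a * x + b / x)) (fun _ _ => mem_univ _)]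
    refine Finset.sum_congr rfl fun u _ => ?_
    rw [Finset.filter_filter, Finset.sum_congr rfl (g := fun _ => (ZMod.stdAddChar (N := p)) u)]
    · rw [sum_const, nsmul_eq_mul]
    · intro x hx
      rw [mem_filter] at hx
      rw [hx.2.2]
  rw [hS]
  calc _ ≤ ∑ u : ZMod p, ‖((N u : ℂ) - (M : ℂ)) * (ZMod.stdAddChar (N := p)) u‖ := norm_sum_le _ _
    _ = ∑ u : ZMod p, (M - N u) := by
      refine Finset.sum_congr rfl fun u _ => ?_
      rw [norm_mul, AddChar.norm_apply, mul_one]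
      rw [← Complex.ofReal_natCast, ← Complex.ofReal_sub, Complex.norm_real, Real.norm_eq_abs,
        abs_of_nonpos (sub_nonpos.2 (hN' u))]
      ring
    _ = p * M - (p ^ (2 * (ν + 1)) - 1) := by
      rw [Finset.sum_sub_distrib, sum_const, Finset.card_univ, ZMod.card, nsmul_eq_mul]
      congr 1
      rw [eq_sub_iff_add_eq]
      exact_mod_cast hsum
    _ ≤ _ := by
      rw [hM]
      have : (p : ℝ) ^ (2 * (ν + 1)) = p * (p : ℝ) ^ (2 * ν + 1) := by ring
      have h1 : (1 : ℝ) ≤ (p : ℝ) ^ (ν + 1) := one_le_pow₀ (by exact_mod_cast (by omega))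
      nlinarith

/-- standard character -/
noncomputable def stdψ (p : ℕ) [Fact p.Prime] (F : Type*) [Field F] [Algebra (ZMod p) F] :
    AddChar F ℂ :=
  (ZMod.stdAddChar (N := p)).compAddMonoidHom (Algebra.trace (ZMod p) F).toAddMonoidHom

lemma stdψ_apply (p : ℕ) [Fact p.Prime] (F : Type*) [Field F] [Algebra (ZMod p) F] (x : F) :
    stdψ p F x = (ZMod.stdAddChar (N := p)) (Algebra.trace (ZMod p) F x) := rfl

lemma stdψ_ne_one (p : ℕ) [Fact p.Prime] (F : Type*) [Field F] [Fintype F] [Algebra (ZMod p) F] :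
    stdψ p F ≠ 1 := by
  obtain ⟨x, hx⟩ := Algebra.trace_surjective (ZMod p) F 1
  intro h
  have h1 := stdψ_apply p F x
  rw [h, hx] at h1
  have h2 : (ZMod.stdAddChar (N := p)) ≠ 1 := by
    intro h
    have h1 := ZMod.isPrimitive_stdAddChar p
    have h2 := h1 (a := 1) one_ne_zero
    apply h2
    rw [h]; ext; simp
  rw [AddChar.zmod_char_ne_one_iff] at h2
  exact h2 h1.symm

lemma Smang_bound (p : ℕ) [Fact p.Prime] (hp3 : 3 ≤ p) (F : Type*) [Field F] [Fintype F]
    [Algebra (ZMod p) F] (a b : F) (ha : a ≠ 0) (j : ℕ) :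
    ‖Smang (stdψ p F) a b (2 * (j + 1))‖ ≤ (4 * p + 1) * (Fintype.card F : ℝ) ^ (j + 1) := by
  classical
  have : CharP F p := charP_of_injective_algebraMap (algebraMap (ZMod p) F).injective p
  let L := FiniteField.Extension F p (2 * (j + 1))
  have : Fintype L := Fintype.ofFinite L
  have hfin : Module.finrank F L = 2 * (j + 1) := FiniteField.finrank_extension F p _
  rw [← Smang_eq (L := L) (stdψ p F) a b _ hfin]
  have hr : 0 < Module.finrank (ZMod p) F := Module.finrank_pos
  set r := Module.finrank (ZMod p) F with hrdef
  obtain ⟨ν, hν⟩ : ∃ ν, r * (j + 1) = ν + 1 := ⟨r * (j + 1) - 1, by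
    have : 0 < r * (j + 1) := by positivity
    omega⟩
  have hcF : Fintype.card F = p ^ r := by
    have h1 := Module.card_eq_pow_finrank (K := ZMod p) (V := F)
    rwa [ZMod.card] at h1
  have hcL : Fintype.card L = p ^ (2 * (ν + 1)) := by
    rw [Module.card_eq_pow_finrank (K := F) (V := L), hfin, hcF, ← pow_mul, ← hν]
    congr 1; ring
  have h := kl_stepanov (k := L) p hp3 ν hcL (algebraMap F L a) (algebraMap F L b) (by simpa using ha)
  have e : (Fintype.card F : ℝ) ^ (j + 1) = (p : ℝ) ^ (ν + 1) := by
    rw [hcF, ← hν]; push_cast; rw [pow_mul]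
  rw [e]
  convert h using 4 with x
  rw [stdψ_apply, Algebra.trace_trace]

theorem weil_kloosterman (p : ℕ) [Fact p.Prime] (hp3 : 3 ≤ p) (F : Type*) [Field F] [Fintype F]
    [DecidableEq F] [Algebra (ZMod p) F] (a b : F) (ha : a ≠ 0) (hb : b ≠ 0) :
    ‖∑ x ∈ univ.filter (fun x : F => x ≠ 0), stdψ p F (a * x + b / x)‖ ≤
      2 * Real.sqrt (Fintype.card F) := by
  set ψ := stdψ p F
  have hψ : ψ ≠ 1 := stdψ_ne_one p F
  rw [← Acoef_one ψ a b]
  obtain ⟨s1, s2, s3⟩ := Smang_rec ψ hψ a b ha hb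
  set q : ℝ := (Fintype.card F : ℝ) with hq
  have hqpos : 0 < q := by rw [hq]; exact_mod_cast Fintype.card_pos
  have hreal : (starRingEnd ℂ) (Acoef ψ a b 1) = Acoef ψ a b 1 := by
    rw [Acoef_one ψ a b, map_sum]
    refine Finset.sum_bij (fun x _ => -x) ?_ ?_ ?_ ?_
    · intro x hx; simpa using hx
    · intro x _ y _ h; simpa using h
    · intro x hx; exact ⟨-x, by simpa using hx, by simp⟩
    · intro x _
      rw [← AddChar.map_neg_eq_conj]
      congr 1
      rw [div_neg]; ring
  obtain ⟨κ, hκ⟩ := Complex.conj_eq_iff_real.1 hreal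
  rw [hκ] at s1 s2 s3 ⊢
  rw [Complex.norm_real, Real.norm_eq_abs]
  by_contra! hcon
  have hD : 4 * q < κ ^ 2 := by
    have h1 : (2 * Real.sqrt q) ^ 2 < |κ| ^ 2 := by gcongr
    rw [sq_abs, mul_pow, Real.sq_sqrt hqpos.le] at h1
    linarith
  set δ := Real.sqrt (κ ^ 2 - 4 * q) with hδ
  have hδ2 : δ ^ 2 = κ ^ 2 - 4 * q := Real.sq_sqrt (by linarith)
  set α := (-κ - δ) / 2 with hα
  set β := (-κ + δ) / 2 with hβ
  have hsum : α + β = -κ := by rw [hα, hβ]; ring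
  have hprod : α * β = q := by rw [hα, hβ]; linear_combination (-1/4) * hδ2
  have hcast : ((Fintype.card F : ℕ) : ℂ) = (q : ℂ) := by rw [hq]; simp
  have hrec : ∀ n, Smang ψ a b (n + 1) = ((-(α ^ (n + 1) + β ^ (n + 1)) : ℝ) : ℂ) ∧
      Smang ψ a b (n + 2) = ((-(α ^ (n + 2) + β ^ (n + 2)) : ℝ) : ℂ) := by
    intro n
    induction n with
    | zero =>
      refine ⟨?_, ?_⟩
      · rw [s1]; congr 1; simp; linarith
      · rw [s2, hcast]
        norm_cast
        rw [← hprod, show κ = -(α + β) by linarith]; ring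
    | succ n ih =>
      refine ⟨ih.2, ?_⟩
      rw [s3, ih.1, ih.2, hcast]
      norm_cast
      rw [← hprod, show κ = -(α + β) by linarith]; ring
  have hbd : ∀ j : ℕ, α ^ (2 * (j + 1)) + β ^ (2 * (j + 1)) ≤ (4 * p + 1) * q ^ (j + 1) := by
    intro j
    have h1 := Smang_bound p hp3 F a b ha j
    rw [show 2 * (j + 1) = (2 * j) + 2 by ring, (hrec (2 * j)).2, Complex.norm_real,
      Real.norm_eq_abs, abs_neg] at h1
    exact (le_abs_self _).trans h1
  have hfinal : ∀ γ : ℝ, q < γ ^ 2 → (∀ j : ℕ, γ ^ (2 * (j + 1)) ≤ (4 * p + 1) * q ^ (j + 1)) →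
      False := by
    intro γ hγ hall
    obtain ⟨n, hn⟩ := pow_unbounded_of_one_lt (4 * p + 1 : ℝ) (y := γ ^ 2 / q)
      ((one_lt_div hqpos).2 hγ)
    have h2 : γ ^ 2 / q > 1 := (one_lt_div hqpos).2 hγ
    have h1 : (γ ^ 2 / q) ^ n ≤ (γ ^ 2 / q) ^ (n + 1) := pow_le_pow_right₀ h2.le (by omega)
    have h3 := hall n
    rw [pow_mul, ← div_le_iff₀ (by positivity), ← div_pow] at h3
    linarith
  have hsq : 2 * q < α ^ 2 + β ^ 2 := by
    have : α ^ 2 + β ^ 2 = κ ^ 2 - 2 * q := by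
      rw [← hprod, show κ = -(α + β) by linarith]; ring
    linarith
  rcases lt_or_ge q (α ^ 2) with h | h
  · refine hfinal α h fun j => ?_
    have : 0 ≤ β ^ (2 * (j + 1)) := by rw [pow_mul]; positivity
    linarith [hbd j]
  · refine hfinal β (by linarith) fun j => ?_
    have : 0 ≤ α ^ (2 * (j + 1)) := by rw [pow_mul]; positivity
    linarith [hbd j]

end W13


namespace W13

section Gauss
variable {F : Type*} [Field F] [Fintype F] [DecidableEq F]

/-- quadratic character, complex valued -/
noncomputable def eta (F : Type*) [Field F] [Fintype F] [DecidableEq F] : MulChar F ℂ :=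
  (quadraticChar F).ringHomComp (Int.castRingHom ℂ)

lemma eta_apply (x : F) : eta F x = ((quadraticChar F x : ℤ) : ℂ) := rfl

lemma eta_sq {x : F} (hx : x ≠ 0) : eta F x * eta F x = 1 := by
  rw [eta_apply, ← sq]; exact_mod_cast quadraticChar_sq_one hx

lemma eta_norm {x : F} (hx : x ≠ 0) : ‖eta F x‖ = 1 := by
  have h := congrArg norm (eta_sq hx)
  rw [norm_mul, norm_one, ← sq] at h
  exact (pow_eq_one_iff_of_nonneg (norm_nonneg _) (by norm_num)).1 h

lemma eta_inv (x : F) : eta F x⁻¹ = eta F x := by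
  by_cases hx : x = 0
  · simp [hx]
  · have h1 : eta F x⁻¹ * eta F x = 1 := by rw [← map_mul, inv_mul_cancel₀ hx, map_one]
    calc eta F x⁻¹ = eta F x⁻¹ * (eta F x * eta F x) := by rw [eta_sq hx, mul_one]
      _ = _ := by rw [← mul_assoc, h1, one_mul]

lemma eta_ne_one (h2 : ringChar F ≠ 2) : eta F ≠ 1 := by
  obtain ⟨a, ha⟩ := quadraticChar_exists_neg_one h2
  intro h
  have h1 : eta F a = -1 := by rw [eta_apply, ha]; simp
  have ha0 : a ≠ 0 := by rintro rfl; simp at ha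
  rw [h, MulChar.one_apply (IsUnit.mk0 a ha0)] at h1
  norm_num at h1

lemma gauss_norm (h2 : ringChar F ≠ 2) (ψ : AddChar F ℂ) (hψ : ψ ≠ 1) :
    ‖gaussSum (eta F) ψ‖ = Real.sqrt (Fintype.card F) := by
  have hq : (eta F).IsQuadratic := (quadraticChar_isQuadratic F).comp _
  have h := congrArg norm (gaussSum_sq (eta_ne_one h2) hq (AddChar.IsPrimitive.of_ne_one hψ))
  rw [norm_pow, norm_mul, eta_norm (by simp), one_mul, Complex.norm_natCast] at h
  rw [← h, Real.sqrt_sq (norm_nonneg _)]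

lemma gauss_shift (ψ : AddChar F ℂ) {c : F} (hc : c ≠ 0) :
    ∑ y : F, eta F y * ψ (c * y) = eta F c * gaussSum (eta F) ψ := by
  have h := gaussSum_mulShift (eta F) ψ (Units.mk0 c hc)
  rw [Units.val_mk0] at h
  rw [← h, ← mul_assoc, eta_sq hc, one_mul, gaussSum]
  rfl

lemma sum_psi_shift (ψ : AddChar F ℂ) (hψ : ψ ≠ 1) (c : F) :
    ∑ y : F, ψ (y * c) = if c = 0 then (Fintype.card F : ℂ) else 0 := by
  rw [AddChar.sum_mulShift _ (AddChar.IsPrimitive.of_ne_one hψ)]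
  split_ifs <;> simp

lemma sum_sq (h2 : ringChar F ≠ 2) (f : F → ℂ) :
    ∑ x : F, f (x ^ 2) = ∑ y : F, (1 + eta F y) * f y := by
  rw [← Finset.sum_fiberwise_of_maps_to (t := univ) (g := fun x : F => x ^ 2)
    (fun _ _ => mem_univ _)]
  refine Finset.sum_congr rfl fun y _ => ?_
  have h := quadraticChar_card_sqrts h2 y
  rw [Finset.sum_congr rfl (g := fun _ => f y)]
  · rw [sum_const, nsmul_eq_mul, eta_apply]
    congr 1
    have e : {x : F | x ^ 2 = y}.toFinset = univ.filter (fun x : F => x ^ 2 = y) := by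
      ext; simp
    rw [e] at h
    rw [add_comm]
    exact_mod_cast h
  · intro x hx
    rw [mem_filter] at hx
    rw [hx.2]

lemma gauss_quad (h2 : ringChar F ≠ 2) (ψ : AddChar F ℂ) (hψ : ψ ≠ 1) {c : F} (hc : c ≠ 0) :
    ∑ x : F, ψ (c * x ^ 2) = eta F c * gaussSum (eta F) ψ := by
  rw [sum_sq h2 (fun y => ψ (c * y))]
  simp_rw [add_mul, one_mul]
  rw [Finset.sum_add_distrib, gauss_shift ψ hc]
  have := sum_psi_shift ψ hψ c
  simp_rw [mul_comm _ c] at this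
  rw [this, if_neg hc, zero_add]

lemma four_ne (h2 : ringChar F ≠ 2) : (2 : F) ≠ 0 := Ring.two_ne_zero h2

lemma gauss_quad_lin (h2 : ringChar F ≠ 2) (ψ : AddChar F ℂ) (hψ : ψ ≠ 1) {c : F} (hc : c ≠ 0)
    (e : F) :
    ∑ x : F, ψ (c * x ^ 2 - e * x) = eta F c * gaussSum (eta F) ψ * ψ (-(e ^ 2 / (4 * c))) := by
  rw [← gauss_quad h2 ψ hψ hc, Finset.sum_mul]
  have h2' := four_ne h2
  have h4 : (4 : F) ≠ 0 := by
    have : (4 : F) = 2 * 2 := by norm_num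
    rw [this]; exact mul_ne_zero h2' h2'
  rw [← Equiv.sum_comp (Equiv.addRight (e / (2 * c)))]
  refine Finset.sum_congr rfl fun x _ => ?_
  rw [← AddChar.map_add_eq_mul]
  congr 1
  simp only [Equiv.coe_addRight]
  have : (4 : F) = 2 * 2 := by norm_num
  rw [this]
  field_simp
  ring

lemma salie_sq (h2 : ringChar F ≠ 2) (ψ : AddChar F ℂ) (hψ : ψ ≠ 1) (c : F) :
    ∑ x ∈ univ.filter (fun x : F => x ≠ 0), eta F x * ψ (x + c ^ 2 / x) =
      gaussSum (eta F) ψ * (ψ (2 * c) + ψ (-(2 * c)) - if c = 0 then 1 else 0) := by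
  set G := gaussSum (eta F) ψ
  have h2' := four_ne h2
  have h4 : (4 : F) ≠ 0 := by
    have : (4 : F) = 2 * 2 := by norm_num
    rw [this]; exact mul_ne_zero h2' h2'
  let Φ : F → ℂ := fun c => ∑ x ∈ univ.filter (fun x : F => x ≠ 0), eta F x * ψ (x + c ^ 2 / x)
  have hq0 : (Fintype.card F : ℂ) ≠ 0 := by exact_mod_cast Fintype.card_ne_zero
  have hhat : ∀ v : F, ∑ c' : F, Φ c' * ψ (-(v * c')) =
      G * ((if v = 2 then (Fintype.card F : ℂ) else 0) +
        (if v = -2 then (Fintype.card F : ℂ) else 0) - 1) := by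
    intro v
    simp only [Φ, Finset.sum_mul]
    rw [Finset.sum_comm]
    have h1 : ∀ x ∈ univ.filter (fun x : F => x ≠ 0),
        ∑ c' : F, eta F x * ψ (x + c' ^ 2 / x) * ψ (-(v * c')) = G * ψ (x * (1 - v ^ 2 / 4)) := by
      intro x hx
      rw [mem_filter] at hx
      have hx0 := hx.2
      have : ∀ c' : F, eta F x * ψ (x + c' ^ 2 / x) * ψ (-(v * c')) =
          eta F x * ψ x * ψ (x⁻¹ * c' ^ 2 - v * c') := by
        intro c'
        rw [mul_assoc, mul_assoc, ← AddChar.map_add_eq_mul, ← AddChar.map_add_eq_mul]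
        congr 2; field_simp; ring
      simp_rw [this]
      rw [← Finset.mul_sum, gauss_quad_lin h2 ψ hψ (inv_ne_zero hx0), eta_inv]
      calc eta F x * ψ x * (eta F x * G * ψ (-(v ^ 2 / (4 * x⁻¹))))
          = (eta F x * eta F x) * G * (ψ x * ψ (-(v ^ 2 / (4 * x⁻¹)))) := by ring
        _ = _ := by
          rw [eta_sq hx0, one_mul, ← AddChar.map_add_eq_mul]
          congr 2; field_simp; ring
    rw [Finset.sum_congr rfl h1, ← Finset.mul_sum]
    congr 1
    have h3 := sum_psi_shift ψ hψ (1 - v ^ 2 / 4)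
    rw [← Finset.add_sum_erase _ _ (mem_univ (0 : F)), ← Finset.filter_ne'] at h3
    simp only [zero_mul, AddChar.map_zero_eq_one] at h3
    have h5 : (1 - v ^ 2 / 4 = 0) ↔ (v = 2 ∨ v = -2) := by
      rw [← sq_eq_sq_iff_eq_or_eq_neg]
      constructor
      · intro h; field_simp at h; linear_combination -h
      · intro h; rw [h]; field_simp; norm_num
    have h6 : (2 : F) ≠ -2 := by
      intro h
      apply h4; linear_combination h
    rw [eq_sub_iff_add_eq, add_comm, h3]
    simp only [h5]
    by_cases hv : v = 2
    · subst hv; simp [h6]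
    · by_cases hv' : v = -2
      · subst hv'; simp [h6.symm]
      · simp [hv, hv']
  have hinv : (Fintype.card F : ℂ) * Φ c = ∑ v : F, ψ (v * c) * ∑ c' : F, Φ c' * ψ (-(v * c')) := by
    simp_rw [Finset.mul_sum]
    rw [Finset.sum_comm]
    have : ∀ c' v : F, ψ (v * c) * (Φ c' * ψ (-(v * c'))) = Φ c' * ψ (v * (c - c')) := by
      intro c' v
      rw [mul_left_comm, ← AddChar.map_add_eq_mul]; congr 2; ring
    simp_rw [this, ← Finset.mul_sum, sum_psi_shift ψ hψ, sub_eq_zero, mul_ite, mul_zero]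
    simp [mul_comm]
  show Φ c = _
  apply mul_left_cancel₀ hq0
  rw [hinv]
  simp_rw [hhat, mul_left_comm _ G, ← Finset.mul_sum, mul_sub, mul_add, mul_ite, mul_zero, mul_one]
  rw [Finset.sum_sub_distrib, Finset.sum_add_distrib, sum_psi_shift ψ hψ]
  simp only [Finset.sum_ite_eq', mem_univ, if_true]
  rw [neg_mul]
  split_ifs <;> ring

lemma salie_bound (h2 : ringChar F ≠ 2) (ψ : AddChar F ℂ) (hψ : ψ ≠ 1) (a b : F) (ha : a ≠ 0) :
    ‖∑ x ∈ univ.filter (fun x : F => x ≠ 0), eta F x * ψ (a * x + b / x)‖ ≤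
      2 * Real.sqrt (Fintype.card F) := by
  have hs : ∑ x ∈ univ.filter (fun x : F => x ≠ 0), eta F x * ψ (a * x + b / x) =
      eta F a * ∑ x ∈ univ.filter (fun x : F => x ≠ 0), eta F x * ψ (x + (a * b) / x) := by
    rw [Finset.mul_sum]
    refine Finset.sum_bij (fun x _ => a * x) ?_ ?_ ?_ ?_
    · intro x hx; simpa [ha] using hx
    · intro x _ y _ h; exact mul_left_cancel₀ ha h
    · intro x hx
      refine ⟨x / a, by simpa [ha] using hx, by field_simp⟩
    · intro x hx
      rw [mem_filter] at hx
      have hx0 := hx.2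
      rw [map_mul, ← mul_assoc, ← mul_assoc, eta_sq ha, one_mul]
      congr 2; field_simp
  rw [hs, norm_mul, eta_norm ha, one_mul]
  have hGn := gauss_norm h2 ψ hψ
  have hs0 := Real.sqrt_nonneg (Fintype.card F : ℝ)
  by_cases hsq : IsSquare (a * b)
  · obtain ⟨c, hc⟩ := hsq
    rw [hc, ← sq, salie_sq h2 ψ hψ c, norm_mul, hGn, mul_comm]
    refine mul_le_mul_of_nonneg_right ?_ hs0
    split_ifs with h
    · subst h; simp
    · rw [sub_zero]
      refine (norm_add_le _ _).trans ?_
      rw [AddChar.norm_apply, AddChar.norm_apply]; norm_num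
  · have hab : a * b ≠ 0 := by
      intro h; apply hsq; rw [h]; exact IsSquare.zero
    have hη : eta F (a * b) = -1 := by
      rw [eta_apply, quadraticChar_neg_one_iff_not_isSquare.2 hsq]; simp
    set S := ∑ x ∈ univ.filter (fun x : F => x ≠ 0), eta F x * ψ (x + (a * b) / x)
    have : S = -S := by
      rw [← neg_one_mul, ← hη, Finset.mul_sum]
      refine Finset.sum_bij (fun x _ => (a * b) / x) ?_ ?_ ?_ ?_
      · intro x hx
        rw [mem_filter] at hx ⊢
        exact ⟨mem_univ _, div_ne_zero hab hx.2⟩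
      · intro x hx y hy h
        rw [mem_filter] at hx hy
        have := hx.2
        have := hy.2
        have h' := congrArg (fun z => a * b / z) h
        simp only [div_div_cancel₀ hab] at h'
        exact h'
      · intro x hx
        rw [mem_filter] at hx
        refine ⟨a * b / x, by simp only [mem_filter, mem_univ, true_and]; exact div_ne_zero hab hx.2, ?_⟩
        simp only [div_div_cancel₀ hab]
      · intro x hx
        rw [mem_filter] at hx
        have h5 : eta F (a * b / x) = eta F (a * b) * eta F x := by
          rw [div_eq_mul_inv, map_mul, eta_inv]
        rw [h5, ← mul_assoc, ← mul_assoc, eta_sq hab, one_mul, div_div_cancel₀ hab, add_comm]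
    have h0 : S = 0 := by
      have : (2 : ℂ) * S = 0 := by linear_combination this
      simpa using this
    rw [h0, norm_zero]; positivity

lemma exp_bound (p : ℕ) [Fact p.Prime] (hp3 : 3 ≤ p) [Algebra (ZMod p) F] (n : ℕ) (a b : F)
    (ha : a ≠ 0) :
    ‖∑ x ∈ univ.filter (fun x : F => x ≠ 0), eta F x ^ n * stdψ p F (a * x + b / x)‖ ≤
      2 * Real.sqrt (Fintype.card F) := by
  have hchar : CharP F p := charP_of_injective_algebraMap (algebraMap (ZMod p) F).injective p
  have h2 : ringChar F ≠ 2 := by rw [ringChar.eq F p]; omega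
  have hψ := stdψ_ne_one p F
  rcases Nat.even_or_odd n with ⟨m, rfl⟩ | ⟨m, rfl⟩
  · rw [Finset.sum_congr rfl (g := fun x => stdψ p F (a * x + b / x))]
    swap
    · intro x hx
      rw [mem_filter] at hx
      rw [pow_add, ← mul_pow, eta_sq hx.2, one_pow, one_mul]
    by_cases hb : b = 0
    · subst hb
      have h3 := sum_psi_shift (stdψ p F) hψ a
      rw [← Finset.add_sum_erase _ _ (mem_univ (0 : F)), ← Finset.filter_ne', if_neg ha] at h3
      simp only [mul_comm _ a, mul_zero, AddChar.map_zero_eq_one] at h3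
      simp only [zero_div, add_zero]
      rw [eq_neg_of_add_eq_zero_right h3, norm_neg, norm_one]
      have : 1 ≤ Real.sqrt (Fintype.card F) := by
        rw [Real.one_le_sqrt]; exact_mod_cast Fintype.card_pos
      linarith
    · exact weil_kloosterman p hp3 F a b ha hb
  · rw [Finset.sum_congr rfl (g := fun x => eta F x * stdψ p F (a * x + b / x))]
    swap
    · intro x hx
      rw [mem_filter] at hx
      rw [pow_succ, pow_mul, sq, eta_sq hx.2, one_pow, one_mul]
    exact salie_bound h2 _ hψ a b ha
end Gauss
end W13


namespace W13
section Spec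
variable {F : Type*} [Field F] [Fintype F] [DecidableEq F]

lemma sum_prod_fun {n : ℕ} (f : Fin n → F → ℂ) :
    ∑ z : Fin n → F, ∏ i, f i (z i) = ∏ i, ∑ x, f i x := by
  rw [Finset.prod_univ_sum, Fintype.piFinset_univ]

lemma psi_sum {ι : Type*} (ψ : AddChar F ℂ) (s : Finset ι) (f : ι → F) :
    ψ (∑ i ∈ s, f i) = ∏ i ∈ s, ψ (f i) := by
  classical
  induction s using Finset.induction_on with
  | empty => simp
  | insert a s ha ih => rw [Finset.sum_insert ha, Finset.prod_insert ha, AddChar.map_add_eq_mul, ih]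

lemma dot_sub {n : ℕ} (m x y : Fin n → F) :
    ∑ i, m i * (x - y) i = (∑ i, m i * x i) + -(∑ i, m i * y i) := by
  simp only [Pi.sub_apply, mul_sub, Finset.sum_sub_distrib]; ring

lemma orth (ψ : AddChar F ℂ) (hψ : ψ ≠ 1) {n : ℕ} (z : Fin n → F) :
    ∑ m : Fin n → F, ψ (∑ i, m i * z i) = if z = 0 then (Fintype.card F : ℂ) ^ n else 0 := by
  simp_rw [psi_sum]
  rw [sum_prod_fun (fun i x => ψ (x * z i))]
  simp_rw [sum_psi_shift ψ hψ]
  split_ifs with h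
  · subst h; simp
  · obtain ⟨i, hi⟩ := Function.ne_iff.1 h
    exact Finset.prod_eq_zero (mem_univ i) (by simpa using hi)

lemma parseval (ψ : AddChar F ℂ) (hψ : ψ ≠ 1) {n : ℕ} (f : (Fin n → F) → ℝ) :
    ∑ m : Fin n → F, ‖∑ x, (f x : ℂ) * ψ (∑ i, m i * x i)‖ ^ 2 =
      (Fintype.card F : ℝ) ^ n * ∑ x, f x ^ 2 := by
  have h : ((∑ m : Fin n → F, ‖∑ x, (f x : ℂ) * ψ (∑ i, m i * x i)‖ ^ 2 : ℝ) : ℂ) =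
      (((Fintype.card F : ℝ) ^ n * ∑ x, f x ^ 2 : ℝ) : ℂ) := by
    push_cast
    have e1 : ∀ m : Fin n → F, ((‖∑ x, (f x : ℂ) * ψ (∑ i, m i * x i)‖ : ℂ)) ^ 2 =
        ∑ x, ∑ y, (f x : ℂ) * f y * ψ (∑ i, m i * (x - y) i) := by
      intro m
      rw [← Complex.mul_conj', map_sum, Finset.sum_mul_sum]
      refine Finset.sum_congr rfl fun x _ => Finset.sum_congr rfl fun y _ => ?_
      rw [map_mul, Complex.conj_ofReal, ← AddChar.map_neg_eq_conj]
      have : ∑ i, m i * (x - y) i = (∑ i, m i * x i) + -(∑ i, m i * y i) := by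
        exact dot_sub m x y
      rw [this, AddChar.map_add_eq_mul]; ring
    simp_rw [e1]
    rw [Finset.sum_comm, Finset.mul_sum]
    refine Finset.sum_congr rfl fun x _ => ?_
    rw [Finset.sum_comm]
    simp_rw [← Finset.mul_sum, orth ψ hψ, sub_eq_zero]
    simp
    ring
  exact_mod_cast h

lemma fourier_bound (ψ : AddChar F ℂ) (hψ : ψ ≠ 1) {n : ℕ} (R : (Fin n → F) → ℂ) (L : ℝ)
    (hR : ∀ m : Fin n → F, ‖∑ z, R z * ψ (-∑ i, m i * z i)‖ ≤ L) (f g : (Fin n → F) → ℝ) :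
    ‖∑ x, ∑ y, (f x : ℂ) * g y * R (x - y)‖ ≤
      L * Real.sqrt (∑ x, f x ^ 2) * Real.sqrt (∑ x, g x ^ 2) := by
  have hL : 0 ≤ L := (norm_nonneg _).trans (hR 0)
  set q : ℝ := (Fintype.card F : ℝ) ^ n with hq
  have hq0 : 0 < q := by
    have : 0 < (Fintype.card F : ℝ) := by exact_mod_cast Fintype.card_pos
    positivity
  set lam : (Fin n → F) → ℂ := fun m => ∑ z, R z * ψ (-∑ i, m i * z i) with hlam
  have inv : ∀ z, ∑ m, lam m * ψ (∑ i, m i * z i) = q * R z := by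
    intro z
    have e1 : ∀ m, lam m * ψ (∑ i, m i * z i) = ∑ y, R y * ψ (∑ i, m i * (z - y) i) := by
      intro m
      rw [hlam, Finset.sum_mul]
      refine Finset.sum_congr rfl fun y _ => ?_
      have : ∑ i, m i * (z - y) i = -(∑ i, m i * y i) + (∑ i, m i * z i) := by
        rw [dot_sub, add_comm]
      rw [this, AddChar.map_add_eq_mul]; ring
    simp_rw [e1]
    rw [Finset.sum_comm]
    simp_rw [← Finset.mul_sum, orth ψ hψ, sub_eq_zero]
    simp [hq]
    ring
  have key : (q : ℂ) * ∑ x, ∑ y, (f x : ℂ) * g y * R (x - y) =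
      ∑ m, lam m * ((∑ x, (f x : ℂ) * ψ (∑ i, m i * x i)) *
        (starRingEnd ℂ) (∑ y, (g y : ℂ) * ψ (∑ i, m i * y i))) := by
    have e2 : ∀ m, lam m * ((∑ x, (f x : ℂ) * ψ (∑ i, m i * x i)) *
        (starRingEnd ℂ) (∑ y, (g y : ℂ) * ψ (∑ i, m i * y i))) =
        ∑ x, ∑ y, (f x : ℂ) * g y * (lam m * ψ (∑ i, m i * (x - y) i)) := by
      intro m
      rw [map_sum, Finset.sum_mul_sum, Finset.mul_sum]
      refine Finset.sum_congr rfl fun x _ => ?_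
      rw [Finset.mul_sum]
      refine Finset.sum_congr rfl fun y _ => ?_
      rw [map_mul, Complex.conj_ofReal, ← AddChar.map_neg_eq_conj]
      have : ∑ i, m i * (x - y) i = (∑ i, m i * x i) + -(∑ i, m i * y i) := by
        exact dot_sub m x y
      rw [this, AddChar.map_add_eq_mul]; ring
    simp_rw [e2]
    rw [Finset.mul_sum]
    conv_rhs => rw [Finset.sum_comm]
    refine Finset.sum_congr rfl fun x _ => ?_
    rw [Finset.mul_sum]
    conv_rhs => rw [Finset.sum_comm]
    refine Finset.sum_congr rfl fun y _ => ?_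
    rw [← Finset.mul_sum, inv]; ring
  have hb : q * ‖∑ x, ∑ y, (f x : ℂ) * g y * R (x - y)‖ ≤
      q * (L * Real.sqrt (∑ x, f x ^ 2) * Real.sqrt (∑ x, g x ^ 2)) := by
    calc q * ‖∑ x, ∑ y, (f x : ℂ) * g y * R (x - y)‖
        = ‖(q : ℂ) * ∑ x, ∑ y, (f x : ℂ) * g y * R (x - y)‖ := by
          rw [norm_mul, Complex.norm_real, Real.norm_of_nonneg hq0.le]
      _ ≤ ∑ m : Fin n → F, L * (‖∑ x, (f x : ℂ) * ψ (∑ i, m i * x i)‖ *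
            ‖∑ y, (g y : ℂ) * ψ (∑ i, m i * y i)‖) := by
          rw [key]
          refine (norm_sum_le _ _).trans (Finset.sum_le_sum fun m _ => ?_)
          rw [norm_mul, norm_mul, RCLike.norm_conj]
          exact mul_le_mul_of_nonneg_right (hR m) (by positivity)
      _ ≤ L * (Real.sqrt (q * ∑ x, f x ^ 2) * Real.sqrt (q * ∑ x, g x ^ 2)) := by
          rw [← Finset.mul_sum, ← parseval ψ hψ f, ← parseval ψ hψ g]
          exact mul_le_mul_of_nonneg_left (Real.sum_mul_le_sqrt_mul_sqrt _ _ _) hL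
      _ = _ := by
          rw [Real.sqrt_mul hq0.le, Real.sqrt_mul hq0.le]
          linear_combination (L * Real.sqrt (∑ x, f x ^ 2) * Real.sqrt (∑ x, g x ^ 2)) *
            Real.mul_self_sqrt hq0.le
  exact le_of_mul_le_mul_left hb hq0

lemma indicator_eq (ψ : AddChar F ℂ) (hψ : ψ ≠ 1) (v : F) :
    (((if v = 0 then 1 else 0 : ℝ) - (Fintype.card F : ℝ)⁻¹ : ℝ) : ℂ) =
      (Fintype.card F : ℂ)⁻¹ * ∑ s ∈ univ.filter (fun s : F => s ≠ 0), ψ (s * v) := by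
  have h3 := sum_psi_shift ψ hψ v
  rw [← Finset.add_sum_erase _ _ (mem_univ (0 : F)), ← Finset.filter_ne', zero_mul,
    AddChar.map_zero_eq_one] at h3
  have hq : (Fintype.card F : ℂ) ≠ 0 := by exact_mod_cast Fintype.card_ne_zero
  rw [eq_sub_of_add_eq' h3]
  split_ifs <;> push_cast <;> field_simp <;> ring

lemma eigen_bound (p : ℕ) [Fact p.Prime] (hp3 : 3 ≤ p) [Algebra (ZMod p) F] {n : ℕ}
    (w : Fin n → F) (hw : ∀ i, w i ≠ 0) (t : F) (ht : t ≠ 0) (m : Fin n → F) :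
    ‖∑ z : Fin n → F, (((if (∑ i, w i * z i ^ 2) = t then 1 else 0 : ℝ) -
      (Fintype.card F : ℝ)⁻¹ : ℝ) : ℂ) * stdψ p F (-∑ i, m i * z i)‖ ≤
      (Fintype.card F : ℝ)⁻¹ * Real.sqrt (Fintype.card F) ^ n *
        (2 * Real.sqrt (Fintype.card F)) := by
  have hchar : CharP F p := charP_of_injective_algebraMap (algebraMap (ZMod p) F).injective p
  have h2 : ringChar F ≠ 2 := by rw [ringChar.eq F p]; omega
  have hψ := stdψ_ne_one p F
  set ψ := stdψ p F with hψdef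
  set G := gaussSum (eta F) ψ
  have h2' := four_ne (F := F) h2
  have h4 : (4 : F) ≠ 0 := by
    rw [show (4 : F) = 2 * 2 by norm_num]; exact mul_ne_zero h2' h2'
  have e : ∑ z : Fin n → F, (((if (∑ i, w i * z i ^ 2) = t then 1 else 0 : ℝ) -
      (Fintype.card F : ℝ)⁻¹ : ℝ) : ℂ) * ψ (-∑ i, m i * z i) =
      (Fintype.card F : ℂ)⁻¹ * (G ^ n * ∏ i, eta F (w i)) *
        ∑ s ∈ univ.filter (fun s : F => s ≠ 0),
          eta F s ^ n * ψ (-t * s + (-∑ i, m i ^ 2 / (4 * w i)) / s) := by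
    have e1 : ∀ z : Fin n → F, (((if (∑ i, w i * z i ^ 2) = t then 1 else 0 : ℝ) -
      (Fintype.card F : ℝ)⁻¹ : ℝ) : ℂ) * ψ (-∑ i, m i * z i) =
        ∑ s ∈ univ.filter (fun s : F => s ≠ 0), (Fintype.card F : ℂ)⁻¹ * (ψ (-t * s) *
          ∏ i, ψ (s * w i * z i ^ 2 - m i * z i)) := by
      intro z
      have := indicator_eq ψ hψ ((∑ i, w i * z i ^ 2) - t)
      simp only [sub_eq_zero] at this
      rw [this, mul_assoc, Finset.sum_mul, Finset.mul_sum]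
      refine Finset.sum_congr rfl fun s _ => ?_
      rw [← psi_sum, ← AddChar.map_add_eq_mul, ← AddChar.map_add_eq_mul,
        Finset.sum_sub_distrib]
      simp_rw [mul_assoc s]
      rw [← Finset.mul_sum]
      congr 2; ring
    simp_rw [e1]
    rw [Finset.sum_comm, Finset.mul_sum]
    refine Finset.sum_congr rfl fun s hs => ?_
    rw [mem_filter] at hs
    have hs0 := hs.2
    rw [← Finset.mul_sum, ← Finset.mul_sum,
      sum_prod_fun (fun i x => ψ (s * w i * x ^ 2 - m i * x))]
    simp_rw [gauss_quad_lin h2 ψ hψ (mul_ne_zero hs0 (hw _)), map_mul, Finset.prod_mul_distrib]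
    rw [← psi_sum, AddChar.map_add_eq_mul]
    have : ∑ i, -(m i ^ 2 / (4 * (s * w i))) = (-∑ i, m i ^ 2 / (4 * w i)) / s := by
      rw [neg_div, Finset.sum_div, ← Finset.sum_neg_distrib]
      refine Finset.sum_congr rfl fun i _ => ?_
      have := hw i
      field_simp
    rw [this]
    simp only [Finset.prod_const, Finset.card_univ, Fintype.card_fin]
    ring
  rw [e, norm_mul]
  refine mul_le_mul (le_of_eq ?_) (exp_bound p hp3 n (-t) _ (neg_ne_zero.2 ht)) (norm_nonneg _)
    (by positivity)
  rw [norm_mul, norm_mul, norm_pow, gauss_norm h2 ψ hψ, norm_prod,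
    Finset.prod_congr rfl (fun i _ => eta_norm (hw i))]
  simp

lemma spectral (p : ℕ) [Fact p.Prime] (hp3 : 3 ≤ p) [Algebra (ZMod p) F] {d : ℕ}
    (Q : QuadraticForm F (Fin d → F))
    (hQ : ∀ x, (∀ y, QuadraticMap.polar (⇑Q) x y = 0) → x = 0) (t : F) (ht : t ≠ 0)
    (f g : (Fin d → F) → ℝ) :
    |∑ x, ∑ y, f x * g y * ((if Q (x - y) = t then 1 else 0 : ℝ) - (Fintype.card F : ℝ)⁻¹)| ≤
      ((Fintype.card F : ℝ)⁻¹ * Real.sqrt (Fintype.card F) ^ d *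
        (2 * Real.sqrt (Fintype.card F))) *
        Real.sqrt (∑ x, f x ^ 2) * Real.sqrt (∑ x, g x ^ 2) := by
  have hchar : CharP F p := charP_of_injective_algebraMap (algebraMap (ZMod p) F).injective p
  have h2 : ringChar F ≠ 2 := by rw [ringChar.eq F p]; omega
  have h2' := four_ne (F := F) h2
  let _ : Invertible (2 : F) := invertibleOfNonzero h2'
  have hsep : (QuadraticMap.associated (R := F) Q).SeparatingLeft := by
    intro x hx
    apply hQ
    intro y
    have := hx y
    have h3 := congrArg (fun B => B x y) (QuadraticMap.two_nsmul_associated F (Q := Q))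
    simp only [LinearMap.smul_apply, this, smul_zero] at h3
    exact h3.symm
  obtain ⟨w, ⟨e⟩⟩ := QuadraticForm.equivalent_weightedSumSquares_units_of_nondegenerate' Q hsep
  have hfr : Module.finrank F (Fin d → F) = d := by simp
  revert w
  rw [hfr]
  intro w e
  have hQe : ∀ x, Q x = ∑ i, (w i : F) * (e x) i ^ 2 := by
    intro x
    rw [← e.map_app x, QuadraticMap.weightedSumSquares_apply]
    simp [Units.smul_def, sq]
  let E : (Fin d → F) ≃ (Fin d → F) := e.toLinearEquiv.toEquiv
  have hE : ∀ x, E x = e x := fun _ => rfl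
  have hb := fourier_bound (stdψ p F) (stdψ_ne_one p F)
    (fun z => (((if (∑ i, (w i : F) * z i ^ 2) = t then 1 else 0 : ℝ) -
      (Fintype.card F : ℝ)⁻¹ : ℝ) : ℂ)) _
    (eigen_bound p hp3 (fun i => (w i : F)) (fun i => (w i).ne_zero) t ht)
    (fun x => f (E.symm x)) (fun x => g (E.symm x))
  rw [← Equiv.sum_comp E] at hb
  simp_rw [← Equiv.sum_comp E (fun x => f (E.symm x) ^ 2),
    ← Equiv.sum_comp E (fun x => g (E.symm x) ^ 2)] at hb
  conv at hb =>
    lhs; arg 1; arg 2; ext x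
    rw [← Equiv.sum_comp E]
  simp only [Equiv.symm_apply_apply] at hb
  refine le_trans (le_of_eq ?_) hb
  rw [← Real.norm_eq_abs, ← Complex.norm_real]
  congr 1
  push_cast
  refine Finset.sum_congr rfl fun x _ => Finset.sum_congr rfl fun y _ => ?_
  rw [hQe (x - y)]
  have : e (x - y) = E x - E y := map_sub e.toLinearEquiv x y
  rw [this]
end Spec
end W13


namespace W13
section Tr
open Matrix
variable {ι : Type*} [Fintype ι] [DecidableEq ι]

lemma op_norm (R : Matrix ι ι ℝ) (L : ℝ) (hL : 0 ≤ L)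
    (H : ∀ v w : ι → ℝ, |v ⬝ᵥ R *ᵥ w| ≤ L * Real.sqrt (v ⬝ᵥ v) * Real.sqrt (w ⬝ᵥ w)) (w : ι → ℝ) :
    Real.sqrt ((R *ᵥ w) ⬝ᵥ (R *ᵥ w)) ≤ L * Real.sqrt (w ⬝ᵥ w) := by
  have h := H (R *ᵥ w) w
  have h0 : 0 ≤ (R *ᵥ w) ⬝ᵥ (R *ᵥ w) := by
    unfold dotProduct
    exact Finset.sum_nonneg fun i _ => mul_self_nonneg _
  rw [abs_of_nonneg h0] at h
  have h1 := Real.mul_self_sqrt h0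
  have h2 := Real.sqrt_nonneg ((R *ᵥ w) ⬝ᵥ (R *ᵥ w))
  have h3 := Real.sqrt_nonneg (w ⬝ᵥ w)
  set s := Real.sqrt ((R *ᵥ w) ⬝ᵥ (R *ᵥ w))
  set n := Real.sqrt (w ⬝ᵥ w)
  rcases h2.eq_or_lt with h4 | h4
  · rw [← h4]; positivity
  · rw [← h1] at h
    by_contra hc
    push Not at hc
    nlinarith

lemma pow_bound (R : Matrix ι ι ℝ) (L : ℝ) (hL : 0 ≤ L)
    (H : ∀ v w : ι → ℝ, |v ⬝ᵥ R *ᵥ w| ≤ L * Real.sqrt (v ⬝ᵥ v) * Real.sqrt (w ⬝ᵥ w)) (k : ℕ) :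
    ∀ v w : ι → ℝ, |v ⬝ᵥ (R ^ (k + 1)) *ᵥ w| ≤
      L ^ (k + 1) * Real.sqrt (v ⬝ᵥ v) * Real.sqrt (w ⬝ᵥ w) := by
  induction k with
  | zero => intro v w; simpa using H v w
  | succ k ih =>
    intro v w
    rw [pow_succ R (k + 1), ← Matrix.mulVec_mulVec]
    refine (ih v (R *ᵥ w)).trans ?_
    calc L ^ (k + 1) * Real.sqrt (v ⬝ᵥ v) * Real.sqrt ((R *ᵥ w) ⬝ᵥ (R *ᵥ w))
        ≤ L ^ (k + 1) * Real.sqrt (v ⬝ᵥ v) * (L * Real.sqrt (w ⬝ᵥ w)) := by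
          gcongr
          exact op_norm R L hL H w
      _ = _ := by ring

/-- tr of words -/
lemma trace_word (X Y : Matrix ι ι ℝ) (u : ι → ℝ) :
    (X * vecMulVec u u * Y).trace = u ⬝ᵥ (Y * X) *ᵥ u := by
  rw [Matrix.trace_mul_comm, ← Matrix.mul_assoc, Matrix.mul_vecMulVec, Matrix.trace_vecMulVec,
    dotProduct_comm]

lemma rec_word (R : Matrix ι ι ℝ) (c : ℝ) (u : ι → ℝ) (j k : ℕ) :
    u ⬝ᵥ (R ^ j * (c • vecMulVec u u + R) ^ (k + 1)) *ᵥ u =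
      c * (u ⬝ᵥ (R ^ 0 * (c • vecMulVec u u + R) ^ k) *ᵥ u) * (u ⬝ᵥ (R ^ j) *ᵥ u) +
      u ⬝ᵥ (R ^ (j + 1) * (c • vecMulVec u u + R) ^ k) *ᵥ u := by
  set A := c • vecMulVec u u + R with hA
  have h : R ^ j * A ^ (k + 1) = c • (R ^ j * vecMulVec u u * A ^ k) + R ^ (j + 1) * A ^ k := by
    rw [pow_succ' A k, pow_succ R j]
    conv_lhs => rw [hA, ← hA]
    rw [show A * A ^ k = (c • vecMulVec u u + R) * A ^ k from by rw [← hA]]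
    rw [add_mul, mul_add]
    simp only [smul_mul_assoc, mul_smul_comm, Matrix.mul_assoc]
  rw [h, Matrix.add_mulVec, dotProduct_add, Matrix.smul_mulVec, dotProduct_smul]
  congr 1
  rw [pow_zero, one_mul, ← Matrix.mulVec_mulVec, ← Matrix.mulVec_mulVec, Matrix.vecMulVec_mulVec]
  simp [Matrix.mulVec_smul, dotProduct_smul]
  ring

lemma trace_five (R : Matrix ι ι ℝ) (c : ℝ) (u : ι → ℝ) (r : ℕ → ℝ)
    (hr : ∀ k, r k = u ⬝ᵥ (R ^ k) *ᵥ u) :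
    ((c • vecMulVec u u + R) ^ 5).trace = c ^ 5 * r 0 ^ 5 + 5 * c ^ 4 * r 0 ^ 3 * r 1
      + 5 * c ^ 3 * r 0 ^ 2 * r 2 + 5 * c ^ 3 * r 0 * r 1 ^ 2 + 5 * c ^ 2 * r 0 * r 3
      + 5 * c ^ 2 * r 1 * r 2 + 5 * c * r 4 + (R ^ 5).trace := by
  have hrec := rec_word R c u
  have h0 : ∀ j, u ⬝ᵥ (R ^ j * (c • vecMulVec u u + R) ^ 0) *ᵥ u = r j := by
    intro j; rw [pow_zero, mul_one, hr]
  simp only [← hr] at hrec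
  set A := c • vecMulVec u u + R with hA
  have hJ : A - R = c • vecMulVec u u := by rw [hA]; abel
  have key : A ^ 5 = A ^ 0 * (A - R) * R ^ 4 + A ^ 1 * (A - R) * R ^ 3 + A ^ 2 * (A - R) * R ^ 2
      + A ^ 3 * (A - R) * R ^ 1 + A ^ 4 * (A - R) * R ^ 0 + R ^ 5 := by noncomm_ring
  have hw : ∀ j k, (A ^ k * (A - R) * R ^ j).trace = c * (u ⬝ᵥ (R ^ j * A ^ k) *ᵥ u) := by
    intro j k
    rw [hJ, mul_smul_comm, smul_mul_assoc, Matrix.trace_smul, trace_word]; rfl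
  rw [key]
  simp only [Matrix.trace_add, hw]
  simp only [hrec, h0, Nat.reduceAdd]
  ring

lemma trace_R5 (R : Matrix ι ι ℝ) (hs : Rᵀ = R) (L : ℝ) (hL : 0 ≤ L)
    (H : ∀ v w : ι → ℝ, |v ⬝ᵥ R *ᵥ w| ≤ L * Real.sqrt (v ⬝ᵥ v) * Real.sqrt (w ⬝ᵥ w)) :
    |(R ^ 5).trace| ≤ L ^ 3 * ∑ x, ∑ y, R x y ^ 2 := by
  have h1 : (R ^ 5).trace = ∑ x, (R x) ⬝ᵥ (R ^ 3) *ᵥ (R x) := by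
    rw [Matrix.trace]
    refine Finset.sum_congr rfl fun x _ => ?_
    rw [show R ^ 5 = R * (R ^ 3 * Rᵀ) by rw [hs]; noncomm_ring]
    rw [Matrix.diag_apply, Matrix.mul_apply]
    rfl
  rw [h1, Finset.mul_sum]
  refine (Finset.abs_sum_le_sum_abs _ _).trans (Finset.sum_le_sum fun x _ => ?_)
  refine (pow_bound R L hL H 2 (R x) (R x)).trans ?_
  have h0 : 0 ≤ (R x) ⬝ᵥ (R x) := Finset.sum_nonneg fun i _ => mul_self_nonneg _
  rw [mul_assoc, Real.mul_self_sqrt h0]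
  simp [dotProduct, sq]

/-- the main combinatorial estimate -/
lemma five_cycle (a : ι → ι → ℝ) (ha : ∀ x y, a x y = 0 ∨ a x y = 1) (hs : ∀ x y, a x y = a y x)
    (c L : ℝ) (hc : 0 ≤ c) (hc1 : c ≤ 1 / 2) (hL : 0 ≤ L)
    (H : ∀ v w : ι → ℝ, |∑ x, ∑ y, v x * w y * (a x y - c)| ≤
      L * Real.sqrt (∑ x, v x ^ 2) * Real.sqrt (∑ x, w x ^ 2)) :
    |∑ x, ∑ y, ∑ z, ∑ s, ∑ t, a x y * a y z * a z s * a s t * a t x -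
        (c * Fintype.card ι) ^ 5| ≤
      5 * (c * Fintype.card ι) ^ 4 * L + 10 * (c * Fintype.card ι) ^ 3 * L ^ 2
        + 10 * (c * Fintype.card ι) ^ 2 * L ^ 3 + 5 * (c * Fintype.card ι) * L ^ 4
        + L ^ 3 * (Fintype.card ι * (L + c * Fintype.card ι)) := by
  set N : ℝ := (Fintype.card ι : ℝ) with hN
  have hN0 : 0 ≤ N := by positivity
  let R : Matrix ι ι ℝ := fun x y => a x y - c
  let u : ι → ℝ := fun _ => 1
  have hR : Rᵀ = R := by
    ext x y
    show a y x - c = a x y - c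
    rw [hs x y]
  have hH : ∀ v w : ι → ℝ, |v ⬝ᵥ R *ᵥ w| ≤ L * Real.sqrt (v ⬝ᵥ v) * Real.sqrt (w ⬝ᵥ w) := by
    intro v w
    have := H v w
    simp only [sq] at this
    have e : v ⬝ᵥ R *ᵥ w = ∑ x, ∑ y, v x * w y * (a x y - c) := by
      simp only [dotProduct, mulVec, R, Finset.mul_sum]
      refine Finset.sum_congr rfl fun x _ => Finset.sum_congr rfl fun y _ => by ring
    rw [e]; exact this
  have huu : u ⬝ᵥ u = N := by simp [u, dotProduct, hN]
  let r : ℕ → ℝ := fun k => u ⬝ᵥ (R ^ k) *ᵥ u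
  have hr0 : r 0 = N := by simp only [r, pow_zero, Matrix.one_mulVec]; exact huu
  have hrk : ∀ k, |r (k + 1)| ≤ N * L ^ (k + 1) := by
    intro k
    have := pow_bound R L hL hH k u u
    rw [huu, mul_assoc, Real.mul_self_sqrt hN0, mul_comm] at this
    exact this
  have hA : (c • vecMulVec u u + R) = Matrix.of a := by
    ext x y
    show c * (1 * 1) + (a x y - c) = a x y
    ring
  have htr : ∑ x, ∑ y, ∑ z, ∑ s, ∑ t, a x y * a y z * a z s * a s t * a t x =
      ((c • vecMulVec u u + R) ^ 5).trace := by
    rw [hA, show (Matrix.of a) ^ 5 = Matrix.of a * (Matrix.of a * (Matrix.of a *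
      (Matrix.of a * Matrix.of a))) by noncomm_ring]
    simp only [Matrix.trace, Matrix.diag_apply, Matrix.mul_apply, Matrix.of_apply, Finset.mul_sum]
    simp only [mul_assoc]
  have h5 := trace_five R c u r (fun _ => rfl)
  have hHS : ∑ x, ∑ y, R x y ^ 2 ≤ N * (L + c * N) := by
    have e1 : ∀ x y, R x y ^ 2 = (1 - 2 * c) * R x y + (c - c ^ 2) := by
      intro x y
      rcases ha x y with h | h <;> simp only [R, h] <;> ring
    have e2 : r 1 = ∑ x, ∑ y, R x y := by
      simp [r, u, dotProduct, mulVec]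
    simp only [e1, Finset.sum_add_distrib, ← Finset.mul_sum, ← e2]
    simp only [Finset.sum_const, Finset.card_univ, nsmul_eq_mul, ← hN]
    have h1 := abs_le.1 (hrk 0)
    simp only [zero_add, pow_one] at h1
    have : (1 - 2 * c) * r 1 ≤ 1 * (N * L) :=
      (mul_le_mul_of_nonneg_left h1.2 (by linarith)).trans
        (mul_le_mul_of_nonneg_right (by linarith) (mul_nonneg hN0 hL))
    nlinarith [mul_nonneg hN0 hL, mul_nonneg hN0 hN0, mul_nonneg hc hc]
  have hT := (trace_R5 R hR L hL hH).trans (mul_le_mul_of_nonneg_left hHS (by positivity))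
  rw [htr, h5, hr0]
  have h1 := hrk 0
  have h2 := hrk 1
  have h3 := hrk 2
  have h4 := hrk 3
  simp only [Nat.reduceAdd, zero_add] at h1 h2 h3 h4
  have t1 : |5 * c ^ 4 * N ^ 3 * r 1| ≤ 5 * c ^ 4 * N ^ 3 * (N * L ^ 1) := by
    rw [abs_mul, abs_of_nonneg (by positivity)]; gcongr
  have t2 : |5 * c ^ 3 * N ^ 2 * r 2| ≤ 5 * c ^ 3 * N ^ 2 * (N * L ^ 2) := by
    rw [abs_mul, abs_of_nonneg (by positivity)]; gcongr
  have t3 : |5 * c ^ 3 * N * r 1 ^ 2| ≤ 5 * c ^ 3 * N * (N * L ^ 1) ^ 2 := by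
    rw [abs_mul, abs_of_nonneg (by positivity), abs_pow]; gcongr
  have t4 : |5 * c ^ 2 * N * r 3| ≤ 5 * c ^ 2 * N * (N * L ^ 3) := by
    rw [abs_mul, abs_of_nonneg (by positivity)]; gcongr
  have t5 : |5 * c ^ 2 * r 1 * r 2| ≤ 5 * c ^ 2 * (N * L ^ 1) * (N * L ^ 2) := by
    rw [abs_mul, abs_mul, abs_of_nonneg (show 0 ≤ 5 * c ^ 2 by positivity)]; gcongr
  have t6 : |5 * c * r 4| ≤ 5 * c * (N * L ^ 4) := by
    rw [abs_mul, abs_of_nonneg (by positivity)]; gcongr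
  rw [abs_le] at t1 t2 t3 t4 t5 t6 hT ⊢
  constructor <;> linarith [t1.1, t2.1, t3.1, t4.1, t5.1, t6.1, hT.1, t1.2, t2.2, t3.2, t4.2, t5.2, t6.2, hT.2]
end Tr
end W13


namespace W13

lemma count_eq {V : Type*} [Fintype V] [DecidableEq V] [AddCommGroup V] {F : Type*} [DecidableEq F]
    (Q : V → F) (t : F) (E : Finset V) :
    (Nat.card {x : Fin 5 → V // (∀ i, x i ∈ E) ∧
        Q (x 0 - x 1) = t ∧ Q (x 1 - x 2) = t ∧ Q (x 2 - x 3) = t ∧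
        Q (x 3 - x 4) = t ∧ Q (x 4 - x 0) = t} : ℝ) =
    ∑ x : {x // x ∈ E}, ∑ y : {x // x ∈ E}, ∑ z : {x // x ∈ E}, ∑ s : {x // x ∈ E},
      ∑ r : {x // x ∈ E},
      (if Q (x.1 - y.1) = t then 1 else 0 : ℝ) * (if Q (y.1 - z.1) = t then 1 else 0 : ℝ) *
      (if Q (z.1 - s.1) = t then 1 else 0 : ℝ) * (if Q (s.1 - r.1) = t then 1 else 0 : ℝ) *
      (if Q (r.1 - x.1) = t then 1 else 0 : ℝ) := by
  let W := {x // x ∈ E}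
  let e : {x : Fin 5 → V // (∀ i, x i ∈ E) ∧
        Q (x 0 - x 1) = t ∧ Q (x 1 - x 2) = t ∧ Q (x 2 - x 3) = t ∧
        Q (x 3 - x 4) = t ∧ Q (x 4 - x 0) = t} ≃
      {y : W × W × W × W × W // Q (y.1.1 - y.2.1.1) = t ∧ Q (y.2.1.1 - y.2.2.1.1) = t ∧
        Q (y.2.2.1.1 - y.2.2.2.1.1) = t ∧ Q (y.2.2.2.1.1 - y.2.2.2.2.1) = t ∧
        Q (y.2.2.2.2.1 - y.1.1) = t} :=
    { toFun := fun x => ⟨(⟨x.1 0, x.2.1 0⟩, ⟨x.1 1, x.2.1 1⟩, ⟨x.1 2, x.2.1 2⟩,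
        ⟨x.1 3, x.2.1 3⟩, ⟨x.1 4, x.2.1 4⟩), x.2.2⟩
      invFun := fun y => ⟨![y.1.1.1, y.1.2.1.1, y.1.2.2.1.1, y.1.2.2.2.1.1, y.1.2.2.2.2.1], by
        refine ⟨?_, y.2⟩
        intro i
        fin_cases i
        · exact y.1.1.2
        · exact y.1.2.1.2
        · exact y.1.2.2.1.2
        · exact y.1.2.2.2.1.2
        · exact y.1.2.2.2.2.2⟩
      left_inv := by
        intro x
        apply Subtype.ext
        funext i
        fin_cases i <;> rfl
      right_inv := by
        intro y
        rfl }
  rw [Nat.card_congr e, Nat.card_eq_fintype_card, Fintype.card_subtype, Finset.card_filter]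
  push_cast
  simp only [Fintype.sum_prod_type]
  refine Finset.sum_congr rfl fun x _ => Finset.sum_congr rfl fun y _ =>
    Finset.sum_congr rfl fun z _ => Finset.sum_congr rfl fun s _ =>
    Finset.sum_congr rfl fun r _ => ?_
  simp only [ite_and]
  split_ifs <;> simp

lemma numeric (N s P : ℝ) (hN : 0 ≤ N) (hs : 0 < s) (hP : 0 ≤ P)
    (h1 : 8 * (s ^ 2 * P ^ 2) / N ^ 2 ≤ 1) (h2 : 48 * P / N ≤ 1) (K L : ℝ) (hK : K = N / s ^ 2)
    (hL : L = 2 * P / s ^ 2) :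
    5 * K ^ 4 * L + 10 * K ^ 3 * L ^ 2 + 10 * K ^ 2 * L ^ 3 + 5 * K * L ^ 4
      + L ^ 3 * (N * (L + K)) ≤ K ^ 5 * (8 * (s * P ^ 2) / N ^ 2 + 32 * P / N) := by
  rcases hN.eq_or_lt with h0 | h0
  · rw [← h0] at hK ⊢
    simp [hK]
  set ρ := 2 * P / N with hρ
  have hρ0 : 0 ≤ ρ := by positivity
  have hρ1 : 24 * ρ ≤ 1 := by
    calc 24 * ρ = 48 * P / N := by rw [hρ]; ring
      _ ≤ 1 := h2
  have hsρ : 2 * (s * ρ) ^ 2 ≤ 1 := by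
    calc 2 * (s * ρ) ^ 2 = 8 * (s ^ 2 * P ^ 2) / N ^ 2 := by rw [hρ]; ring
      _ ≤ 1 := h1
  have hK0 : 0 ≤ K := by rw [hK]; positivity
  have eL : L = K * ρ := by rw [hL, hK, hρ]; field_simp
  have eN : N = K * s ^ 2 := by rw [hK]; field_simp
  have e1 : 8 * (s * P ^ 2) / N ^ 2 = 2 * s * ρ ^ 2 := by rw [hρ]; ring
  have e2 : 32 * P / N = 16 * ρ := by rw [hρ]; ring
  rw [e1, e2, eL]
  have eq : 5 * K ^ 4 * (K * ρ) + 10 * K ^ 3 * (K * ρ) ^ 2 + 10 * K ^ 2 * (K * ρ) ^ 3 +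
      5 * K * (K * ρ) ^ 4 + (K * ρ) ^ 3 * (N * (K * ρ + K)) =
      K ^ 5 * (s * ρ ^ 2 * ((s * ρ) * (1 + ρ)) + ρ * (5 + 10 * ρ + 10 * ρ ^ 2 + 5 * ρ ^ 3)) := by
    rw [eN]; ring
  rw [eq]
  have hx : s * ρ ≤ 1 := by
    have : 0 ≤ s * ρ := by positivity
    nlinarith
  have hy : (s * ρ) * (1 + ρ) ≤ 2 := by
    have : (s * ρ) * (1 + ρ) ≤ 1 * (1 + 1) := by gcongr; linarith
    linarith
  have hr1 : ρ ≤ 1 := by linarith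
  have hz : 5 + 10 * ρ + 10 * ρ ^ 2 + 5 * ρ ^ 3 ≤ 16 := by
    have a2 : ρ ^ 2 ≤ ρ := by nlinarith
    have a3 : ρ ^ 3 ≤ ρ := by nlinarith
    linarith
  have : s * ρ ^ 2 * ((s * ρ) * (1 + ρ)) + ρ * (5 + 10 * ρ + 10 * ρ ^ 2 + 5 * ρ ^ 3) ≤
      s * ρ ^ 2 * 2 + ρ * 16 := by gcongr
  calc _ ≤ K ^ 5 * (s * ρ ^ 2 * 2 + ρ * 16) := by gcongr
    _ = _ := by ring

lemma sum_ext {V : Type*} [Fintype V] (E : Finset V) (G : V → ℝ) (hG : ∀ x, x ∉ E → G x = 0) :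
    ∑ x, G x = ∑ x : {x // x ∈ E}, G x.1 := by
  rw [Finset.sum_coe_sort E G]
  exact (Finset.sum_subset (subset_univ E) (fun x _ hx => hG x hx)).symm
end W13

theorem stmt13 (q d : ℕ) (hd : 2 ≤ d)
    (F : Type) [Field F] [Fintype F]
    (hq : Fintype.card F = q) (hodd : Odd q)
    (Q : QuadraticForm F (Fin d → F))
    (hQ : ∀ x, (∀ y, QuadraticMap.polar (⇑Q) x y = 0) → x = 0)
    (t : F) (ht : t ≠ 0)
    (E : Finset (Fin d → F))
    (γ : ℝ) (hγ : γ = if d = 2 then -1 else -(((d : ℝ) - 2) / 2))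
    (hsize : 12 * (q : ℝ) ^ γ + 8 * (q : ℝ) ^ (d + 2) / (E.card : ℝ) ^ 2 +
        48 * (q : ℝ) ^ (((d : ℝ) + 1) / 2) / (E.card : ℝ) ≤ 1) :
    |(Nat.card {x : Fin 5 → (Fin d → F) // (∀ i, x i ∈ E) ∧
        Q (x 0 - x 1) = t ∧ Q (x 1 - x 2) = t ∧ Q (x 2 - x 3) = t ∧
        Q (x 3 - x 4) = t ∧ Q (x 4 - x 0) = t} : ℝ) -
        (E.card : ℝ) ^ 5 / (q : ℝ) ^ 5| ≤
      ((E.card : ℝ) ^ 5 / (q : ℝ) ^ 5) *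
        (12 * (q : ℝ) ^ γ + 8 * (q : ℝ) ^ ((2 * (d : ℝ) + 3) / 2) / (E.card : ℝ) ^ 2 +
          32 * (q : ℝ) ^ (((d : ℝ) + 1) / 2) / (E.card : ℝ)) := by
  classical
  obtain ⟨p, hp⟩ := CharP.exists F
  have hpp : p.Prime := CharP.char_is_prime F p
  haveI : Fact p.Prime := ⟨hpp⟩
  have hp3 : 3 ≤ p := by
    have h2 := hpp.two_le
    rcases h2.eq_or_lt with h | h
    · exfalso
      have : p ∣ Fintype.card F := by
        rw [← CharP.cast_eq_zero_iff F p]; exact Nat.cast_card_eq_zero F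
      rw [hq, ← h] at this
      obtain ⟨k, hk⟩ := hodd
      omega
    · exact h
  letI : Algebra (ZMod p) F := ZMod.algebra F p
  have hq2 : 2 ≤ q := by rw [← hq]; exact Fintype.one_lt_card
  have hq0 : (0 : ℝ) < q := by exact_mod_cast (by omega : 0 < q)
  set N : ℝ := (E.card : ℝ) with hN
  have hN0 : 0 ≤ N := by positivity
  set s := Real.sqrt q with hs
  have hs0 : 0 < s := Real.sqrt_pos.2 hq0
  have hss : s ^ 2 = q := Real.sq_sqrt hq0.le
  have hpow : ∀ k : ℕ, (q : ℝ) ^ ((k : ℝ) / 2) = s ^ k := by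
    intro k
    rw [hs, Real.sqrt_eq_rpow, ← Real.rpow_natCast, ← Real.rpow_mul hq0.le]
    congr 1; ring
  have e1 : (q : ℝ) ^ (((d : ℝ) + 1) / 2) = s ^ (d + 1) := by rw [← hpow]; push_cast; rfl
  have e2 : (q : ℝ) ^ ((2 * (d : ℝ) + 3) / 2) = s * (s ^ (d + 1)) ^ 2 := by
    rw [show s * (s ^ (d + 1)) ^ 2 = s ^ (2 * d + 3) by ring, ← hpow]; push_cast; rfl
  have e3 : (q : ℝ) ^ (d + 2) = s ^ 2 * (s ^ (d + 1)) ^ 2 := by rw [← hss]; ring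
  have hγ0 : 0 ≤ 12 * (q : ℝ) ^ γ := by positivity
  rw [e1, e3] at hsize
  rw [e1, e2]
  set P := s ^ (d + 1) with hP
  have hP0 : 0 ≤ P := by positivity
  have a1 : 0 ≤ 8 * (s ^ 2 * P ^ 2) / N ^ 2 := by positivity
  have a2 : 0 ≤ 48 * P / N := by positivity
  set L := (q : ℝ)⁻¹ * s ^ d * (2 * s) with hL
  have hLP : L = 2 * P / s ^ 2 := by rw [hL, hP, hss]; ring
  have hnum := W13.numeric N s P hN0 hs0 hP0 (by linarith) (by linarith) (N / s ^ 2) L rfl hLP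
  have hcN : (q : ℝ)⁻¹ * (Fintype.card {x // x ∈ E} : ℝ) = N / s ^ 2 := by
    rw [hss, Fintype.card_coe, hN]; ring
  have main := W13.five_cycle (ι := {x // x ∈ E})
    (fun x y => if Q (x.1 - y.1) = t then 1 else 0) (by intro x y; split_ifs <;> simp)
    (by
      intro x y
      rw [← neg_sub y.1 x.1, QuadraticMap.map_neg]) (q : ℝ)⁻¹ L (by positivity)
    (by
      rw [one_div]
      exact inv_anti₀ (by norm_num) (by exact_mod_cast hq2)) (by positivity)
    (by
      intro v w
      have hsp := W13.spectral p hp3 Q hQ t ht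
        (fun x => if h : x ∈ E then v ⟨x, h⟩ else 0) (fun x => if h : x ∈ E then w ⟨x, h⟩ else 0)
      rw [hq, ← hs, ← hL] at hsp
      refine le_trans (le_of_eq ?_) (hsp.trans (le_of_eq ?_))
      · rw [W13.sum_ext E _ (by intro x hx; simp [hx])]
        congr 1
        refine Finset.sum_congr rfl fun x _ => ?_
        rw [W13.sum_ext E _ (by intro y hy; simp [hy])]
        refine Finset.sum_congr rfl fun y _ => ?_
        simp
      · rw [W13.sum_ext E _ (by intro x hx; simp [hx]), W13.sum_ext E _ (by intro x hx; simp [hx])]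
        simp)
  rw [hcN, Fintype.card_coe, ← hN] at main
  rw [W13.count_eq (fun x => Q x) t E]
  have eK : N ^ 5 / (q : ℝ) ^ 5 = (N / s ^ 2) ^ 5 := by rw [hss, div_pow]
  rw [eK]
  refine main.trans (hnum.trans ?_)
  exact mul_le_mul_of_nonneg_left (by linarith) (pow_nonneg (div_nonneg hN0 (sq_nonneg s)) 5)
end
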